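/- Let $K$ be an algebraic number field of degree $n$ with $2 \leq n \leq 6$. Then for every $\varepsilon \in (0, 1/2)$ there exists a constant $C > 0$ (depending on $K$ and $\varepsilon$) such that for all real $x \geq d_K^{1/2}$ sufficiently large, $\left| \frac{1}{x} \int_1^x \left( \sum_{m \leq t} r_K(m) - \kappa_K t \right) \mathrm{d}t \right| \leq C\, x^{3/4 - 3/(2n) + \varepsilon}$. -/

import Mathlib

open NumberField Filter Asymptotics Set MeasureTheory

/-- `rK K m` is the number of nonzero integral ideals of the ring of integers of `K`
with absolute norm equal to `m` (for `m ≥ 1` the nonzero condition is automatic). -/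
noncomputable def rK (K : Type*) [Field K] [NumberField K] (m : ℕ) : ℕ :=
  Nat.card {I : Ideal (𝓞 K) // Ideal.absNorm I = m}

/-- The exponential integral `E₁(X) = ∫_X^∞ e^{-t}/t dt`. -/
noncomputable def E1 (X : ℝ) : ℝ := ∫ t in Set.Ioi X, Real.exp (-t) / t

namespace IdealMean

section Local

set_option linter.unusedSectionVars false

open scoped FourierTransform RealInnerProductSpace ContDiff
open Module

variable {E : Type*} [NormedAddCommGroup E] [InnerProductSpace ℝ E] [FiniteDimensional ℝ E]
  [MeasurableSpace E] [BorelSpace E]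

/-- The unimodular character `z ↦ ‖z‖ ^ (is)`. -/
noncomputable def normChar {E : Type*} [NormedAddCommGroup E] (s : ℝ) (z : E) : ℂ :=
  Complex.exp ((s * Real.log ‖z‖ : ℝ) * Complex.I)

/-- Smooth compactly supported functions vanishing near the origin. -/
structure IsTest (χ : E → ℂ) : Prop where
  contDiff : ContDiff ℝ ∞ χ
  hasCompactSupport : HasCompactSupport χ
  zero_notMem : (0 : E) ∉ tsupport χ

/-- The Fourier transform of `χ z * ‖z‖ ^ (is)`. -/
noncomputable def oscInt (χ : E → ℂ) (s : ℝ) (ξ : E) : ℂ :=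
  𝓕 (fun z => χ z * normChar s z) ξ

@[simp] lemma norm_normChar (s : ℝ) (z : E) : ‖normChar s z‖ = 1 :=
  Complex.norm_exp_ofReal_mul_I _

lemma contDiffOn_normChar (s : ℝ) : ContDiffOn ℝ ∞ (normChar (E := E) s) {0}ᶜ := by
  intro z hz
  have hz' : z ≠ 0 := hz
  refine ContDiffAt.contDiffWithinAt ?_
  unfold normChar
  have h1 : ContDiffAt ℝ ∞ (fun z : E => s * Real.log ‖z‖) z :=
    contDiffAt_const.mul ((contDiffAt_norm ℝ hz').log (norm_ne_zero_iff.2 hz'))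
  have h2 : ContDiffAt ℝ ∞ (fun z : E => ((s * Real.log ‖z‖ : ℝ) : ℂ)) z :=
    Complex.ofRealCLM.contDiff.contDiffAt.comp z h1
  exact (h2.mul contDiffAt_const).cexp

namespace IsTest

variable {χ : E → ℂ}

lemma mul (h : IsTest χ) {f : E → ℂ} (hf : ContDiffOn ℝ ∞ f {0}ᶜ) :
    IsTest (fun z => χ z * f z) := by
  have hsub : tsupport (fun z => χ z * f z) ⊆ tsupport χ := tsupport_mul_subset_left
  refine ⟨?_, h.hasCompactSupport.mul_right, fun h0 => h.zero_notMem (hsub h0)⟩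
  rw [contDiff_iff_contDiffAt]
  intro z
  by_cases hz : z ∈ tsupport fun z => χ z * f z
  swap
  · exact contDiffAt_const.congr_of_eventuallyEq (notMem_tsupport_iff_eventuallyEq.1 hz)
  have hz0 : z ≠ 0 := fun h0 => h.zero_notMem (h0 ▸ hsub hz)
  exact h.contDiff.contDiffAt.mul (hf.contDiffAt (isOpen_compl_singleton.mem_nhds hz0))

lemma fderiv (h : IsTest χ) (v : E) : IsTest (fun z => fderiv ℝ χ z v) := by
  have hsub : tsupport (fun z => _root_.fderiv ℝ χ z v) ⊆ tsupport χ := tsupport_fderiv_apply_subset ℝ v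
  exact ⟨(h.contDiff.fderiv_right (m := ∞) (by simp)).clm_apply contDiff_const,
    h.hasCompactSupport.fderiv_apply (𝕜 := ℝ) v, fun h0 => h.zero_notMem (hsub h0)⟩

lemma normChar (h : IsTest χ) (s : ℝ) : IsTest (fun z => χ z * normChar s z) :=
  h.mul (contDiffOn_normChar s)

lemma integrable (h : IsTest χ) : Integrable χ :=
  h.contDiff.continuous.integrable_of_hasCompactSupport h.hasCompactSupport

end IsTest

lemma fourier_fderiv_apply {χ : E → ℂ} (h : IsTest χ) (v ξ : E) :
    𝓕 (fun z => fderiv ℝ χ z v) ξ = 2 * Real.pi * Complex.I * ⟪v, ξ⟫ * 𝓕 χ ξ := by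
  have h1 : ContDiff ℝ 1 χ := h.contDiff.of_le (by exact_mod_cast le_top)
  have hd : Integrable (fderiv ℝ χ) :=
    (h1.continuous_fderiv one_ne_zero).integrable_of_hasCompactSupport
      (h.hasCompactSupport.fderiv (𝕜 := ℝ))
  have := Real.fourier_fderiv h.integrable (h1.differentiable one_ne_zero) hd
  have h2 := congrArg (fun T => T v) (congrFun this ξ)
  rw [Real.fourier_continuousLinearMap_apply hd] at h2
  rw [h2]
  have e : innerSL ℝ ξ v = ⟪v, ξ⟫ := by rw [innerSL_apply_apply, real_inner_comm]
  simp only [VectorFourier.fourierSMulRight_apply, _root_.neg_apply,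
    smul_eq_mul, neg_smul, Complex.real_smul, e]
  ring

lemma fderiv_normChar (s : ℝ) {z : E} (hz : z ≠ 0) (v : E) :
    fderiv ℝ (normChar s) z v =
      Complex.I * s * ((⟪z, v⟫ / ‖z‖ ^ 2 : ℝ) : ℂ) * normChar s z := by
  have hz2 : ‖z‖ ^ 2 ≠ 0 := pow_ne_zero _ (norm_ne_zero_iff.2 hz)
  have h0 : HasFDerivAt (fun z : E => ‖z‖ ^ 2) (2 • innerSL ℝ z) z :=
    (hasStrictFDerivAt_norm_sq z).hasFDerivAt
  have h1 : HasFDerivAt (fun z : E => s * Real.log ‖z‖) ((s / 2 * (‖z‖ ^ 2)⁻¹) • (2 • innerSL ℝ z)) z := by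
    have := (h0.log hz2).const_mul (s / 2)
    refine (this.congr_of_eventuallyEq (Eventually.of_forall fun w => ?_)).congr_fderiv ?_
    · simp [Real.log_pow]; ring
    · rw [smul_smul]
  have h2 := (Complex.ofRealCLM.hasFDerivAt.comp z h1).mul_const Complex.I
  have h3 := h2.cexp
  have h4 : HasFDerivAt (normChar s) _ z := h3
  rw [h4.fderiv]
  simp only [normChar, _root_.smul_apply, ContinuousLinearMap.comp_apply,
    Complex.ofRealCLM_apply, innerSL_apply_apply, smul_eq_mul, Function.comp_apply]
  push_cast
  ring

lemma oscInt_ibp {χ : E → ℂ} (h : IsTest χ) (s : ℝ) (v ξ : E) :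
    2 * Real.pi * Complex.I * ⟪v, ξ⟫ * oscInt χ s ξ =
      oscInt (fun z => fderiv ℝ χ z v) s ξ +
        Complex.I * s * oscInt (fun z => χ z * ((⟪z, v⟫ / ‖z‖ ^ 2 : ℝ) : ℂ)) s ξ := by
  have h1 := fourier_fderiv_apply (h.normChar s) v ξ
  unfold oscInt
  rw [← h1]
  have hχ : IsTest (fun z => χ z * ((⟪z, v⟫ / ‖z‖ ^ 2 : ℝ) : ℂ)) := by
    refine h.mul ?_
    refine Complex.ofRealCLM.contDiff.comp_contDiffOn (ContDiffOn.div ?_ ?_ ?_)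
    · exact (contDiff_id.inner ℝ contDiff_const).contDiffOn
    · exact (contDiff_norm_sq ℝ).contDiffOn
    · intro z hz
      exact pow_ne_zero _ (norm_ne_zero_iff.2 hz)
  simp only [Real.fourier_eq]
  rw [← integral_const_mul, ← integral_add]
  · refine integral_congr_ae (Eventually.of_forall fun z => ?_)
    by_cases hz : z = 0
    · subst hz
      have e0 : χ =ᶠ[nhds 0] 0 := notMem_tsupport_iff_eventuallyEq.1 h.zero_notMem
      have e1 : (fun z => χ z * normChar s z) =ᶠ[nhds 0] 0 := by
        filter_upwards [e0] with w hw
        simp [hw]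
      simp [e0.fderiv_eq, e1.fderiv_eq, e0.self_of_nhds]
    · have hd1 : DifferentiableAt ℝ χ z := h.contDiff.differentiable (by simp) z
      have hd2 : DifferentiableAt ℝ (normChar s) z :=
        ((contDiffOn_normChar s).contDiffAt
          (isOpen_compl_singleton.mem_nhds hz)).differentiableAt (by simp)
      have e : fderiv ℝ (fun z => χ z * normChar s z) z v =
          χ z * fderiv ℝ (normChar s) z v + normChar s z * fderiv ℝ χ z v := by
        rw [fderiv_fun_mul hd1 hd2]; simp
      simp only [e, fderiv_normChar s hz, Circle.smul_def, smul_eq_mul]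
      ring
  · exact (Real.fourierIntegral_convergent_iff ξ).2 ((h.fderiv v).normChar s).integrable
  · exact ((Real.fourierIntegral_convergent_iff ξ).2 (hχ.normChar s).integrable).const_mul _

end Local

section Mellin

open scoped FourierTransform RealInnerProductSpace ContDiff SchwartzMap
open Module

variable {E : Type*} [NormedAddCommGroup E] [InnerProductSpace ℝ E] [FiniteDimensional ℝ E]
  [MeasurableSpace E] [BorelSpace E]

/-- Integrability against the singular weight `‖η‖ ^ (-a)`, with a uniform bound. -/
lemma exists_weight_bound {a : ℝ} (ha0 : 0 ≤ a) (ha : a < finrank ℝ E) :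
    ∃ c, 0 ≤ c ∧ ∀ (H : E → ℝ) (M : ℝ), (∀ η, 0 ≤ H η) → (∀ η, H η ≤ M) → Integrable H →
      Integrable (fun η => ‖η‖ ^ (-a) * H η) ∧ ∫ η, ‖η‖ ^ (-a) * H η ≤ c * M + ∫ η, H η := by
  have hd : 1 ≤ finrank ℝ E := by
    have : (0 : ℝ) < finrank ℝ E := ha0.trans_lt ha
    exact_mod_cast this
  have hmeas : Measurable (fun η : E => ‖η‖ ^ (-a)) := measurable_norm.pow_const _
  have hInt : IntegrableOn (fun η : E => ‖η‖ ^ (-a)) (Metric.ball 0 1) :=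
    integrableOn_ball_of_norm_le_rpow (C := 1) (α := a) hd ha
      (Eventually.of_forall fun x => by
        rw [Real.norm_of_nonneg (by positivity), one_mul]) hmeas.aestronglyMeasurable
  have hInt' := hInt.integrable_indicator Metric.isOpen_ball.measurableSet
  refine ⟨∫ η, (Metric.ball (0 : E) 1).indicator (fun η : E => ‖η‖ ^ (-a)) η,
    integral_nonneg fun η => indicator_nonneg (fun _ _ => by positivity) _, fun H M h0 hM hH => ?_⟩
  have hle : ∀ η, ‖η‖ ^ (-a) * H η ≤
      (Metric.ball (0 : E) 1).indicator (fun η : E => ‖η‖ ^ (-a)) η * M + H η := by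
    intro η
    by_cases hη : η ∈ Metric.ball (0 : E) 1
    · rw [indicator_of_mem hη]
      have : ‖η‖ ^ (-a) * H η ≤ ‖η‖ ^ (-a) * M := by gcongr; exact hM η
      linarith [h0 η]
    · rw [indicator_of_notMem hη]
      have h1 : 1 ≤ ‖η‖ := by simpa using hη
      have : ‖η‖ ^ (-a) ≤ 1 := Real.rpow_le_one_of_one_le_of_nonpos h1 (by linarith)
      nlinarith [h0 η]
  have hInt2 := (hInt'.mul_const M).add hH
  have hI : Integrable (fun η => ‖η‖ ^ (-a) * H η) :=
    hInt2.mono (hmeas.aestronglyMeasurable.mul hH.1) (Eventually.of_forall fun η => by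
      have h2 : 0 ≤ ‖η‖ ^ (-a) * H η := mul_nonneg (by positivity) (h0 η)
      rw [Real.norm_of_nonneg h2]
      exact (hle η).trans (le_abs_self _))
  refine ⟨hI, ?_⟩
  rw [← integral_mul_const, ← integral_add (hInt'.mul_const M) hH]
  exact integral_mono hI hInt2 hle

lemma mellin_gaussian_integral {p : ℂ} (hp : 0 < p.re) (hp' : 2 * p.re < finrank ℝ E)
    {G : E → ℂ} (hG : Integrable G) {M : ℝ} (hM : ∀ η, ‖G η‖ ≤ M) :
    mellin (fun y => ∫ η, Complex.exp (-(((Real.pi * ‖η‖ ^ 2 : ℝ) : ℂ) * y)) * G η) p =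
      Complex.Gamma p * ∫ η, (1 / ((Real.pi * ‖η‖ ^ 2 : ℝ) : ℂ)) ^ p * G η := by
  have hd : 1 ≤ finrank ℝ E := by
    have : (0 : ℝ) < finrank ℝ E := by linarith
    exact_mod_cast this
  have : Nontrivial E := Module.nontrivial_of_finrank_pos (R := ℝ) hd
  unfold mellin
  simp only [smul_eq_mul]
  have h1 : ∀ t : ℝ, (t : ℂ) ^ (p - 1) *
      ∫ η, Complex.exp (-(((Real.pi * ‖η‖ ^ 2 : ℝ) : ℂ) * t)) * G η =
      ∫ η, (t : ℂ) ^ (p - 1) * Complex.exp (-(((Real.pi * ‖η‖ ^ 2 : ℝ) : ℂ) * t)) * G η := by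
    intro t
    rw [← integral_const_mul]
    simp only [mul_assoc]
  have hne : ∀ᵐ η : E, η ≠ 0 := by
    simp [ae_iff, measure_singleton]
  have hpos : ∀ η : E, η ≠ 0 → 0 < Real.pi * ‖η‖ ^ 2 := fun η hη => by
    have := norm_pos_iff.2 hη
    positivity
  simp_rw [h1]
  rw [integral_integral_swap, ← integral_const_mul]
  · refine integral_congr_ae (hne.mono fun η hη => ?_)
    have := Complex.integral_cpow_mul_exp_neg_mul_Ioi hp (hpos η hη)
    simp only []
    rw [integral_mul_const, this]
    ring
  · have hmeas : AEStronglyMeasurable (Function.uncurry fun (t : ℝ) (η : E) =>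
        (t : ℂ) ^ (p - 1) * Complex.exp (-(((Real.pi * ‖η‖ ^ 2 : ℝ) : ℂ) * t)) * G η)
        ((volume.restrict (Ioi 0)).prod volume) := by
      refine AEStronglyMeasurable.mul ?_ (hG.1.comp_snd)
      refine Measurable.aestronglyMeasurable ?_
      refine Measurable.mul ?_ ?_
      · exact (Complex.measurable_ofReal.comp measurable_fst).pow_const _
      · refine Continuous.measurable ?_
        fun_prop
    rw [integrable_prod_iff' hmeas]
    have hnorm : ∀ η : E, ∀ t ∈ Ioi (0 : ℝ), ‖(t : ℂ) ^ (p - 1) *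
        Complex.exp (-(((Real.pi * ‖η‖ ^ 2 : ℝ) : ℂ) * t)) * G η‖ =
        t ^ (p.re - 1) * Real.exp (-(Real.pi * ‖η‖ ^ 2 * t)) * ‖G η‖ := by
      intro η t ht
      rw [norm_mul, norm_mul, Complex.norm_cpow_eq_rpow_re_of_pos ht, Complex.norm_exp]
      simp [← Complex.ofReal_mul]
    constructor
    · refine hne.mono fun η hη => ?_
      have h2 : IntegrableOn (fun t : ℝ => t ^ (p.re - 1) * Real.exp (-(Real.pi * ‖η‖ ^ 2 * t)))
          (Ioi 0) := by
        have := integrableOn_rpow_mul_exp_neg_mul_rpow (p := 1) (s := p.re - 1)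
          (b := Real.pi * ‖η‖ ^ 2) (by linarith) one_pos (hpos η hη)
        simpa using this
      refine (integrable_norm_iff ?_).1 ?_
      · simp only [Function.uncurry]
        refine AEStronglyMeasurable.mul_const ?_ _
        refine Measurable.aestronglyMeasurable (Measurable.mul ?_ ?_)
        · exact Complex.measurable_ofReal.pow_const _
        · refine Continuous.measurable ?_
          fun_prop
      · refine (h2.mul_const ‖G η‖).congr ?_
        refine (ae_restrict_mem measurableSet_Ioi).mono fun t ht => ?_
        exact (hnorm η t ht).symm
    · obtain ⟨c, -, hc⟩ := exists_weight_bound (E := E) (a := 2 * p.re) (by linarith) hp'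
      have h3 := (hc (fun η => ‖G η‖) M (fun _ => norm_nonneg _) hM hG.norm).1.const_mul
        (Real.Gamma p.re * Real.pi ^ (-p.re))
      refine h3.congr (hne.mono fun η hη => ?_)
      simp only [Function.uncurry]
      rw [setIntegral_congr_fun measurableSet_Ioi (hnorm η), integral_mul_const,
        Real.integral_rpow_mul_exp_neg_mul_Ioi hp (hpos η hη)]
      have h4 := norm_pos_iff.2 hη
      rw [one_div, Real.inv_rpow (by positivity), Real.mul_rpow Real.pi_pos.le (by positivity),
        Real.rpow_neg Real.pi_pos.le, Real.rpow_neg h4.le, ← Real.rpow_natCast ‖η‖ 2, ← Real.rpow_mul h4.le]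
      push_cast
      rw [mul_inv]
      ring

/-- The functional equation of the local zeta integrals of Schwartz functions. -/
lemma schwartz_functional_equation (G : 𝓢(E, ℂ)) {p q : ℂ} (hp : 0 < p.re) (hq : 0 < q.re)
    (hpq : p + q = (finrank ℝ E : ℂ) / 2) :
    Complex.Gamma p * ∫ η, (1 / ((Real.pi * ‖η‖ ^ 2 : ℝ) : ℂ)) ^ p * (𝓕 G) η =
      Complex.Gamma q * ∫ η, (1 / ((Real.pi * ‖η‖ ^ 2 : ℝ) : ℂ)) ^ q * G η := by
  have hre : p.re + q.re = (finrank ℝ E : ℝ) / 2 := by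
    have := congrArg Complex.re hpq
    simpa using this
  have hbd : ∀ G : 𝓢(E, ℂ), ∃ M, ∀ η, ‖G η‖ ≤ M := fun G => by
    obtain ⟨M, -, hM⟩ := G.decay 0 0
    exact ⟨M, fun η => by simpa using hM η⟩
  obtain ⟨M, hM⟩ := hbd G
  obtain ⟨M', hM'⟩ := hbd (𝓕 G)
  rw [← mellin_gaussian_integral hp (by linarith) (𝓕 G).integrable hM',
    ← mellin_gaussian_integral hq (by linarith) G.integrable hM]
  have hq' : q = -(p + -((finrank ℝ E : ℂ) / 2)) := by rw [← hpq]; ring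
  conv_rhs => rw [hq', ← mellin_comp_inv, ← mellin_cpow_smul]
  unfold mellin
  refine setIntegral_congr_fun measurableSet_Ioi fun t ht => ?_
  have ht0 : (0 : ℝ) < t := ht
  simp only [smul_eq_mul]
  congr 1
  have h1 : ∫ η, 𝓕 (fun v : E => Complex.exp (-(((Real.pi * t : ℝ) : ℂ)) * ‖v‖ ^ 2)) η * G η =
      ∫ η, Complex.exp (-(((Real.pi * t : ℝ) : ℂ)) * ‖η‖ ^ 2) * 𝓕 (G : E → ℂ) η := by
    have hre : 0 < ((Real.pi * t : ℝ) : ℂ).re := by rw [Complex.ofReal_re]; positivity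
    have hInt : Integrable (fun v : E => Complex.exp (-(((Real.pi * t : ℝ) : ℂ)) * ‖v‖ ^ 2)) := by
      have := GaussianFourier.integrable_cexp_neg_mul_sq_norm_add hre 0 (0 : E)
      simpa using this
    have := VectorFourier.integral_bilin_fourierIntegral_eq_flip (.mul ℂ ℂ) (L := innerₗ E)
        Real.continuous_fourierChar continuous_inner hInt
        (G.integrable (μ := volume))
    simpa using! this
  have h2 : ∀ η : E, Complex.exp (-(((Real.pi * ‖η‖ ^ 2 : ℝ) : ℂ) * t)) * (𝓕 G) η =
      Complex.exp (-(((Real.pi * t : ℝ) : ℂ)) * ‖η‖ ^ 2) * 𝓕 (G : E → ℂ) η := by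
    intro η
    rw [← SchwartzMap.fourier_coe]
    congr 2
    push_cast
    ring
  simp only [h2]
  rw [← h1, ← integral_const_mul]
  congr 1 with η
  rw [fourier_gaussian_innerProductSpace (by rw [Complex.ofReal_re]; positivity)]
  rw [← mul_assoc]
  congr 1
  have hpi : (Real.pi : ℂ) ≠ 0 := by exact_mod_cast Real.pi_ne_zero
  have htc : (t : ℂ) ≠ 0 := by exact_mod_cast ht0.ne'
  congr 1
  · have : (Real.pi : ℂ) / ((Real.pi * t : ℝ) : ℂ) = ((t⁻¹ : ℝ) : ℂ) := by
      push_cast; field_simp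
    rw [this, Complex.ofReal_inv, Complex.inv_cpow, Complex.cpow_neg]
    rw [Complex.arg_ofReal_of_nonneg ht0.le]
    exact Real.pi_pos.ne
  · congr 1
    push_cast
    field_simp

end Mellin

section LocalDecay

open scoped FourierTransform RealInnerProductSpace ContDiff SchwartzMap
open Module

variable {E : Type*} [NormedAddCommGroup E] [InnerProductSpace ℝ E] [FiniteDimensional ℝ E]
  [MeasurableSpace E] [BorelSpace E]

lemma norm_oscInt_le_integral {χ : E → ℂ} (h : IsTest χ) (hd : 1 ≤ finrank ℝ E) :
    ∃ g : 𝓢(E, ℂ), ∀ s ξ, ‖oscInt χ s ξ‖ ≤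
      ∫ η, ‖η‖ ^ (-((finrank ℝ E : ℝ) / 2)) * ‖g (η - ξ)‖ := by
  set d : ℝ := (finrank ℝ E : ℝ) with hd_def
  have hdpos : 0 < d := by rw [hd_def]; exact_mod_cast hd
  have hw : IsTest (fun z => χ z * ((‖z‖ ^ (d / 2) : ℝ) : ℂ)) := by
    refine h.mul (Complex.ofRealCLM.contDiff.comp_contDiffOn fun z hz => ?_)
    have hz' : z ≠ 0 := hz
    exact ((contDiffAt_norm ℝ hz').rpow_const_of_ne (norm_ne_zero_iff.2 hz')).contDiffWithinAt
  have hξ : ∀ ξ : E, IsTest (fun z => χ z * ((‖z‖ ^ (d / 2) : ℝ) : ℂ) *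
      Complex.exp (((-(2 * Real.pi * ⟪z, ξ⟫) : ℝ) : ℂ) * Complex.I)) := fun ξ => by
    refine hw.mul (ContDiff.contDiffOn ?_)
    refine ContDiff.cexp (ContDiff.mul ?_ contDiff_const)
    refine Complex.ofRealCLM.contDiff.comp ?_
    exact (contDiff_const.mul (contDiff_id.inner ℝ contDiff_const)).neg
  let S : E → 𝓢(E, ℂ) := fun ξ => (hξ ξ).hasCompactSupport.toSchwartzMap (hξ ξ).contDiff
  have hS : ∀ ξ z, S ξ z = χ z * ((‖z‖ ^ (d / 2) : ℝ) : ℂ) *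
      Complex.exp (((-(2 * Real.pi * ⟪z, ξ⟫) : ℝ) : ℂ) * Complex.I) := fun ξ z => rfl
  refine ⟨𝓕⁻ (S 0), fun s ξ => ?_⟩
  have hshift : ∀ η, (𝓕⁻ (S ξ)) η = (𝓕⁻ (S 0)) (η - ξ) := by
    intro η
    rw [SchwartzMap.fourierInv_coe, SchwartzMap.fourierInv_coe, Real.fourierInv_eq',
      Real.fourierInv_eq']
    congr 1 with z
    simp only [hS, inner_zero_right, mul_zero, neg_zero, Complex.ofReal_zero, zero_mul,
      Complex.exp_zero, mul_one, inner_sub_right, smul_eq_mul]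
    rw [mul_comm, mul_assoc, ← Complex.exp_add, mul_comm]
    congr 2
    push_cast
    ring
  set p : ℂ := ⟨d / 4, -(s / 2)⟩ with hp_def
  set q : ℂ := ⟨d / 4, s / 2⟩ with hq_def
  have hpre : p.re = d / 4 := rfl
  have hqre : q.re = d / 4 := rfl
  have hp : 0 < p.re := by rw [hpre]; positivity
  have hq : 0 < q.re := by rw [hqre]; positivity
  have hpq : p + q = (finrank ℝ E : ℂ) / 2 := by
    apply Complex.ext
    · have : (d / 4 + d / 4 : ℝ) = d / 2 := by ring
      rw [Complex.add_re, hpre, this]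
      simp [hd_def]
    · simp [p, q]
  have hFE := schwartz_functional_equation (𝓕⁻ (S ξ)) hp hq hpq
  rw [FourierTransform.fourier_fourierInv_eq] at hFE
  have hΓ : ‖Complex.Gamma q‖ = ‖Complex.Gamma p‖ := by
    have : q = (starRingEnd ℂ) p := by
      apply Complex.ext <;> simp [p, q]
    rw [this, Complex.Gamma_conj, RCLike.norm_conj]
  have hΓ0 : 0 < ‖Complex.Gamma p‖ := norm_pos_iff.2 (Complex.Gamma_ne_zero_of_re_pos hp)
  have hnorm : ‖∫ η, (1 / ((Real.pi * ‖η‖ ^ 2 : ℝ) : ℂ)) ^ p * S ξ η‖ =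
      ‖∫ η, (1 / ((Real.pi * ‖η‖ ^ 2 : ℝ) : ℂ)) ^ q * (𝓕⁻ (S ξ)) η‖ := by
    have := congrArg norm hFE
    rw [norm_mul, norm_mul, hΓ] at this
    exact mul_left_cancel₀ hΓ0.ne' this
  have hW : ∀ (a : ℂ) (η : E), η ≠ 0 → (1 / ((Real.pi * ‖η‖ ^ 2 : ℝ) : ℂ)) ^ a =
      Complex.exp (-(Real.log Real.pi + 2 * Real.log ‖η‖ : ℝ) * a) := by
    intro a η hη
    have h1 : 0 < ‖η‖ := norm_pos_iff.2 hη
    have h2 : 0 < (Real.pi * ‖η‖ ^ 2)⁻¹ := by positivity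
    have : (1 / ((Real.pi * ‖η‖ ^ 2 : ℝ) : ℂ)) = (((Real.pi * ‖η‖ ^ 2)⁻¹ : ℝ) : ℂ) := by
      push_cast; simp
    rw [this, Complex.cpow_def_of_ne_zero (by exact_mod_cast h2.ne'), ← Complex.ofReal_log h2.le,
      Real.log_inv, Real.log_mul Real.pi_ne_zero (by positivity), Real.log_pow]
    push_cast
    ring_nf
  have hosc : oscInt χ s ξ = Complex.exp (Real.log Real.pi * p) *
      ∫ η, (1 / ((Real.pi * ‖η‖ ^ 2 : ℝ) : ℂ)) ^ p * S ξ η := by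
    rw [oscInt, Real.fourier_eq', ← integral_const_mul]
    congr 1 with z
    by_cases hz : z = 0
    · have e0 : χ z = 0 := by
        rw [hz]; exact image_eq_zero_of_notMem_tsupport h.zero_notMem
      simp [hS, e0]
    · have h1 : 0 < ‖z‖ := norm_pos_iff.2 hz
      rw [hW p z hz, hS, Real.rpow_def_of_pos h1, normChar, smul_eq_mul, Complex.ofReal_exp]
      have hpI : p = ((d / 4 : ℝ) : ℂ) - ((s / 2 : ℝ) : ℂ) * Complex.I := by
        apply Complex.ext <;> simp [p]
      have e1 : ∀ a b c x : ℂ, a * (b * (x * c * a)) = x * (a * a * b * c) := by intros; ring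
      have e2 : ∀ a b x : ℂ, a * (x * b) = x * (a * b) := by intros; ring
      have e3 : ∀ a b c d x : ℂ, a * (b * (x * c * d)) = x * (a * b * c * d) := by intros; ring
      rw [e2, e3, ← Complex.exp_add, ← Complex.exp_add, ← Complex.exp_add, ← Complex.exp_add]
      congr 2
      rw [hpI]
      push_cast
      ring
  rw [hosc, norm_mul, hnorm]
  have hexp : ‖Complex.exp (Real.log Real.pi * p)‖ = Real.pi ^ (d / 4) := by
    rw [Complex.norm_exp, Complex.re_ofReal_mul, hpre, Real.rpow_def_of_pos Real.pi_pos]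
  rw [hexp]
  have hne : ∀ᵐ η : E, η ≠ 0 := by
    have : Nontrivial E := Module.nontrivial_of_finrank_pos (R := ℝ) hd
    simp [ae_iff, measure_singleton]
  calc Real.pi ^ (d / 4) * ‖∫ η, (1 / ((Real.pi * ‖η‖ ^ 2 : ℝ) : ℂ)) ^ q * (𝓕⁻ (S ξ)) η‖
      ≤ Real.pi ^ (d / 4) * ∫ η, ‖(1 / ((Real.pi * ‖η‖ ^ 2 : ℝ) : ℂ)) ^ q * (𝓕⁻ (S ξ)) η‖ := by
        gcongr
        exact norm_integral_le_integral_norm _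
    _ = ∫ η, ‖η‖ ^ (-(d / 2)) * ‖(𝓕⁻ (S 0)) (η - ξ)‖ := by
        rw [← integral_const_mul]
        refine integral_congr_ae (hne.mono fun η hη => ?_)
        have h1 : 0 < ‖η‖ := norm_pos_iff.2 hη
        simp only []
        rw [norm_mul, hW q η hη, Complex.norm_exp, ← hshift, ← mul_assoc,
          Real.rpow_def_of_pos h1, Real.rpow_def_of_pos Real.pi_pos, ← Real.exp_add]
        congr 2
        rw [← Complex.ofReal_neg, Complex.re_ofReal_mul, hqre]
        ring

lemma oscInt_decay {χ : E → ℂ} (h : IsTest χ) (hd : 1 ≤ finrank ℝ E) (hd2 : finrank ℝ E ≤ 2) :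
    ∃ C, ∀ s ξ, ‖ξ‖ ^ ((finrank ℝ E : ℝ) / 2) * ‖oscInt χ s ξ‖ ≤ C := by
  obtain ⟨g, hg⟩ := norm_oscInt_le_integral h hd
  set d : ℝ := (finrank ℝ E : ℝ) with hd_def
  have hdpos : 0 < d := by rw [hd_def]; exact_mod_cast hd
  have hd2' : d ≤ 2 := by rw [hd_def]; exact_mod_cast hd2
  obtain ⟨c, hc0, hc⟩ := exists_weight_bound (E := E) (a := d / 2) (by positivity)
    (by rw [← hd_def]; linarith)
  obtain ⟨M0, -, hM0⟩ := g.decay 0 0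
  obtain ⟨M1, -, hM1⟩ := g.decay 1 0
  have hi0 : Integrable (fun η => ‖g η‖) := g.integrable.norm
  have hi1 : Integrable (fun η => (1 + ‖η‖) * ‖g η‖) := by
    have := hi0.add (g.integrable_pow_mul volume 1)
    refine this.congr (Eventually.of_forall fun η => ?_)
    simp only [Pi.add_apply, pow_one]
    ring
  refine ⟨(∫ η, ‖g η‖) + (c * (M0 + M1) + ∫ η, (1 + ‖η‖) * ‖g η‖), fun s ξ => ?_⟩
  have hb1 : ∀ η, (1 + ‖η‖) * ‖g η‖ ≤ M0 + M1 := fun η => by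
    have h0 := hM0 η
    have h1 := hM1 η
    simp only [pow_zero, one_mul, pow_one, norm_iteratedFDeriv_zero] at h0 h1
    linarith
  have hA := hc (fun η => ‖g (η - ξ)‖) M0 (fun _ => norm_nonneg _)
    (fun η => by simpa using hM0 (η - ξ)) (hi0.comp_sub_right ξ)
  have hB := hc (fun η => (1 + ‖η - ξ‖) * ‖g (η - ξ)‖) (M0 + M1) (fun _ => by positivity)
    (fun η => hb1 (η - ξ)) (hi1.comp_sub_right ξ)
  have hB2 : ∫ η, (1 + ‖η - ξ‖) * ‖g (η - ξ)‖ = ∫ η, (1 + ‖η‖) * ‖g η‖ :=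
    integral_sub_right_eq_self (fun η => (1 + ‖η‖) * ‖g η‖) ξ
  have hA2 : ∫ η, ‖g (η - ξ)‖ = ∫ η, ‖g η‖ := integral_sub_right_eq_self (fun η => ‖g η‖) ξ
  calc ‖ξ‖ ^ (d / 2) * ‖oscInt χ s ξ‖
      ≤ ‖ξ‖ ^ (d / 2) * ∫ η, ‖η‖ ^ (-(d / 2)) * ‖g (η - ξ)‖ := by
        gcongr
        exact hg s ξ
    _ = ∫ η, ‖ξ‖ ^ (d / 2) * (‖η‖ ^ (-(d / 2)) * ‖g (η - ξ)‖) := (integral_const_mul _ _).symm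
    _ ≤ ∫ η, (‖g (η - ξ)‖ + ‖η‖ ^ (-(d / 2)) * ((1 + ‖η - ξ‖) * ‖g (η - ξ)‖)) := by
        refine integral_mono (hA.1.const_mul _) ((hi0.comp_sub_right ξ).add hB.1) fun η => ?_
        have h1 : ‖ξ‖ ^ (d / 2) ≤ ‖η‖ ^ (d / 2) + ‖η - ξ‖ ^ (d / 2) := by
          calc ‖ξ‖ ^ (d / 2) ≤ (‖η‖ + ‖η - ξ‖) ^ (d / 2) := by
                gcongr
                have := norm_sub_le η (η - ξ)
                simpa using this
            _ ≤ _ := Real.rpow_add_le_add_rpow (norm_nonneg _) (norm_nonneg _)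
                  (by positivity) (by linarith)
        have h2 : ‖η - ξ‖ ^ (d / 2) ≤ 1 + ‖η - ξ‖ := by
          calc ‖η - ξ‖ ^ (d / 2) ≤ (1 + ‖η - ξ‖) ^ (d / 2) := by
                gcongr
                linarith
            _ ≤ (1 + ‖η - ξ‖) ^ (1 : ℝ) := by
                gcongr
                · linarith [norm_nonneg (η - ξ)]
                · linarith
            _ = _ := Real.rpow_one _
        have h3 : ‖η‖ ^ (d / 2) * ‖η‖ ^ (-(d / 2)) ≤ 1 := by
          rw [Real.rpow_neg (norm_nonneg _)]
          exact mul_inv_le_one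
        have hw : 0 ≤ ‖η‖ ^ (-(d / 2)) := by positivity
        have hgn := norm_nonneg (g (η - ξ))
        calc ‖ξ‖ ^ (d / 2) * (‖η‖ ^ (-(d / 2)) * ‖g (η - ξ)‖)
            ≤ (‖η‖ ^ (d / 2) + (1 + ‖η - ξ‖)) * (‖η‖ ^ (-(d / 2)) * ‖g (η - ξ)‖) := by
              gcongr
              linarith
          _ = ‖η‖ ^ (d / 2) * ‖η‖ ^ (-(d / 2)) * ‖g (η - ξ)‖ +
              ‖η‖ ^ (-(d / 2)) * ((1 + ‖η - ξ‖) * ‖g (η - ξ)‖) := by ring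
          _ ≤ _ := by
              have := mul_le_of_le_one_left hgn h3
              linarith
    _ ≤ _ := by
        rw [integral_add (hi0.comp_sub_right ξ) hB.1, hA2]
        have := hB.2
        rw [hB2] at this
        linarith

end LocalDecay

section LocalBound

open scoped FourierTransform RealInnerProductSpace ContDiff SchwartzMap
open Module

variable {E : Type*} [NormedAddCommGroup E] [InnerProductSpace ℝ E] [FiniteDimensional ℝ E]
  [MeasurableSpace E] [BorelSpace E]

omit [FiniteDimensional ℝ E] [MeasurableSpace E] [BorelSpace E] in
lemma contDiffOn_inner_div (v : E) :
    ContDiffOn ℝ ∞ (fun z : E => ((⟪z, v⟫ / ‖z‖ ^ 2 : ℝ) : ℂ)) {0}ᶜ := by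
  refine Complex.ofRealCLM.contDiff.comp_contDiffOn (ContDiffOn.div ?_ ?_ ?_)
  · exact (contDiff_id.inner ℝ contDiff_const).contDiffOn
  · exact (contDiff_norm_sq ℝ).contDiffOn
  · intro z hz
    exact pow_ne_zero _ (norm_ne_zero_iff.2 hz)

lemma oscInt_finset_sum {ι : Type*} (t : Finset ι) {χ : ι → E → ℂ} (h : ∀ i, IsTest (χ i))
    (s : ℝ) (ξ : E) :
    oscInt (fun z => ∑ i ∈ t, χ i z) s ξ = ∑ i ∈ t, oscInt (χ i) s ξ := by
  simp only [oscInt, Real.fourier_eq]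
  rw [← integral_finsetSum _ fun i _ =>
    (Real.fourierIntegral_convergent_iff ξ).2 ((h i).normChar s).integrable]
  congr 1 with z
  rw [← Finset.smul_sum, Finset.sum_mul]

lemma norm_oscInt_le (χ : E → ℂ) (s : ℝ) (ξ : E) : ‖oscInt χ s ξ‖ ≤ ∫ z, ‖χ z‖ := by
  rw [oscInt, Real.fourier_eq]
  refine (norm_integral_le_integral_norm _).trans_eq ?_
  simp [Circle.norm_smul]

lemma oscInt_decay_xi {χ : E → ℂ} (h : IsTest χ) (hd : 1 ≤ finrank ℝ E) (hd2 : finrank ℝ E ≤ 2) :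
    ∃ C, 0 ≤ C ∧ ∀ s ξ, ‖oscInt χ s ξ‖ ≤ C * (1 + ‖ξ‖) ^ (-((finrank ℝ E : ℝ) / 2)) := by
  obtain ⟨C, hC⟩ := oscInt_decay h hd hd2
  have hd2' : (finrank ℝ E : ℝ) ≤ 2 := by exact_mod_cast hd2
  have hC0 : 0 ≤ C := le_trans (by positivity) (hC 0 0)
  have hI0 : 0 ≤ ∫ z, ‖χ z‖ := integral_nonneg fun _ => norm_nonneg _
  refine ⟨(∫ z, ‖χ z‖) + C, by positivity, fun s ξ => ?_⟩
  rw [Real.rpow_neg (by positivity), ← div_eq_mul_inv, le_div_iff₀ (by positivity)]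
  have h1 : (1 + ‖ξ‖) ^ ((finrank ℝ E : ℝ) / 2) ≤ 1 + ‖ξ‖ ^ ((finrank ℝ E : ℝ) / 2) := by
    have := Real.rpow_add_le_add_rpow zero_le_one (norm_nonneg ξ)
      (p := (finrank ℝ E : ℝ) / 2) (by positivity) (by linarith)
    rwa [Real.one_rpow] at this
  calc _ ≤ ‖oscInt χ s ξ‖ * (1 + ‖ξ‖ ^ ((finrank ℝ E : ℝ) / 2)) := by gcongr
    _ = ‖oscInt χ s ξ‖ + ‖ξ‖ ^ ((finrank ℝ E : ℝ) / 2) * ‖oscInt χ s ξ‖ := by ring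
    _ ≤ _ := add_le_add (norm_oscInt_le χ s ξ) (hC s ξ)

lemma oscInt_decay_s {χ : E → ℂ} (h : IsTest χ) (hd : 1 ≤ finrank ℝ E) (hd2 : finrank ℝ E ≤ 2) :
    ∃ C, 0 ≤ C ∧ ∀ s ξ, ‖oscInt χ s ξ‖ ≤ C * (1 + |s|) ^ (-((finrank ℝ E : ℝ) / 2)) := by
  set d : ℝ := (finrank ℝ E : ℝ) with hd_def
  have hd2' : d ≤ 2 := by rw [hd_def]; exact_mod_cast hd2
  have hd0 : 0 ≤ d := by positivity
  let b := stdOrthonormalBasis ℝ E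
  have hχ : ∀ j, IsTest (fun z => χ z * ((⟪z, b j⟫ : ℝ) : ℂ)) := fun j =>
    h.mul (Complex.ofRealCLM.contDiff.comp (contDiff_id.inner ℝ contDiff_const)).contDiffOn
  have hψ : ∀ j, IsTest (fun z => χ z * ((⟪z, b j⟫ : ℝ) : ℂ) *
      ((⟪z, b j⟫ / ‖z‖ ^ 2 : ℝ) : ℂ)) := fun j => (hχ j).mul (contDiffOn_inner_div _)
  choose C1 hC10 hC1 using fun j => oscInt_decay_xi (hχ j) hd hd2
  choose C2 hC20 hC2 using fun j => oscInt_decay_xi ((hχ j).fderiv (b j)) hd hd2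
  obtain ⟨C0, hC00, hC0⟩ := oscInt_decay_xi h hd hd2
  have hsum : ∀ s ξ, Complex.I * s * oscInt χ s ξ = ∑ j, (2 * Real.pi * Complex.I * ⟪b j, ξ⟫ *
      oscInt (fun z => χ z * ((⟪z, b j⟫ : ℝ) : ℂ)) s ξ -
      oscInt (fun z => fderiv ℝ (fun z => χ z * ((⟪z, b j⟫ : ℝ) : ℂ)) z (b j)) s ξ) := by
    intro s ξ
    simp_rw [fun j => oscInt_ibp (hχ j) s (b j) ξ, add_sub_cancel_left]
    rw [← Finset.mul_sum, ← oscInt_finset_sum _ hψ]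
    congr 2 with z
    by_cases hz : z = 0
    · have e0 : χ z = 0 := by
        rw [hz]; exact image_eq_zero_of_notMem_tsupport h.zero_notMem
      simp [e0]
    · have h1 : ‖z‖ ≠ 0 := norm_ne_zero_iff.2 hz
      have h2 : ∑ j, ⟪z, b j⟫ * ⟪z, b j⟫ = ‖z‖ ^ 2 := by
        have := b.sum_sq_inner_left z
        simpa [sq] using this
      have h3 : ∀ j, χ z * ((⟪z, b j⟫ : ℝ) : ℂ) * ((⟪z, b j⟫ / ‖z‖ ^ 2 : ℝ) : ℂ) =
          χ z * ((⟪z, b j⟫ * ⟪z, b j⟫ / ‖z‖ ^ 2 : ℝ) : ℂ) := by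
        intro j
        push_cast
        ring
      simp_rw [h3]
      rw [← Finset.mul_sum, ← Complex.ofReal_sum, ← Finset.sum_div, h2, div_self (by positivity)]
      simp
  set D : ℝ := (∑ j, (2 * Real.pi * C1 j + C2 j)) + C0 with hD
  have hDsum : 0 ≤ ∑ j, (2 * Real.pi * C1 j + C2 j) := Finset.sum_nonneg fun j _ => by
    have := hC10 j
    have := hC20 j
    positivity
  have hD0 : 0 ≤ D := by positivity
  have key : ∀ s ξ, (1 + |s|) * ‖oscInt χ s ξ‖ ≤ D * (1 + ‖ξ‖) ^ (1 - d / 2) := by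
    intro s ξ
    have hx : (1 : ℝ) ≤ 1 + ‖ξ‖ := by linarith [norm_nonneg ξ]
    have hx0 : 0 < 1 + ‖ξ‖ := by linarith
    have hmul : (1 + ‖ξ‖) ^ (1 - d / 2) = (1 + ‖ξ‖) * (1 + ‖ξ‖) ^ (-(d / 2)) := by
      rw [sub_eq_add_neg, Real.rpow_add hx0, Real.rpow_one]
    have hle : (1 + ‖ξ‖) ^ (-(d / 2)) ≤ (1 + ‖ξ‖) ^ (1 - d / 2) := by
      rw [hmul]
      exact le_mul_of_one_le_left (by positivity) hx
    have h1 : |s| * ‖oscInt χ s ξ‖ ≤ (∑ j, (2 * Real.pi * C1 j + C2 j)) *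
        (1 + ‖ξ‖) ^ (1 - d / 2) := by
      have e := congrArg norm (hsum s ξ)
      rw [norm_mul, norm_mul, Complex.norm_I, one_mul, Complex.norm_real, Real.norm_eq_abs] at e
      rw [e, Finset.sum_mul]
      refine (norm_sum_le _ _).trans (Finset.sum_le_sum fun j _ => ?_)
      refine (norm_sub_le _ _).trans ?_
      rw [add_mul]
      refine add_le_add ?_ ?_
      · have e1 : ‖2 * Real.pi * Complex.I * ((⟪b j, ξ⟫ : ℝ) : ℂ)‖ = 2 * Real.pi * |⟪b j, ξ⟫| := by
          simp [abs_of_pos Real.pi_pos]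
        have e2 : |⟪b j, ξ⟫| ≤ 1 + ‖ξ‖ := by
          have := abs_real_inner_le_norm (b j) ξ
          rw [b.norm_eq_one, one_mul] at this
          linarith
        rw [norm_mul, e1, hmul]
        have := hC10 j
        calc _ ≤ 2 * Real.pi * (1 + ‖ξ‖) * (C1 j * (1 + ‖ξ‖) ^ (-(d / 2))) := by
              gcongr
              exact hC1 j s ξ
          _ = _ := by ring
      · have := hC20 j
        exact (hC2 j s ξ).trans (by gcongr)
    have h2 : ‖oscInt χ s ξ‖ ≤ C0 * (1 + ‖ξ‖) ^ (1 - d / 2) :=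
      (hC0 s ξ).trans (by gcongr)
    rw [hD]
    linarith
  refine ⟨C0 + D, by positivity, fun s ξ => ?_⟩
  have hs0 : 0 < 1 + |s| := by positivity
  rcases le_total |s| ‖ξ‖ with hle | hle
  · refine (hC0 s ξ).trans ?_
    calc C0 * (1 + ‖ξ‖) ^ (-(d / 2)) ≤ C0 * (1 + |s|) ^ (-(d / 2)) := by
          gcongr ?_ * ?_
          exact Real.rpow_le_rpow_of_nonpos hs0 (by linarith) (by linarith)
      _ ≤ _ := by gcongr; linarith
  · have h1 : (1 + |s|) * ‖oscInt χ s ξ‖ ≤ (1 + |s|) * (D * (1 + |s|) ^ (-(d / 2))) := by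
      refine (key s ξ).trans ?_
      have : (1 + |s|) * (D * (1 + |s|) ^ (-(d / 2))) = D * (1 + |s|) ^ (1 - d / 2) := by
        rw [sub_eq_add_neg, Real.rpow_add hs0, Real.rpow_one]
        ring
      rw [this]
      gcongr
      linarith
    refine (le_of_mul_le_mul_left h1 hs0).trans ?_
    gcongr
    linarith

lemma oscInt_pow_bound (hd : 1 ≤ finrank ℝ E) (hd2 : finrank ℝ E ≤ 2) (k : ℕ) :
    ∀ {χ : E → ℂ}, IsTest χ → ∃ C, 0 ≤ C ∧ ∀ s ξ,
      ‖ξ‖ ^ k * ‖oscInt χ s ξ‖ ≤ C * (1 + |s|) ^ ((k : ℝ) - (finrank ℝ E : ℝ) / 2) := by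
  induction k with
  | zero =>
    intro χ h
    simpa using oscInt_decay_s h hd hd2
  | succ k ih =>
    intro χ h
    let b := stdOrthonormalBasis ℝ E
    choose C1 hC10 hC1 using fun j => ih (h.fderiv (b j))
    choose C2 hC20 hC2 using fun j => ih (h.mul (contDiffOn_inner_div (b j)))
    refine ⟨∑ j, (C1 j + C2 j), Finset.sum_nonneg fun j _ => add_nonneg (hC10 j) (hC20 j),
      fun s ξ => ?_⟩
    have hs0 : 0 < 1 + |s| := by positivity
    have hξ : ‖ξ‖ ≤ ∑ j, |⟪b j, ξ⟫| := by
      conv_lhs => rw [← b.sum_repr' ξ]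
      refine (norm_sum_le _ _).trans (Finset.sum_le_sum fun j _ => ?_)
      rw [norm_smul, b.norm_eq_one, mul_one, Real.norm_eq_abs]
    have hexp : (1 + |s|) ^ (((k + 1 : ℕ) : ℝ) - (finrank ℝ E : ℝ) / 2) =
        (1 + |s|) * (1 + |s|) ^ ((k : ℝ) - (finrank ℝ E : ℝ) / 2) := by
      have : ((k + 1 : ℕ) : ℝ) - (finrank ℝ E : ℝ) / 2 = 1 + ((k : ℝ) - (finrank ℝ E : ℝ) / 2) := by
        push_cast
        ring
      rw [this, Real.rpow_add hs0, Real.rpow_one]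
    have hj : ∀ j, |⟪b j, ξ⟫| * ‖oscInt χ s ξ‖ ≤ ‖oscInt (fun z => fderiv ℝ χ z (b j)) s ξ‖ +
        |s| * ‖oscInt (fun z => χ z * ((⟪z, b j⟫ / ‖z‖ ^ 2 : ℝ) : ℂ)) s ξ‖ := by
      intro j
      have e := congrArg norm (oscInt_ibp h s (b j) ξ)
      have e1 : ‖2 * Real.pi * Complex.I * ((⟪b j, ξ⟫ : ℝ) : ℂ)‖ = 2 * Real.pi * |⟪b j, ξ⟫| := by
        simp [abs_of_pos Real.pi_pos]
      rw [norm_mul, e1] at e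
      have h2 : 1 ≤ 2 * Real.pi := by linarith [Real.pi_gt_three]
      calc |⟪b j, ξ⟫| * ‖oscInt χ s ξ‖ ≤ (2 * Real.pi) * (|⟪b j, ξ⟫| * ‖oscInt χ s ξ‖) :=
            le_mul_of_one_le_left (by positivity) h2
        _ = _ := by rw [← mul_assoc, e]
        _ ≤ _ := (norm_add_le _ _).trans_eq (by simp)
    calc ‖ξ‖ ^ (k + 1) * ‖oscInt χ s ξ‖ = ‖ξ‖ ^ k * (‖ξ‖ * ‖oscInt χ s ξ‖) := by ring
      _ ≤ ‖ξ‖ ^ k * ((∑ j, |⟪b j, ξ⟫|) * ‖oscInt χ s ξ‖) := by gcongr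
      _ = ∑ j, ‖ξ‖ ^ k * (|⟪b j, ξ⟫| * ‖oscInt χ s ξ‖) := by
          rw [Finset.sum_mul, Finset.mul_sum]
      _ ≤ ∑ j, ‖ξ‖ ^ k * (‖oscInt (fun z => fderiv ℝ χ z (b j)) s ξ‖ +
        |s| * ‖oscInt (fun z => χ z * ((⟪z, b j⟫ / ‖z‖ ^ 2 : ℝ) : ℂ)) s ξ‖) := by
          gcongr with j _
          exact hj j
      _ ≤ ∑ j, (C1 j + C2 j) * (1 + |s|) ^ (((k + 1 : ℕ) : ℝ) - (finrank ℝ E : ℝ) / 2) := by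
          refine Finset.sum_le_sum fun j _ => ?_
          rw [hexp]
          set Q := (1 + |s|) ^ ((k : ℝ) - (finrank ℝ E : ℝ) / 2)
          have hQ : 0 ≤ Q := by positivity
          have a1 := hC1 j s ξ
          have a2 := mul_le_mul_of_nonneg_left (hC2 j s ξ) (abs_nonneg s)
          have a3 : 0 ≤ C1 j * |s| * Q := mul_nonneg (mul_nonneg (hC10 j) (abs_nonneg s)) hQ
          have a4 : 0 ≤ C2 j * Q := mul_nonneg (hC20 j) hQ
          linarith
      _ = _ := by rw [Finset.sum_mul]

/-- Uniform bound for the Fourier transform of a test function twisted by `‖z‖ ^ (is)`. -/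
lemma oscInt_bound (hd : 1 ≤ finrank ℝ E) (hd2 : finrank ℝ E ≤ 2) {p : ℝ} (hp : 0 ≤ p)
    {χ : E → ℂ} (h : IsTest χ) : ∃ C, 0 ≤ C ∧ ∀ s ξ,
      ‖ξ‖ ^ p * ‖oscInt χ s ξ‖ ≤ C * (1 + |s|) ^ (p - (finrank ℝ E : ℝ) / 2) := by
  obtain ⟨k, hk⟩ := exists_nat_ge p
  obtain ⟨C0, hC00, hC0⟩ := oscInt_pow_bound hd hd2 0 h
  obtain ⟨C1, hC10, hC1⟩ := oscInt_pow_bound hd hd2 k h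
  refine ⟨C0 + C1, by positivity, fun s ξ => ?_⟩
  have hs0 : 0 < 1 + |s| := by positivity
  have h0 := hC0 s ξ
  have h1 := hC1 s ξ
  simp only [pow_zero, one_mul, Nat.cast_zero, zero_sub] at h0
  rw [sub_eq_add_neg, Real.rpow_add hs0] at h1 ⊢
  set D := (1 + |s|) ^ (-((finrank ℝ E : ℝ) / 2))
  have hD : 0 ≤ D := by positivity
  rcases le_total ‖ξ‖ (1 + |s|) with hle | hle
  · calc ‖ξ‖ ^ p * ‖oscInt χ s ξ‖ ≤ (1 + |s|) ^ p * (C0 * D) := by gcongr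
      _ = C0 * ((1 + |s|) ^ p * D) := by ring
      _ ≤ _ := by gcongr; linarith
  · have hξ : 0 < ‖ξ‖ := hs0.trans_le hle
    have h2 : ‖ξ‖ ^ p * (1 + |s|) ^ (k : ℝ) ≤ ‖ξ‖ ^ k * (1 + |s|) ^ p := by
      have e1 : (1 + |s|) ^ (k : ℝ) = (1 + |s|) ^ p * (1 + |s|) ^ (k - p) := by
        rw [← Real.rpow_add hs0]; congr 1; ring
      have e2 : ‖ξ‖ ^ k = ‖ξ‖ ^ p * ‖ξ‖ ^ (k - p) := by
        rw [← Real.rpow_natCast, ← Real.rpow_add hξ]; congr 1; ring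
      have e3 : (1 + |s|) ^ (k - p) ≤ ‖ξ‖ ^ (k - p) :=
        Real.rpow_le_rpow hs0.le hle (by linarith)
      calc _ = ‖ξ‖ ^ p * (1 + |s|) ^ p * (1 + |s|) ^ (k - p) := by rw [e1]; ring
        _ ≤ ‖ξ‖ ^ p * (1 + |s|) ^ p * ‖ξ‖ ^ (k - p) := by gcongr
        _ = _ := by rw [e2]; ring
    have h3 : 0 < (1 + |s|) ^ (k : ℝ) := by positivity
    refine le_of_mul_le_mul_left ?_ h3
    calc (1 + |s|) ^ (k : ℝ) * (‖ξ‖ ^ p * ‖oscInt χ s ξ‖)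
        = (‖ξ‖ ^ p * (1 + |s|) ^ (k : ℝ)) * ‖oscInt χ s ξ‖ := by ring
      _ ≤ (‖ξ‖ ^ k * (1 + |s|) ^ p) * ‖oscInt χ s ξ‖ := by gcongr
      _ = (1 + |s|) ^ p * (‖ξ‖ ^ k * ‖oscInt χ s ξ‖) := by ring
      _ ≤ (1 + |s|) ^ p * (C1 * ((1 + |s|) ^ (k : ℝ) * D)) := by gcongr
      _ = (1 + |s|) ^ (k : ℝ) * (C1 * ((1 + |s|) ^ p * D)) := by ring
      _ ≤ _ := by gcongr; linarith

end LocalBound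

section Poisson

open UnitAddTorus

variable {ι : Type*} [Fintype ι]

/-- The Fourier coefficients of a function on `ι → ℝ` at integer frequencies. -/
noncomputable def intFourier (F : (ι → ℝ) → ℂ) (k : ι → ℤ) : ℂ :=
  ∫ c, Complex.exp (((-(2 * Real.pi * ∑ i, (k i : ℝ) * c i) : ℝ) : ℂ) * Complex.I) * F c

lemma exists_finset_support [DecidableEq ι] {F : (ι → ℝ) → ℂ} (hF : HasCompactSupport F) (r : ℝ) :
    ∃ T : Finset (ι → ℤ), ∀ x : ι → ℝ, ‖x‖ ≤ r → ∀ m ∉ T, F (x + fun i => (m i : ℝ)) = 0 := by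
  obtain ⟨R, hR⟩ := hF.isCompact.isBounded.exists_norm_le
  refine ⟨Fintype.piFinset fun _ => Finset.Icc (-⌈r + R⌉) ⌈r + R⌉, fun x hx m hm => ?_⟩
  by_contra h0
  apply hm
  rw [Fintype.mem_piFinset]
  intro i
  have h1 := hR _ (subset_tsupport F h0)
  have h2 : |x i + m i| ≤ R := (norm_le_pi_norm (x + fun i => (m i : ℝ)) i).trans h1
  have h3 : |x i| ≤ r := (norm_le_pi_norm x i).trans hx
  have h4 : |(m i : ℝ)| ≤ r + R := by
    have : (m i : ℝ) = (x i + m i) - x i := by ring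
    rw [this]
    exact (abs_sub _ _).trans (by linarith)
  have h5 := Int.le_ceil (r + R)
  rw [abs_le] at h4
  rw [Finset.mem_Icc]
  constructor
  · have : ((-⌈r + R⌉ : ℤ) : ℝ) ≤ m i := by push_cast; linarith
    exact_mod_cast this
  · have : (m i : ℝ) ≤ (⌈r + R⌉ : ℤ) := by linarith
    exact_mod_cast this

lemma continuous_periodization {F : (ι → ℝ) → ℂ} (hc : Continuous F) (hF : HasCompactSupport F) :
    Continuous fun x : ι → ℝ => ∑' m : ι → ℤ, F (x + fun i => (m i : ℝ)) := by
  classical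
  rw [continuous_iff_continuousAt]
  intro x
  obtain ⟨T, hT⟩ := exists_finset_support hF (‖x‖ + 1)
  have h1 : (fun x : ι → ℝ => ∑' m : ι → ℤ, F (x + fun i => (m i : ℝ))) =ᶠ[nhds x]
      fun x => ∑ m ∈ T, F (x + fun i => (m i : ℝ)) := by
    have : ∀ᶠ y in nhds x, ‖y‖ < ‖x‖ + 1 :=
      continuous_norm.continuousAt.eventually_lt continuousAt_const (by simp)
    filter_upwards [this] with y hy
    exact tsum_eq_sum fun m hm => hT y hy.le m hm
  refine ContinuousAt.congr ?_ h1.symm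
  fun_prop

lemma mFourier_coe (k : ι → ℤ) (x : ι → ℝ) :
    mFourier (-k) (fun i => (x i : UnitAddCircle)) =
      Complex.exp (((-(2 * Real.pi * ∑ i, (k i : ℝ) * x i) : ℝ) : ℂ) * Complex.I) := by
  simp only [mFourier, ContinuousMap.coe_mk, fourier_coe_apply]
  rw [← Complex.exp_sum]
  congr 1
  push_cast
  rw [Finset.mul_sum, ← Finset.sum_neg_distrib, Finset.sum_mul]
  refine Finset.sum_congr rfl fun i _ => ?_
  simp
  ring

/-- Poisson summation for compactly supported functions with summable Fourier coefficients. -/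
lemma poisson_summation {F : (ι → ℝ) → ℂ} (hc : Continuous F) (hF : HasCompactSupport F)
    (hs : Summable (intFourier F)) :
    ∑' m : ι → ℤ, F (fun i => (m i : ℝ)) = ∑' k, intFourier F k := by
  classical
  let π : (ι → ℝ) → UnitAddTorus ι := fun x i => (x i : UnitAddCircle)
  have hπ : IsOpenQuotientMap π :=
    IsOpenQuotientMap.piMap fun _ => QuotientAddGroup.isOpenQuotientMap_mk
  let P : (ι → ℝ) → ℂ := fun x => ∑' m : ι → ℤ, F (x + fun i => (m i : ℝ))
  have hP : Continuous P := continuous_periodization hc hF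
  have hper : ∀ x y, π x = π y → P x = P y := by
    intro x y hxy
    have h1 : ∀ i, ∃ n : ℤ, y i - x i = n := by
      intro i
      have := congrFun hxy i
      have h2 := (QuotientAddGroup.eq (s := AddSubgroup.zmultiples (1 : ℝ))).1 this
      obtain ⟨n, hn⟩ := AddSubgroup.mem_zmultiples_iff.1 h2
      exact ⟨n, by rw [zsmul_eq_mul, mul_one] at hn; linarith⟩
    choose n hn using h1
    have : y = x + fun i => (n i : ℝ) := by
      ext i
      simp [← hn]
    simp only [P, this]
    rw [← (Equiv.addLeft n).tsum_eq]
    congr 1 with m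
    congr 1
    ext i
    simp
    ring
  let g : C(UnitAddTorus ι, ℂ) :=
    ⟨fun t => P (Function.surjInv hπ.surjective t), by
      rw [hπ.isQuotientMap.continuous_iff]
      convert hP using 1
      ext x
      exact hper _ _ (Function.surjInv_eq hπ.surjective (π x))⟩
  have hg : ∀ x, g (π x) = P x := fun x => hper _ _ (Function.surjInv_eq hπ.surjective (π x))
  have hcoef : ∀ k, mFourierCoeff g k = intFourier F k := by
    intro k
    rw [mFourierCoeff_eq_integral g k 0]
    let e : (ι → ℝ) → ℂ := fun c =>
      Complex.exp (((-(2 * Real.pi * ∑ i, (k i : ℝ) * c i) : ℝ) : ℂ) * Complex.I)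
    have he : Continuous e := by
      simp only [e]
      fun_prop
    let B : (ι → ℤ) → Set (ι → ℝ) := fun m => Set.pi univ fun i => Ioc (m i : ℝ) (m i + 1)
    have hBm : ∀ m, MeasurableSet (B m) := fun m =>
      MeasurableSet.univ_pi fun i => measurableSet_Ioc
    have hceil : ∀ m (x : ι → ℝ), x ∈ B m ↔ ∀ i, m i = ⌈x i⌉ - 1 := by
      intro m x
      simp only [B, mem_univ_pi]
      refine forall_congr' fun i => ?_
      rw [mem_Ioc, eq_sub_iff_add_eq, eq_comm, Int.ceil_eq_iff]
      push_cast
      rw [add_sub_cancel_right]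
    have hBd : Pairwise (Function.onFun Disjoint B) := by
      intro m m' hne
      refine Set.disjoint_left.2 fun x hx hx' => hne ?_
      ext i
      rw [(hceil m x).1 hx i, (hceil m' x).1 hx' i]
    have hBu : ⋃ m, B m = univ := by
      refine eq_univ_of_forall fun x => mem_iUnion.2 ⟨fun i => ⌈x i⌉ - 1, ?_⟩
      exact (hceil _ x).2 fun i => rfl
    have hInt : Integrable (fun c => e c * F c) :=
      (he.mul hc).integrable_of_hasCompactSupport hF.mul_left
    have hset : {x : ι → ℝ | ∀ i, x i ∈ Ioc ((0 : ι → ℝ) i) ((0 : ι → ℝ) i + 1)} = B 0 := by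
      ext x; simp [B]
    have hbd : ∀ x ∈ B 0, ‖x‖ ≤ 1 := by
      intro x hx
      rw [pi_norm_le_iff_of_nonneg zero_le_one]
      intro i
      have := hx i (mem_univ i)
      simp only [Pi.zero_apply, Int.cast_zero, zero_add, mem_Ioc] at this
      rw [Real.norm_eq_abs, abs_of_pos this.1]
      exact this.2
    obtain ⟨T, hT⟩ := exists_finset_support hF 1
    have htr : ∀ m, ∫ x in B m, e x * F x = ∫ x in B 0, e x * F (x + fun i => (m i : ℝ)) := by
      intro m
      let v : ι → ℝ := fun i => (m i : ℝ)
      have h1 := (measurePreserving_add_right (volume : Measure (ι → ℝ)) v).setIntegral_preimage_emb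
        (MeasurableEquiv.addRight v).measurableEmbedding (fun x => e x * F x) (B m)
      have h2 : (fun x => x + v) ⁻¹' (B m) = B 0 := by
        ext x
        simp only [B, v, mem_preimage, mem_univ_pi, mem_Ioc, Pi.add_apply, Pi.zero_apply,
          Int.cast_zero]
        refine forall_congr' fun i => ?_
        constructor <;> rintro ⟨h3, h4⟩ <;> constructor <;> linarith
      rw [← h1, h2]
      refine setIntegral_congr_fun (hBm 0) fun x _ => ?_
      simp only [v]
      congr 1
      simp only [e]
      rw [Complex.exp_eq_exp_iff_exists_int]
      refine ⟨-∑ i, k i * m i, ?_⟩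
      simp only [Pi.add_apply, mul_add, Finset.sum_add_distrib]
      push_cast
      ring
    rw [hset]
    calc ∫ x in B 0, mFourier (-k) (fun i => (x i : UnitAddCircle)) •
          g (fun i => (x i : UnitAddCircle))
        = ∫ x in B 0, ∑ m ∈ T, e x * F (x + fun i => (m i : ℝ)) := by
          refine setIntegral_congr_fun (hBm 0) fun x hx => ?_
          have := hg x
          simp only [π] at this
          simp only [mFourier_coe, smul_eq_mul, this, P]
          rw [← Finset.mul_sum, tsum_eq_sum fun m hm => hT x (hbd x hx) m hm]
      _ = ∑ m ∈ T, ∫ x in B 0, e x * F (x + fun i => (m i : ℝ)) := by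
          refine integral_finsetSum _ fun m _ => Integrable.integrableOn ?_
          refine (he.mul (hc.comp (continuous_id.add continuous_const))
            ).integrable_of_hasCompactSupport (HasCompactSupport.mul_left ?_)
          exact hF.comp_homeomorph (Homeomorph.addRight _)
      _ = ∑ m ∈ T, ∫ x in B m, e x * F x := by simp only [htr]
      _ = ∑' m, ∫ x in B m, e x * F x := by
          refine (tsum_eq_sum fun m hm => ?_).symm
          rw [htr]
          refine setIntegral_eq_zero_of_forall_eq_zero fun x hx => ?_
          rw [hT x (hbd x hx) m hm, mul_zero]
      _ = ∫ x, e x * F x := by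
          rw [← integral_iUnion hBm hBd (by rw [hBu]; exact hInt.integrableOn), hBu,
            setIntegral_univ]
  have hs' : Summable (mFourierCoeff g) := by
    rw [funext hcoef]
    exact hs
  have := hasSum_mFourier_series_apply_of_summable hs' (π 0)
  rw [hg] at this
  simp only [P, zero_add] at this
  rw [← this.tsum_eq]
  refine tsum_congr fun k => ?_
  rw [hcoef, smul_eq_mul]
  have h1 : mFourier k (π 0) = 1 := by
    simp [mFourier, π]
  rw [h1, mul_one]

lemma norm_tsum_sub_integral_le {F : (ι → ℝ) → ℂ} (hc : Continuous F) (hF : HasCompactSupport F)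
    {B : (ι → ℤ) → ℝ} (hB : Summable B) (hB0 : 0 ≤ B 0) (hFB : ∀ k ≠ 0, ‖intFourier F k‖ ≤ B k) :
    ‖∑' m : ι → ℤ, F (fun i => (m i : ℝ)) - ∫ c, F c‖ ≤ ∑' k, B k := by
  classical
  have h0 : intFourier F 0 = ∫ c, F c := by simp [intFourier]
  have hs : Summable (intFourier F) := by
    refine Summable.of_norm_bounded_eventually hB ?_
    filter_upwards [(Set.finite_singleton (0 : ι → ℤ)).compl_mem_cofinite] with k hk
    exact hFB k hk
  have hs2 := hs.hasSum.sub (hasSum_ite_eq 0 (intFourier F 0))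
  rw [poisson_summation hc hF hs, ← h0, ← hs2.tsum_eq]
  refine tsum_of_norm_bounded hB.hasSum fun k => ?_
  by_cases hk : k = 0
  · simp [hk, hB0]
  · simpa [hk] using hFB k hk

end Poisson

section Lattice

open scoped FourierTransform RealInnerProductSpace ContDiff
open Module

variable {a b : Type*} [Fintype a] [Fintype b]

/-- The product over the coordinates of `χ₁`, `χ₂` twisted by `‖·‖ ^ (is)`. -/
noncomputable def prodFun (χ₁ : ℝ → ℂ) (χ₂ : ℂ → ℂ) (s₁ : a → ℝ) (s₂ : b → ℝ)
    (x : (a → ℝ) × (b → ℂ)) : ℂ :=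
  (∏ i, χ₁ (x.1 i) * normChar (s₁ i) (x.1 i)) * ∏ j, χ₂ (x.2 j) * normChar (s₂ j) (x.2 j)

/-- The standard pairing on `(a → ℝ) × (b → ℂ)`. -/
noncomputable def pairing (x y : (a → ℝ) × (b → ℂ)) : ℝ :=
  ∑ i, x.1 i * y.1 i + ∑ j, ⟪x.2 j, y.2 j⟫

lemma integral_prodFun (χ₁ : ℝ → ℂ) (χ₂ : ℂ → ℂ) (s₁ : a → ℝ) (s₂ : b → ℝ)
    (y : (a → ℝ) × (b → ℂ)) :
    ∫ x, Complex.exp (((-(2 * Real.pi * pairing x y) : ℝ) : ℂ) * Complex.I) *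
        prodFun χ₁ χ₂ s₁ s₂ x =
      (∏ i, oscInt χ₁ (s₁ i) (y.1 i)) * ∏ j, oscInt χ₂ (s₂ j) (y.2 j) := by
  have h1 : ∀ (s ξ : ℝ), oscInt χ₁ s ξ =
      ∫ z : ℝ, Complex.exp (((-(2 * Real.pi * (z * ξ)) : ℝ) : ℂ) * Complex.I) *
        (χ₁ z * normChar s z) := by
    intro s ξ
    rw [oscInt, Real.fourier_eq']
    congr 1 with z
    simp [mul_comm ξ z]
  have h2 : ∀ (s : ℝ) (ξ : ℂ), oscInt χ₂ s ξ =
      ∫ z : ℂ, Complex.exp (((-(2 * Real.pi * ⟪z, ξ⟫) : ℝ) : ℂ) * Complex.I) *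
        (χ₂ z * normChar s z) := by
    intro s ξ
    rw [oscInt, Real.fourier_eq']
    congr 1 with z
    simp
  simp_rw [h1, h2]
  rw [← integral_fintype_prod_volume_eq_prod (fun (i : a) (z : ℝ) =>
      Complex.exp (((-(2 * Real.pi * (z * y.1 i)) : ℝ) : ℂ) * Complex.I) *
        (χ₁ z * normChar (s₁ i) z)),
    ← integral_fintype_prod_volume_eq_prod (fun (j : b) (z : ℂ) =>
      Complex.exp (((-(2 * Real.pi * ⟪z, y.2 j⟫) : ℝ) : ℂ) * Complex.I) *
        (χ₂ z * normChar (s₂ j) z)), ← integral_prod_mul]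
  congr 1 with x
  have h3 : Complex.exp (((-(2 * Real.pi * pairing x y) : ℝ) : ℂ) * Complex.I) =
      (∏ i, Complex.exp (((-(2 * Real.pi * (x.1 i * y.1 i)) : ℝ) : ℂ) * Complex.I)) *
        ∏ j, Complex.exp (((-(2 * Real.pi * ⟪x.2 j, y.2 j⟫) : ℝ) : ℂ) * Complex.I) := by
    rw [← Complex.exp_sum, ← Complex.exp_sum, ← Complex.exp_add, ← Finset.sum_mul,
      ← Finset.sum_mul, ← add_mul, ← Complex.ofReal_sum, ← Complex.ofReal_sum, ← Complex.ofReal_add,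
      Finset.sum_neg_distrib, Finset.sum_neg_distrib, ← neg_add, ← Finset.mul_sum,
      ← Finset.mul_sum, ← mul_add, pairing]
  rw [h3, prodFun]
  simp only [Finset.prod_mul_distrib]
  ring

lemma sum_mul_prod_le {κ : Type*} [Fintype κ] {y o D E : κ → ℝ} {C : ℝ} (hC : 0 ≤ C)
    (ho : ∀ v, 0 ≤ o v) (hD : ∀ v, 0 ≤ D v) (hE : ∀ v, 0 ≤ E v) (h1 : ∀ v, o v ≤ C * D v)
    (h2 : ∀ v, y v * o v ≤ C * (E v * D v)) :
    (∑ v, y v) * ∏ v, o v ≤ C ^ Fintype.card κ * ((∑ v, E v) * ∏ v, D v) := by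
  classical
  rw [Finset.sum_mul, Finset.sum_mul, Finset.mul_sum]
  refine Finset.sum_le_sum fun v _ => ?_
  rw [← Finset.mul_prod_erase _ _ (Finset.mem_univ v), ← Finset.mul_prod_erase _ D (Finset.mem_univ v)]
  calc _ = (y v * o v) * ∏ w ∈ Finset.univ.erase v, o w := by ring
    _ ≤ (C * (E v * D v)) * ∏ w ∈ Finset.univ.erase v, o w :=
        mul_le_mul_of_nonneg_right (h2 v) (Finset.prod_nonneg fun w _ => ho w)
    _ ≤ (C * (E v * D v)) * ∏ w ∈ Finset.univ.erase v, (C * D w) :=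
        mul_le_mul_of_nonneg_left (Finset.prod_le_prod (fun w _ => ho w) fun w _ => h1 w)
          (mul_nonneg hC (mul_nonneg (hE v) (hD v)))
    _ = _ := by
      rw [Finset.prod_mul_distrib, Finset.prod_const, Finset.card_erase_of_mem (Finset.mem_univ v),
        Finset.card_univ]
      have : C ^ Fintype.card κ = C * C ^ (Fintype.card κ - 1) := by
        rw [← pow_succ', Nat.sub_add_cancel (Fintype.card_pos_iff.2 ⟨v⟩)]
      rw [this]; ring

lemma summable_int_norm_rpow {ι : Type*} [Fintype ι] {p : ℝ} (hp : (Fintype.card ι : ℝ) < p) :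
    Summable fun k : ι → ℤ => ‖(fun i => (k i : ℝ))‖ ^ (-p) := by
  classical
  set Λ : Submodule ℤ (ι → ℝ) := Submodule.span ℤ (Set.range (Pi.basisFun ℝ ι))
  have hr : finrank ℤ Λ = Fintype.card ι := by
    rw [ZLattice.rank ℝ Λ, finrank_fintype_fun_eq_card]
  have h1 := ZLattice.summable_norm_rpow Λ (-p) (by rw [hr]; linarith)
  let φ : (ι → ℤ) → Λ := fun k => ⟨fun i => (k i : ℝ), by
    rw [(Pi.basisFun ℝ ι).mem_span_iff_repr_mem ℤ]
    intro i
    exact ⟨k i, by simp⟩⟩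
  have hφ : Function.Injective φ := by
    intro k l h
    have h2 : (fun i => (k i : ℝ)) = fun i => (l i : ℝ) := congrArg Subtype.val h
    funext i
    exact_mod_cast congrFun h2 i
  exact (h1.comp_injective hφ : Summable ((fun z : Λ => ‖z‖ ^ (-p)) ∘ φ))

/-- The weight governing the Fourier transform of `prodFun`. -/
noncomputable def weight (p : ℝ) (s₁ : a → ℝ) (s₂ : b → ℝ) : ℝ :=
  (∑ i, (1 + |s₁ i|) ^ p + ∑ j, (1 + |s₂ j|) ^ p) *
    ((∏ i, (1 + |s₁ i|) ^ (-(1 / 2) : ℝ)) * ∏ j, (1 + |s₂ j|) ^ (-1 : ℝ))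

lemma weight_nonneg (p : ℝ) (s₁ : a → ℝ) (s₂ : b → ℝ) : 0 ≤ weight p s₁ s₂ := by
  unfold weight; positivity

lemma pi_norm_rpow_le {E : Type*} [NormedAddCommGroup E] {p : ℝ} (hp : 0 < p) (y : a → E) :
    ‖y‖ ^ p ≤ ∑ i, ‖y i‖ ^ p := by
  have h0 : 0 ≤ ∑ i, ‖y i‖ ^ p := by positivity
  have h1 : ‖y‖ ≤ (∑ i, ‖y i‖ ^ p) ^ (1 / p) := by
    refine (pi_norm_le_iff_of_nonneg (by positivity)).2 fun i => ?_
    calc ‖y i‖ = (‖y i‖ ^ p) ^ (1 / p) := by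
          rw [← Real.rpow_mul (norm_nonneg _), mul_one_div_cancel hp.ne', Real.rpow_one]
      _ ≤ _ := by
          gcongr
          exact Finset.single_le_sum (f := fun i => ‖y i‖ ^ p) (fun _ _ => by positivity)
            (Finset.mem_univ i)
  calc ‖y‖ ^ p ≤ ((∑ i, ‖y i‖ ^ p) ^ (1 / p)) ^ p := by gcongr
    _ = _ := by rw [← Real.rpow_mul h0, one_div_mul_cancel hp.ne', Real.rpow_one]

lemma norm_prod_oscInt_le {χ₁ : ℝ → ℂ} {χ₂ : ℂ → ℂ} (h₁ : IsTest χ₁) (h₂ : IsTest χ₂) {p : ℝ}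
    (hp : 0 < p) : ∃ C, 0 ≤ C ∧ ∀ (s₁ : a → ℝ) (s₂ : b → ℝ) (y : (a → ℝ) × (b → ℂ)),
      ‖y‖ ^ p * ‖(∏ i, oscInt χ₁ (s₁ i) (y.1 i)) * ∏ j, oscInt χ₂ (s₂ j) (y.2 j)‖ ≤
        C * weight p s₁ s₂ := by
  obtain ⟨C1, hC1, h1⟩ := oscInt_bound (E := ℝ) (by simp) (by simp) le_rfl h₁
  obtain ⟨C2, hC2, h2⟩ := oscInt_bound (E := ℝ) (by simp) (by simp) hp.le h₁
  obtain ⟨C3, hC3, h3⟩ := oscInt_bound (E := ℂ) (by simp) (by simp) le_rfl h₂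
  obtain ⟨C4, hC4, h4⟩ := oscInt_bound (E := ℂ) (by simp) (by simp) hp.le h₂
  simp only [finrank_self, Nat.cast_one, Complex.finrank_real_complex, Nat.cast_ofNat,
    Real.rpow_zero, one_mul, zero_sub] at h1 h2 h3 h4
  set C := C1 + C2 + C3 + C4
  have key (s₁ : a → ℝ) (s₂ : b → ℝ) (y : (a → ℝ) × (b → ℂ)) := sum_mul_prod_le (κ := a ⊕ b)
    (y := Sum.elim (fun i => ‖y.1 i‖ ^ p) fun j => ‖y.2 j‖ ^ p)
    (o := Sum.elim (fun i => ‖oscInt χ₁ (s₁ i) (y.1 i)‖) fun j => ‖oscInt χ₂ (s₂ j) (y.2 j)‖)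
    (D := Sum.elim (fun i => (1 + |s₁ i|) ^ (-(1 / 2) : ℝ)) fun j => (1 + |s₂ j|) ^ (-1 : ℝ))
    (E := Sum.elim (fun i => (1 + |s₁ i|) ^ p) fun j => (1 + |s₂ j|) ^ p) (C := C)
    (by positivity) (by rintro (i | j) <;> simp) (by rintro (i | j) <;> simp <;> positivity)
    (by rintro (i | j) <;> simp <;> positivity)
    (by
      rintro (i | j)
      · simp only [Sum.elim_inl]
        exact (h1 _ _).trans (mul_le_mul_of_nonneg_right (by simp only [C]; linarith) (by positivity))
      · simp only [Sum.elim_inr]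
        refine (h3 _ _).trans ?_
        rw [div_self two_ne_zero]
        exact mul_le_mul_of_nonneg_right (by simp only [C]; linarith) (by positivity))
    (by
      rintro (i | j)
      · simp only [Sum.elim_inl]
        rw [← Real.rpow_add (by positivity), ← sub_eq_add_neg]
        exact (h2 _ _).trans (mul_le_mul_of_nonneg_right (by simp only [C]; linarith) (by positivity))
      · simp only [Sum.elim_inr]
        refine (h4 _ _).trans ?_
        rw [div_self two_ne_zero, ← Real.rpow_add (by positivity), ← sub_eq_add_neg]
        exact mul_le_mul_of_nonneg_right (by simp only [C]; linarith) (by positivity))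
  refine ⟨C ^ Fintype.card (a ⊕ b), by positivity, fun s₁ s₂ y => ?_⟩
  refine le_trans ?_ ((key s₁ s₂ y).trans_eq ?_)
  · rw [Fintype.prod_sum_type, Fintype.sum_sum_type, norm_mul, norm_prod, norm_prod]
    simp only [Sum.elim_inl, Sum.elim_inr]
    refine mul_le_mul_of_nonneg_right ?_ (by positivity)
    rw [Prod.norm_def]
    rcases max_cases ‖y.1‖ ‖y.2‖ with h | h <;> rw [h.1]
    · exact (pi_norm_rpow_le hp _).trans (le_add_of_nonneg_right (by positivity))
    · exact (pi_norm_rpow_le hp _).trans (le_add_of_nonneg_left (by positivity))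
  · rw [Fintype.prod_sum_type, Fintype.sum_sum_type]
    rfl

section Superposition

variable {T : Type*} [MeasurableSpace T]

/-- Superposition of the functions `prodFun`. -/
noncomputable def superpose (μ : Measure T) (χ₁ : ℝ → ℂ) (χ₂ : ℂ → ℂ) (s₁ : T → a → ℝ)
    (s₂ : T → b → ℝ) (A : T → ℂ) (x : (a → ℝ) × (b → ℂ)) : ℂ :=
  ∫ τ, A τ * prodFun χ₁ χ₂ (s₁ τ) (s₂ τ) x ∂μ

variable {μ : Measure T} {χ₁ : ℝ → ℂ} {χ₂ : ℂ → ℂ} {s₁ : T → a → ℝ}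
    {s₂ : T → b → ℝ} {A : T → ℂ}

lemma IsTest.exists_norm_le {E : Type*} [NormedAddCommGroup E] [InnerProductSpace ℝ E] {χ : E → ℂ}
    (h : IsTest χ) : ∃ C, ∀ x, ‖χ x‖ ≤ C :=
  h.hasCompactSupport.exists_bound_of_continuous h.contDiff.continuous

lemma norm_prodFun (χ₁ : ℝ → ℂ) (χ₂ : ℂ → ℂ) (s₁ : a → ℝ) (s₂ : b → ℝ)
    (x : (a → ℝ) × (b → ℂ)) :
    ‖prodFun χ₁ χ₂ s₁ s₂ x‖ = (∏ i, ‖χ₁ (x.1 i)‖) * ∏ j, ‖χ₂ (x.2 j)‖ := by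
  simp [prodFun, norm_prod]

lemma continuous_prodFun (h₁ : IsTest χ₁) (h₂ : IsTest χ₂) (s₁ : a → ℝ) (s₂ : b → ℝ) :
    Continuous (prodFun χ₁ χ₂ s₁ s₂) := by
  have h3 := fun s => (h₁.normChar s).contDiff.continuous
  have h4 := fun s => (h₂.normChar s).contDiff.continuous
  unfold prodFun
  refine (continuous_finsetProd _ fun i _ => ?_).mul (continuous_finsetProd _ fun j _ => ?_)
  · exact (h3 (s₁ i)).comp ((continuous_apply i).comp continuous_fst)
  · exact (h4 (s₂ j)).comp ((continuous_apply j).comp continuous_snd)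

lemma measurable_prodFun (h₁ : IsTest χ₁) (h₂ : IsTest χ₂) (hs₁ : Measurable s₁)
    (hs₂ : Measurable s₂) : Measurable fun q : T × ((a → ℝ) × (b → ℂ)) =>
      prodFun χ₁ χ₂ (s₁ q.1) (s₂ q.1) q.2 := by
  have h3 := h₁.contDiff.continuous.measurable
  have h4 := h₂.contDiff.continuous.measurable
  unfold prodFun normChar
  fun_prop

lemma integrable_mul_prodFun [SFinite μ] (h₁ : IsTest χ₁) (h₂ : IsTest χ₂) (hs₁ : Measurable s₁)
    (hs₂ : Measurable s₂) (hA : Integrable A μ) :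
    Integrable (fun q : T × ((a → ℝ) × (b → ℂ)) => A q.1 * prodFun χ₁ χ₂ (s₁ q.1) (s₂ q.1) q.2)
      (μ.prod volume) := by
  have h5 : Integrable (fun x : (a → ℝ) × (b → ℂ) =>
      (∏ i, ‖χ₁ (x.1 i)‖) * ∏ j, ‖χ₂ (x.2 j)‖) := by
    refine Integrable.mul_prod (f := fun x : a → ℝ => ∏ i, ‖χ₁ (x i)‖)
      (g := fun x : b → ℂ => ∏ j, ‖χ₂ (x j)‖) ?_ ?_
    · exact Integrable.fintype_prod fun i => h₁.integrable.norm
    · exact Integrable.fintype_prod fun i => h₂.integrable.norm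
  refine (hA.norm.mul_prod h5).mono' ?_ (Eventually.of_forall fun q => ?_)
  · exact hA.aestronglyMeasurable.comp_fst.mul (measurable_prodFun h₁ h₂ hs₁ hs₂).aestronglyMeasurable
  · rw [norm_mul, norm_prodFun]

lemma continuous_superpose (h₁ : IsTest χ₁) (h₂ : IsTest χ₂) (hs₁ : Measurable s₁)
    (hs₂ : Measurable s₂) (hA : Integrable A μ) : Continuous (superpose μ χ₁ χ₂ s₁ s₂ A) := by
  obtain ⟨C1, hC1⟩ := h₁.exists_norm_le
  obtain ⟨C2, hC2⟩ := h₂.exists_norm_le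
  unfold superpose
  refine continuous_of_dominated (bound := fun τ => ‖A τ‖ * ((∏ i : a, C1) * ∏ j : b, C2))
    (fun x => ?_) (fun x => Eventually.of_forall fun τ => ?_) (hA.norm.mul_const _)
    (Eventually.of_forall fun τ => ?_)
  · refine hA.aestronglyMeasurable.mul (Measurable.aestronglyMeasurable ?_)
    have hm : Measurable fun τ : T => (τ, x) := measurable_id.prodMk measurable_const
    have h6 := (measurable_prodFun h₁ h₂ hs₁ hs₂).comp hm
    rw [Function.comp_def] at h6
    exact h6
  · rw [norm_mul, norm_prodFun]
    gcongr
    · exact Finset.prod_nonneg fun i _ => (norm_nonneg _).trans (hC1 0)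
    · exact hC1 _
    · exact hC2 _
  · exact continuous_const.mul (continuous_prodFun h₁ h₂ _ _)

lemma hasCompactSupport_superpose (h₁ : IsTest χ₁) (h₂ : IsTest χ₂) :
    HasCompactSupport (superpose μ χ₁ χ₂ s₁ s₂ A) := by
  have hc : IsCompact ((Set.univ.pi fun _ : a => tsupport χ₁) ×ˢ
      (Set.univ.pi fun _ : b => tsupport χ₂)) :=
    (isCompact_univ_pi fun _ => h₁.hasCompactSupport).prod
      (isCompact_univ_pi fun _ => h₂.hasCompactSupport)
  refine HasCompactSupport.intro hc fun x hx => ?_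
  refine integral_eq_zero_of_ae (Eventually.of_forall fun τ => ?_)
  have : ‖prodFun χ₁ χ₂ (s₁ τ) (s₂ τ) x‖ = 0 := by
    rw [norm_prodFun]
    by_contra h
    rw [mul_eq_zero, not_or, Finset.prod_eq_zero_iff, Finset.prod_eq_zero_iff] at h
    push Not at h
    refine hx ⟨fun i _ => subset_tsupport _ ?_, fun j _ => subset_tsupport _ ?_⟩
    · exact norm_ne_zero_iff.1 (h.1 i (Finset.mem_univ i))
    · exact norm_ne_zero_iff.1 (h.2 j (Finset.mem_univ j))
  simp [norm_eq_zero.1 this]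

lemma integral_superpose [SFinite μ] (h₁ : IsTest χ₁) (h₂ : IsTest χ₂) (hs₁ : Measurable s₁)
    (hs₂ : Measurable s₂) (hA : Integrable A μ) (y : (a → ℝ) × (b → ℂ)) :
    ∫ x, Complex.exp (((-(2 * Real.pi * pairing x y) : ℝ) : ℂ) * Complex.I) *
        superpose μ χ₁ χ₂ s₁ s₂ A x =
      ∫ τ, A τ * ((∏ i, oscInt χ₁ (s₁ τ i) (y.1 i)) * ∏ j, oscInt χ₂ (s₂ τ j) (y.2 j)) ∂μ := by
  simp_rw [← integral_prodFun, superpose, ← integral_const_mul]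
  rw [integral_integral_swap]
  · congr 1 with τ
    congr 1 with x
    ring
  · have h := integrable_mul_prodFun h₁ h₂ hs₁ hs₂ hA
    have h' := h.swap
    refine h'.mono ?_ (Eventually.of_forall fun q => ?_)
    · refine AEStronglyMeasurable.mul ?_ h'.aestronglyMeasurable
      have hpc : Continuous fun x : (a → ℝ) × (b → ℂ) =>
          Complex.exp (((-(2 * Real.pi * pairing x y) : ℝ) : ℂ) * Complex.I) := by
        unfold pairing
        fun_prop
      exact (hpc.measurable.comp measurable_fst).aestronglyMeasurable
    · simp only [Function.uncurry, Function.comp, norm_mul, Complex.norm_exp_ofReal_mul_I, one_mul,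
        Prod.swap]
      exact le_rfl

lemma norm_integral_superpose_le [SFinite μ] (h₁ : IsTest χ₁) (h₂ : IsTest χ₂) {p : ℝ}
    (hp : 0 < p) (hs₁ : Measurable s₁) (hs₂ : Measurable s₂) : ∃ C, 0 ≤ C ∧ ∀ A : T → ℂ,
      Integrable A μ → Integrable (fun τ => ‖A τ‖ * weight p (s₁ τ) (s₂ τ)) μ →
      ∀ y : (a → ℝ) × (b → ℂ),
      ‖y‖ ^ p * ‖∫ x, Complex.exp (((-(2 * Real.pi * pairing x y) : ℝ) : ℂ) * Complex.I) *
        superpose μ χ₁ χ₂ s₁ s₂ A x‖ ≤ C * ∫ τ, ‖A τ‖ * weight p (s₁ τ) (s₂ τ) ∂μ := by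
  obtain ⟨C, hC, h⟩ := norm_prod_oscInt_le (a := a) (b := b) h₁ h₂ hp
  refine ⟨C, hC, fun A hA hAW y => ?_⟩
  have h0 : 0 ≤ ‖y‖ ^ p := by positivity
  rw [integral_superpose h₁ h₂ hs₁ hs₂ hA, ← integral_const_mul]
  calc _ = ‖∫ τ, ((‖y‖ ^ p : ℝ) : ℂ) * (A τ * ((∏ i, oscInt χ₁ (s₁ τ i) (y.1 i)) *
        ∏ j, oscInt χ₂ (s₂ τ j) (y.2 j))) ∂μ‖ := by
        rw [integral_const_mul, norm_mul, Complex.norm_of_nonneg h0]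
    _ ≤ _ := by
        refine norm_integral_le_of_norm_le (hAW.const_mul C) (Eventually.of_forall fun τ => ?_)
        rw [norm_mul, norm_mul, Complex.norm_of_nonneg h0]
        calc _ = ‖A τ‖ * (‖y‖ ^ p * ‖(∏ i, oscInt χ₁ (s₁ τ i) (y.1 i)) *
            ∏ j, oscInt χ₂ (s₂ τ j) (y.2 j)‖) := by ring
          _ ≤ ‖A τ‖ * (C * weight p (s₁ τ) (s₂ τ)) := mul_le_mul_of_nonneg_left (h _ _ _) (norm_nonneg _)
          _ = _ := by ring

end Superposition

end Lattice

section LatticeSum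

open scoped FourierTransform RealInnerProductSpace ContDiff
open Module

variable {a b ι : Type*} [Fintype a] [Fintype b] [Fintype ι]

lemma exists_integral_comp_eq (L : (ι → ℝ) ≃ₗ[ℝ] (a → ℝ) × (b → ℂ)) :
    ∃ κ : ℝ, 0 ≤ κ ∧ ∀ G : (a → ℝ) × (b → ℂ) → ℂ, ∫ c, G (L c) = κ * ∫ x, G x := by
  let L' := L.toContinuousLinearEquiv
  have : (volume : Measure ((a → ℝ) × (b → ℂ))).IsAddHaarMeasure :=
    Measure.prod.instIsAddHaarMeasure volume volume
  have : ((volume : Measure (ι → ℝ)).map L').IsAddHaarMeasure :=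
    L'.isAddHaarMeasure_map _
  refine ⟨Measure.addHaarScalarFactor ((volume : Measure (ι → ℝ)).map L') volume, by positivity,
    fun G => ?_⟩
  have h1 : ∫ c, G (L c) = ∫ x, G x ∂((volume : Measure (ι → ℝ)).map L') :=
    (L'.toHomeomorph.measurableEmbedding.integral_map G).symm
  have h2 := Measure.isAddLeftInvariant_eq_smul ((volume : Measure (ι → ℝ)).map L') volume
  rw [h1]
  conv_lhs => rw [h2]
  rw [integral_smul_nnreal_measure]
  rfl

lemma pairing_le (x y : (a → ℝ) × (b → ℂ)) :
    pairing x y ≤ (Fintype.card a + Fintype.card b) * (‖x‖ * ‖y‖) := by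
  have h1 : ∀ i, x.1 i * y.1 i ≤ ‖x‖ * ‖y‖ := fun i => by
    calc x.1 i * y.1 i ≤ ‖x.1 i‖ * ‖y.1 i‖ := by rw [← norm_mul]; exact Real.le_norm_self _
      _ ≤ _ := mul_le_mul ((norm_le_pi_norm _ _).trans (norm_fst_le x))
        ((norm_le_pi_norm _ _).trans (norm_fst_le y)) (norm_nonneg _) (norm_nonneg _)
  have h2 : ∀ j, ⟪x.2 j, y.2 j⟫ ≤ ‖x‖ * ‖y‖ := fun j => 
    (real_inner_le_norm _ _).trans (mul_le_mul ((norm_le_pi_norm _ _).trans (norm_snd_le x))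
        ((norm_le_pi_norm _ _).trans (norm_snd_le y)) (norm_nonneg _) (norm_nonneg _))
  calc pairing x y ≤ ∑ i : a, ‖x‖ * ‖y‖ + ∑ j : b, ‖x‖ * ‖y‖ :=
        add_le_add (Finset.sum_le_sum fun i _ => h1 i) (Finset.sum_le_sum fun j _ => h2 j)
    _ = _ := by simp; ring

lemma exists_pairing_eq (φ : (a → ℝ) × (b → ℂ) →ₗ[ℝ] ℝ) : ∃ y, ∀ x, φ x = pairing x y := by
  classical
  refine ⟨(fun i => φ (Pi.single i 1, 0), fun j => ⟨φ (0, Pi.single j 1), φ (0, Pi.single j Complex.I)⟩),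
    fun x => ?_⟩
  have hx : x = ∑ i, x.1 i • ((Pi.single i 1, 0) : (a → ℝ) × (b → ℂ)) +
      ∑ j, ((x.2 j).re • ((0, Pi.single j 1) : (a → ℝ) × (b → ℂ)) +
        (x.2 j).im • ((0, Pi.single j Complex.I) : (a → ℝ) × (b → ℂ))) := by
    refine Prod.ext ?_ ?_
    · ext i
      simp [Prod.fst_sum, Finset.sum_apply, Pi.single_apply]
    · ext j
      simp [Prod.snd_sum, Finset.sum_apply, Pi.single_apply, Finset.sum_add_distrib,
        Complex.re_add_im]
  conv_lhs => rw [hx]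
  simp only [map_add, map_sum, map_smul, smul_eq_mul, pairing]
  congr 1
  refine Finset.sum_congr rfl fun j _ => ?_
  rw [Complex.inner]
  simp [mul_comm]

lemma exists_dual (L : (ι → ℝ) ≃ₗ[ℝ] (a → ℝ) × (b → ℂ)) :
    ∃ C : ℝ, 0 < C ∧ ∀ k : ι → ℝ, ∃ y, (∀ c, ∑ i, k i * c i = pairing (L c) y) ∧
      ‖k‖ ≤ C * ‖y‖ := by
  let L' := L.toContinuousLinearEquiv
  set N : ℝ := Fintype.card a + Fintype.card b
  refine ⟨N * ‖(L' : (ι → ℝ) →L[ℝ] (a → ℝ) × (b → ℂ))‖ + 1, by positivity, fun k => ?_⟩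
  obtain ⟨y, hy⟩ := exists_pairing_eq
    ((∑ i, k i • LinearMap.proj (R := ℝ) (φ := fun _ : ι => ℝ) i).comp L.symm.toLinearMap)
  have hy' : ∀ c, ∑ i, k i * c i = pairing (L c) y := fun c => by
    rw [← hy]; simp
  refine ⟨y, hy', ?_⟩
  rcases eq_or_ne k 0 with rfl | hk
  · simp only [norm_zero]; positivity
  have hk0 : 0 < ‖k‖ := norm_pos_iff.2 hk
  have h1 : ‖k‖ ^ 2 ≤ ∑ i, k i * k i := by
    have h2 : ‖k‖ ≤ √(∑ i, k i * k i) := by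
      refine (pi_norm_le_iff_of_nonneg (by positivity)).2 fun i => ?_
      refine Real.le_sqrt_of_sq_le ?_
      rw [Real.norm_eq_abs, sq_abs, sq]
      exact Finset.single_le_sum (f := fun i => k i * k i) (fun i _ => mul_self_nonneg _)
        (Finset.mem_univ i)
    calc _ ≤ √(∑ i, k i * k i) ^ 2 := by gcongr
      _ = _ := Real.sq_sqrt (Finset.sum_nonneg fun i _ => mul_self_nonneg _)
  have h3 : ‖L k‖ ≤ ‖(L' : (ι → ℝ) →L[ℝ] (a → ℝ) × (b → ℂ))‖ * ‖k‖ :=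
    (L' : (ι → ℝ) →L[ℝ] (a → ℝ) × (b → ℂ)).le_opNorm k
  have h4 := hy' k ▸ pairing_le (L k) y
  have h5 : ‖k‖ * ‖k‖ ≤ (N * ‖(L' : (ι → ℝ) →L[ℝ] (a → ℝ) × (b → ℂ))‖ * ‖y‖) * ‖k‖ :=
    calc ‖k‖ * ‖k‖ = ‖k‖ ^ 2 := by ring
      _ ≤ N * (‖L k‖ * ‖y‖) := h1.trans h4
      _ ≤ N * ((‖(L' : (ι → ℝ) →L[ℝ] (a → ℝ) × (b → ℂ))‖ * ‖k‖) * ‖y‖) := by gcongr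
      _ = _ := by ring
  have h6 := le_of_mul_le_mul_right h5 hk0
  rw [add_mul, one_mul]
  exact h6.trans (le_add_of_nonneg_right (norm_nonneg _))

variable {T : Type*} [MeasurableSpace T] {μ : Measure T} {χ₁ : ℝ → ℂ} {χ₂ : ℂ → ℂ}
  {s₁ : T → a → ℝ} {s₂ : T → b → ℝ}

lemma norm_tsum_lattice_sub_le [SFinite μ] (h₁ : IsTest χ₁) (h₂ : IsTest χ₂)
    (hs₁ : Measurable s₁) (hs₂ : Measurable s₂) (L : (ι → ℝ) ≃ₗ[ℝ] (a → ℝ) × (b → ℂ))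
    {p : ℝ} (hp : (Fintype.card ι : ℝ) < p) : ∃ C, 0 ≤ C ∧ ∀ A : T → ℂ,
      Integrable A μ → Integrable (fun τ => ‖A τ‖ * weight p (s₁ τ) (s₂ τ)) μ →
      ∀ R : ℝ, 1 ≤ R →
      ‖∑' m : ι → ℤ, superpose μ χ₁ χ₂ s₁ s₂ A (R⁻¹ • L fun i => (m i : ℝ)) -
        (R : ℂ) ^ Fintype.card ι * ∫ c, superpose μ χ₁ χ₂ s₁ s₂ A (L c)‖ ≤
      C * ∫ τ, ‖A τ‖ * weight p (s₁ τ) (s₂ τ) ∂μ := by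
  classical
  have hp0 : 0 < p := lt_of_le_of_lt (Nat.cast_nonneg _) hp
  obtain ⟨C1, hC1, h1⟩ := norm_integral_superpose_le (μ := μ) h₁ h₂ hp0 hs₁ hs₂
  obtain ⟨κ, hκ, hG⟩ := exists_integral_comp_eq L
  obtain ⟨C2, hC2, h2⟩ := exists_dual L
  set S := ∑' k : ι → ℤ, ‖(fun i => (k i : ℝ))‖ ^ (-p)
  have hS := summable_int_norm_rpow (ι := ι) hp
  refine ⟨κ * C1 * C2 ^ p * S, by positivity, fun A hA hAW R hR => ?_⟩
  have hR0 : 0 < R := by positivity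
  set f := superpose μ χ₁ χ₂ s₁ s₂ A
  have hfc : Continuous f := continuous_superpose h₁ h₂ hs₁ hs₂ hA
  have hfs : HasCompactSupport f := hasCompactSupport_superpose h₁ h₂
  set W := ∫ τ, ‖A τ‖ * weight p (s₁ τ) (s₂ τ) ∂μ
  have hW : 0 ≤ W := integral_nonneg fun τ => mul_nonneg (norm_nonneg _) (weight_nonneg _ _ _)
  let F : (ι → ℝ) → ℂ := fun c => f (R⁻¹ • L c)
  let e : (ι → ℝ) ≃ₜ (a → ℝ) × (b → ℂ) :=
    L.toContinuousLinearEquiv.toHomeomorph.trans (Homeomorph.smulOfNeZero R⁻¹ (by positivity))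
  have hF : F = f ∘ e := rfl
  have hFc : Continuous F := hF ▸ hfc.comp e.continuous
  have hFs : HasCompactSupport F := hF ▸ hfs.comp_homeomorph e
  have hscale : ∀ G : (ι → ℝ) → ℂ, ∫ c, G (R⁻¹ • c) = (R : ℂ) ^ Fintype.card ι * ∫ c, G c := by
    intro G
    rw [Measure.integral_comp_inv_smul, finrank_fintype_fun_eq_card, abs_of_pos (by positivity),
      Complex.real_smul]
    push_cast; rfl
  have hInt : ∫ c, F c = (R : ℂ) ^ Fintype.card ι * ∫ c, f (L c) := by
    rw [← hscale]
    simp only [F, map_smul]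
  rw [← hInt]
  refine (norm_tsum_sub_integral_le hFc hFs
    (B := fun k => κ * C1 * C2 ^ p * W * ‖(fun i => (k i : ℝ))‖ ^ (-p))
    (hS.mul_left _) (by positivity) fun k hk => ?_).trans_eq ?_
  swap
  · rw [tsum_mul_left]; ring
  have hk0 : 0 < ‖(fun i => (k i : ℝ))‖ := by
    rw [norm_pos_iff]
    intro h
    exact hk (funext fun i => by simpa using congrFun h i)
  obtain ⟨y, hy, hyk⟩ := h2 fun i => (k i : ℝ)
  have hy0 : 0 < ‖y‖ := by
    by_contra h
    have : ‖y‖ = 0 := le_antisymm (not_lt.1 h) (norm_nonneg _)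
    rw [this, mul_zero] at hyk
    linarith
  have hF1 : intFourier F k = (R : ℂ) ^ Fintype.card ι * (κ *
      ∫ x, Complex.exp (((-(2 * Real.pi * pairing x (R • y)) : ℝ) : ℂ) * Complex.I) * f x) := by
    rw [← hG, ← hscale, intFourier]
    congr 1 with c
    simp only [F, map_smul]
    rw [hy]
    congr 5
    rw [pairing, pairing]
    simp only [Prod.smul_fst, Prod.smul_snd, Pi.smul_apply, smul_eq_mul, real_inner_smul_left,
      real_inner_smul_right]
    have e1 : ∀ u v : ℝ, R⁻¹ * u * (R * v) = u * v := fun u v => by field_simp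
    have e2 : ∀ u : ℝ, R * (R⁻¹ * u) = u := fun u => by field_simp
    simp only [e1, e2]
  have h3 := h1 A hA hAW (R • y)
  rw [norm_smul, Real.norm_of_nonneg hR0.le, Real.mul_rpow hR0.le hy0.le] at h3
  rw [hF1, norm_mul, norm_mul, norm_pow, Complex.norm_of_nonneg hR0.le, Complex.norm_of_nonneg hκ]
  set Q := ‖∫ x, Complex.exp (((-(2 * Real.pi * pairing x (R • y)) : ℝ) : ℂ) * Complex.I) * f x‖
  have h4 : R ^ Fintype.card ι ≤ R ^ p := by
    rw [← Real.rpow_natCast]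
    exact Real.rpow_le_rpow_of_exponent_le hR hp.le
  have h5 : ‖(fun i => (k i : ℝ))‖ ^ p ≤ C2 ^ p * ‖y‖ ^ p := by
    rw [← Real.mul_rpow hC2.le hy0.le]
    gcongr
  rw [Real.rpow_neg hk0.le, ← div_eq_mul_inv, le_div_iff₀ (by positivity)]
  calc R ^ Fintype.card ι * (κ * Q) * ‖(fun i => (k i : ℝ))‖ ^ p
      ≤ R ^ p * (κ * Q) * (C2 ^ p * ‖y‖ ^ p) := by gcongr
    _ = κ * C2 ^ p * (R ^ p * ‖y‖ ^ p * Q) := by ring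
    _ ≤ κ * C2 ^ p * (C1 * W) := by gcongr
    _ = _ := by ring

end LatticeSum

section Cutoff

open scoped FourierTransform RealInnerProductSpace ContDiff
open Module

lemma exists_isTest (E : Type*) [NormedAddCommGroup E] [InnerProductSpace ℝ E]
    [FiniteDimensional ℝ E] (B : ℝ) :
    ∃ χ : E → ℂ, IsTest χ ∧ ∀ z, z ≠ 0 → |Real.log ‖z‖| ≤ B → χ z = 1 := by
  set m := Real.exp (-B) ^ 2
  set M := Real.exp B ^ 2
  have hm : 0 < m := by positivity
  let χ : E → ℂ := fun z => ((Real.smoothTransition (2 * ‖z‖ ^ 2 / m - 1) *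
    Real.smoothTransition (M + 1 - ‖z‖ ^ 2) : ℝ) : ℂ)
  refine ⟨χ, ⟨?_, ?_, ?_⟩, ?_⟩
  · refine Complex.ofRealCLM.contDiff.comp (ContDiff.mul ?_ ?_)
    · refine Real.smoothTransition.contDiff.comp ?_
      exact ((contDiff_const.mul (contDiff_norm_sq ℝ)).div_const _).sub contDiff_const
    · exact Real.smoothTransition.contDiff.comp (contDiff_const.sub (contDiff_norm_sq ℝ))
  · refine HasCompactSupport.intro (isCompact_closedBall (0 : E) (√(M + 1))) fun z hz => ?_
    have h1 : M + 1 ≤ ‖z‖ ^ 2 := by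
      rw [mem_closedBall_zero_iff, not_le] at hz
      exact (Real.sqrt_le_iff.1 hz.le).2
    simp only [χ]
    rw [Real.smoothTransition.zero_of_nonpos (x := M + 1 - ‖z‖ ^ 2) (by linarith)]
    simp
  · rw [notMem_tsupport_iff_eventuallyEq]
    have : ∀ᶠ z : E in nhds 0, ‖z‖ ^ 2 < m / 2 := by
      refine (continuous_norm.pow 2).continuousAt.eventually_lt continuousAt_const ?_
      simp [hm]
    filter_upwards [this] with z hz
    simp only [χ]
    rw [Real.smoothTransition.zero_of_nonpos (x := 2 * ‖z‖ ^ 2 / m - 1)]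
    · simp
    · rw [sub_nonpos, div_le_one hm]; linarith
  · intro z hz hlog
    have hz0 : 0 < ‖z‖ := norm_pos_iff.2 hz
    have h1 : Real.exp (-B) ≤ ‖z‖ := by
      rw [← Real.le_log_iff_exp_le hz0]; exact (abs_le.1 hlog).1
    have h2 : ‖z‖ ≤ Real.exp B := by
      rw [← Real.log_le_iff_le_exp hz0]; exact (abs_le.1 hlog).2
    have h3 : m ≤ ‖z‖ ^ 2 := by simp only [m]; gcongr
    have h4 : ‖z‖ ^ 2 ≤ M := by simp only [M]; gcongr
    simp only [χ]
    rw [Real.smoothTransition.one_of_one_le, Real.smoothTransition.one_of_one_le]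
    · simp
    · linarith
    · rw [le_sub_iff_add_le, le_div_iff₀ hm]; linarith

/-- A smooth bump whose integer translates sum to `1`. -/
noncomputable def bump (c : ℝ) : ℝ := Real.smoothTransition (c + 1) - Real.smoothTransition c

lemma contDiff_bump : ContDiff ℝ ∞ bump :=
  (Real.smoothTransition.contDiff.comp (contDiff_id.add contDiff_const)).sub
    Real.smoothTransition.contDiff

lemma bump_eq_zero {c : ℝ} (hc : 1 ≤ |c|) : bump c = 0 := by
  rcases le_abs.1 hc with h | h
  · rw [bump, Real.smoothTransition.one_of_one_le h, Real.smoothTransition.one_of_one_le (by linarith),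
      sub_self]
  · rw [bump, Real.smoothTransition.zero_of_nonpos (by linarith),
      Real.smoothTransition.zero_of_nonpos (by linarith), sub_self]

lemma hasCompactSupport_bump : HasCompactSupport bump :=
  HasCompactSupport.intro (isCompact_closedBall (0 : ℝ) 1) fun z hz => bump_eq_zero (by
    rw [mem_closedBall_zero_iff, not_le] at hz; exact hz.le)

/-- The Fourier transform of `bump`. -/
noncomputable def bumpHat : ℝ → ℂ := 𝓕 fun c => (bump c : ℂ)

lemma contDiff_ofReal_bump : ContDiff ℝ ∞ fun c => (bump c : ℂ) :=
  Complex.ofRealCLM.contDiff.comp contDiff_bump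

lemma hasCompactSupport_ofReal_bump : HasCompactSupport fun c => (bump c : ℂ) :=
  hasCompactSupport_bump.comp_left (g := fun x : ℝ => (x : ℂ)) (by simp)

lemma bumpHat_eq_coe : bumpHat =
    𝓕 (hasCompactSupport_ofReal_bump.toSchwartzMap contDiff_ofReal_bump) := by
  rw [SchwartzMap.fourier_coe]
  rfl

lemma integrable_bumpHat : Integrable bumpHat := by
  rw [bumpHat_eq_coe]
  exact SchwartzMap.integrable _

lemma integrable_bumpHat_mul (q : ℝ) : Integrable fun τ => ‖bumpHat τ‖ * (1 + |τ|) ^ q := by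
  obtain ⟨k, hk⟩ := exists_nat_ge q
  set φ := 𝓕 (hasCompactSupport_ofReal_bump.toSchwartzMap contDiff_ofReal_bump)
  have h1 := ((φ.integrable (μ := volume)).norm).const_mul (2 ^ k)
  have h2 := (φ.integrable_pow_mul volume k).const_mul (2 ^ k)
  rw [bumpHat_eq_coe]
  refine (h1.add h2).mono' ?_ (Eventually.of_forall fun τ => ?_)
  · refine (φ.continuous.norm.mul ?_).aestronglyMeasurable
    exact (continuous_const.add continuous_abs).rpow_const fun x =>
      Or.inl (add_pos_of_pos_of_nonneg one_pos (abs_nonneg x)).ne'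
  · rw [norm_mul, norm_norm, Real.norm_of_nonneg (by positivity)]
    have h3 : (1 + |τ|) ^ q ≤ 2 ^ k + 2 ^ k * |τ| ^ k := by
      calc (1 + |τ|) ^ q ≤ (1 + |τ|) ^ (k : ℝ) :=
            Real.rpow_le_rpow_of_exponent_le (by linarith [abs_nonneg τ]) hk
        _ = (1 + |τ|) ^ k := Real.rpow_natCast _ _
        _ ≤ _ := by
          rcases le_total |τ| 1 with h | h
          · calc (1 + |τ|) ^ k ≤ 2 ^ k := by gcongr; linarith
              _ ≤ _ := by simp
          · calc (1 + |τ|) ^ k ≤ (2 * |τ|) ^ k := by gcongr; linarith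
              _ = 2 ^ k * |τ| ^ k := mul_pow _ _ _
              _ ≤ _ := by simp
    calc _ ≤ ‖φ τ‖ * (2 ^ k + 2 ^ k * |τ| ^ k) := by gcongr
      _ = _ := by simp only [Pi.add_apply, Real.norm_eq_abs]; ring

lemma integral_bumpHat (c : ℝ) :
    ∫ τ, bumpHat τ * Complex.exp (((2 * Real.pi * (τ * c) : ℝ) : ℂ) * Complex.I) = bump c := by
  have h := congrFun (Continuous.fourierInv_fourier_eq
    (f := fun c => (bump c : ℂ)) contDiff_ofReal_bump.continuous
    (contDiff_ofReal_bump.continuous.integrable_of_hasCompactSupport hasCompactSupport_ofReal_bump)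
    integrable_bumpHat) c
  rw [Real.fourierInv_eq'] at h
  rw [← h]
  congr 1 with τ
  simp [bumpHat, mul_comm]

end Cutoff

section Unfold

open scoped FourierTransform RealInnerProductSpace ContDiff
open Module

variable {a b ι ρ : Type*} [Fintype a] [Fintype b] [Fintype ι] [Fintype ρ]

lemma weight_le {p X Y : ℝ} (hp : 0 ≤ p) (hX0 : 0 < X) (hY : 1 ≤ Y) {s₁ : a → ℝ} {s₂ : b → ℝ}
    (h1 : ∀ i, 1 + |s₁ i| ≤ X * Y) (h2 : ∀ i, 1 + |s₂ i| ≤ X * Y)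
    (h3 : ∀ i, Y ≤ X * (1 + |s₁ i|)) (h4 : ∀ i, Y ≤ X * (1 + |s₂ i|)) :
    weight p s₁ s₂ ≤ (Fintype.card a + Fintype.card b) *
      (X ^ (p + ((Fintype.card a : ℝ) + 2 * Fintype.card b) / 2) *
        Y ^ (p - ((Fintype.card a : ℝ) + 2 * Fintype.card b) / 2)) := by
  have hY0 : 0 < Y := by linarith
  have hX := hX0.le
  have key : ∀ (e : ℝ) (s : ℝ), 0 ≤ e → Y ≤ X * (1 + |s|) → (1 + |s|) ^ (-e) ≤ X ^ e * Y ^ (-e) := by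
    intro e s he h
    have hs : 0 < 1 + |s| := by positivity
    rw [Real.rpow_neg hs.le, Real.rpow_neg hY0.le, inv_le_iff_one_le_mul₀ (by positivity)]
    rw [mul_right_comm, ← div_eq_mul_inv, one_le_div (by positivity), ← Real.mul_rpow hX hs.le]
    gcongr
  unfold weight
  have hs : (∑ i, (1 + |s₁ i|) ^ p + ∑ j, (1 + |s₂ j|) ^ p) ≤
      (Fintype.card a + Fintype.card b) * (X * Y) ^ p := by
    calc _ ≤ ∑ i : a, (X * Y) ^ p + ∑ j : b, (X * Y) ^ p := by
          gcongr with i _ j _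
          · exact h1 i
          · exact h2 j
      _ = _ := by simp; ring
  have hpr : (∏ i, (1 + |s₁ i|) ^ (-(1 / 2) : ℝ)) * ∏ j, (1 + |s₂ j|) ^ (-1 : ℝ) ≤
      (∏ i : a, X ^ (1 / 2 : ℝ) * Y ^ (-(1 / 2) : ℝ)) * ∏ j : b, X ^ (1 : ℝ) * Y ^ (-1 : ℝ) := by
    gcongr with i _ j _
    · exact key _ _ (by norm_num) (h3 i)
    · exact key _ _ (by norm_num) (h4 j)
  refine (mul_le_mul hs hpr (by positivity) (by positivity)).trans_eq ?_
  set A : ℝ := (Fintype.card a : ℝ)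
  set B : ℝ := (Fintype.card b : ℝ)
  rw [Finset.prod_const, Finset.prod_const, Finset.card_univ, Finset.card_univ, mul_pow, mul_pow,
    Real.mul_rpow hX hY0.le]
  simp only [← Real.rpow_natCast, ← Real.rpow_mul hX, ← Real.rpow_mul hY0.le]
  have e1 : X ^ (p + (A + 2 * B) / 2) = X ^ p * X ^ (1 / 2 * A) * X ^ (1 * B) := by
    rw [← Real.rpow_add hX0, ← Real.rpow_add hX0]; congr 1; ring
  have e2 : Y ^ (p - (A + 2 * B) / 2) = Y ^ p * Y ^ (-(1 / 2) * A) * Y ^ (-1 * B) := by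
    rw [← Real.rpow_add hY0, ← Real.rpow_add hY0]; congr 1; ring
  rw [e1, e2]
  simp only [A, B]
  ring

lemma prodFun_eq (χ₁ : ℝ → ℂ) (χ₂ : ℂ → ℂ) (s₁ : a → ℝ) (s₂ : b → ℝ) (x : (a → ℝ) × (b → ℂ)) :
    prodFun χ₁ χ₂ s₁ s₂ x = ((∏ i, χ₁ (x.1 i)) * ∏ j, χ₂ (x.2 j)) *
      Complex.exp (((∑ i, s₁ i * Real.log ‖x.1 i‖ + ∑ j, s₂ j * Real.log ‖x.2 j‖ : ℝ) : ℂ) *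
        Complex.I) := by
  simp only [prodFun, normChar, Finset.prod_mul_distrib, ← Complex.exp_sum, Complex.ofReal_add,
    Complex.ofReal_sum, add_mul, Complex.exp_add, Finset.sum_mul]
  ring

/-- A linear form in the logarithms of the coordinates. -/
noncomputable def logForm (γ₁ : a → ℝ) (γ₂ : b → ℝ) (x : (a → ℝ) × (b → ℂ)) : ℝ :=
  ∑ i, γ₁ i * Real.log ‖x.1 i‖ + ∑ j, γ₂ j * Real.log ‖x.2 j‖

open Classical in
/-- The function `∏ bump (c_i x) * g (log |N x|)` on vectors with nonzero coordinates. -/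
noncomputable def mainFun (γ₁ : ρ → a → ℝ) (γ₂ : ρ → b → ℝ) (g : ℝ → ℂ)
    (x : (a → ℝ) × (b → ℂ)) : ℂ :=
  if (∀ i, x.1 i ≠ 0) ∧ ∀ j, x.2 j ≠ 0 then
    (∏ k, (bump (logForm (γ₁ k) (γ₂ k) x) : ℂ)) * g (logForm 1 2 x) else 0

/-- The frequencies at the real coordinates. -/
noncomputable def freq {a : Type*} (d : ℝ) (γ : ρ → a → ℝ) (τ : (ρ → ℝ) × ℝ) (i : a) : ℝ :=
  2 * Real.pi * (∑ k, τ.1 k * γ k i + τ.2 * d)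

/-- The amplitude. -/
noncomputable def ampl (g : ℝ → ℂ) (τ : (ρ → ℝ) × ℝ) : ℂ := (∏ k, bumpHat (τ.1 k)) * 𝓕 g τ.2

lemma integral_ampl (γ₁ : ρ → a → ℝ) (γ₂ : ρ → b → ℝ) {g : ℝ → ℂ} (hg : Continuous g)
    (hgi : Integrable g) (hgf : Integrable (𝓕 g)) (x : (a → ℝ) × (b → ℂ)) :
    ∫ τ, ampl g τ * Complex.exp (((∑ i, freq 1 γ₁ τ i * Real.log ‖x.1 i‖ +
      ∑ j, freq 2 γ₂ τ j * Real.log ‖x.2 j‖ : ℝ) : ℂ) * Complex.I) =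
      (∏ k, (bump (logForm (γ₁ k) (γ₂ k) x) : ℂ)) * g (logForm 1 2 x) := by
  have hg1 : ∫ t, 𝓕 g t * Complex.exp (((2 * Real.pi * (t * logForm 1 2 x) : ℝ) : ℂ) * Complex.I) =
      g (logForm 1 2 x) := by
    have h := congrFun (Continuous.fourierInv_fourier_eq hg hgi hgf) (logForm 1 2 x)
    rw [Real.fourierInv_eq'] at h
    rw [← h]
    congr 1 with τ
    simp [mul_comm]
  rw [← hg1]
  simp_rw [← integral_bumpHat]
  rw [← integral_fintype_prod_volume_eq_prod (fun (k : ρ) (z : ℝ) => bumpHat z *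
    Complex.exp (((2 * Real.pi * (z * logForm (γ₁ k) (γ₂ k) x) : ℝ) : ℂ) * Complex.I)),
    ← integral_prod_mul]
  congr 1 with τ
  simp only [Finset.prod_mul_distrib, ← Complex.exp_sum, ampl]
  rw [mul_mul_mul_comm, ← Complex.exp_add, ← Finset.sum_mul, ← add_mul, ← Complex.ofReal_sum,
    ← Complex.ofReal_add]
  congr 4
  simp only [freq, logForm, Finset.mul_sum, Finset.sum_mul, mul_add, add_mul,
    Finset.sum_add_distrib, Pi.ofNat_apply]
  rw [Finset.sum_comm, Finset.sum_comm (s := (Finset.univ : Finset b))]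
  simp only [mul_assoc]
  ring

lemma one_add_sum_le_prod (τ : ρ → ℝ) : 1 + ∑ k, |τ k| ≤ ∏ k, (1 + |τ k|) := by
  classical
  induction (Finset.univ : Finset ρ) using Finset.induction_on with
  | empty => simp
  | insert k s hk ih =>
    rw [Finset.sum_insert hk, Finset.prod_insert hk]
    have h1 : 1 ≤ ∏ k ∈ s, (1 + |τ k|) := ih.trans' (by
      have : 0 ≤ ∑ k ∈ s, |τ k| := Finset.sum_nonneg fun _ _ => abs_nonneg _
      linarith)
    nlinarith [abs_nonneg (τ k)]

lemma superpose_ampl_eq {γ₁ : ρ → a → ℝ} {γ₂ : ρ → b → ℝ}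
    (H : ∀ B : ℝ, ∃ B' : ℝ, ∀ x : (a → ℝ) × (b → ℂ), (∀ i, x.1 i ≠ 0) → (∀ j, x.2 j ≠ 0) →
      (∀ k, |logForm (γ₁ k) (γ₂ k) x| ≤ B) → |logForm 1 2 x| ≤ B →
      (∀ i, |Real.log ‖x.1 i‖| ≤ B') ∧ ∀ j, |Real.log ‖x.2 j‖| ≤ B') (r : ℝ) :
    ∃ χ₁ χ₂, IsTest χ₁ ∧ IsTest χ₂ ∧ ∀ g : ℝ → ℂ, Continuous g → Integrable g → Integrable (𝓕 g) →
      (∀ u, r < |u| → g u = 0) → ∀ x,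
        superpose volume χ₁ χ₂ (freq 1 γ₁) (freq 2 γ₂) (ampl (ρ := ρ) g) x = mainFun γ₁ γ₂ g x := by
  obtain ⟨B', hB'⟩ := H (max 1 r)
  obtain ⟨χ₁, h₁, h₁'⟩ := exists_isTest ℝ B'
  obtain ⟨χ₂, h₂, h₂'⟩ := exists_isTest ℂ B'
  refine ⟨χ₁, χ₂, h₁, h₂, fun g hg hgi hgf hr x => ?_⟩
  have e : superpose volume χ₁ χ₂ (freq 1 γ₁) (freq 2 γ₂) (ampl (ρ := ρ) g) x =
      ((∏ i, χ₁ (x.1 i)) * ∏ j, χ₂ (x.2 j)) *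
        ((∏ k, (bump (logForm (γ₁ k) (γ₂ k) x) : ℂ)) * g (logForm 1 2 x)) := by
    rw [← integral_ampl γ₁ γ₂ hg hgi hgf, ← integral_const_mul, superpose]
    congr 1 with τ
    rw [prodFun_eq]
    ring
  rw [e, mainFun]
  split_ifs with hx
  · by_cases h0 : (∀ k, |logForm (γ₁ k) (γ₂ k) x| ≤ 1) ∧ |logForm 1 2 x| ≤ r
    · obtain ⟨hb1, hb2⟩ := hB' x hx.1 hx.2 (fun k => (h0.1 k).trans (le_max_left _ _))
        (h0.2.trans (le_max_right _ _))
      rw [Finset.prod_eq_one fun i _ => h₁' _ (hx.1 i) (hb1 i),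
        Finset.prod_eq_one fun i _ => h₂' _ (hx.2 i) (hb2 i), one_mul, one_mul]
    · rw [not_and_or] at h0
      push Not at h0
      rcases h0 with ⟨k, hk⟩ | h
      · rw [Finset.prod_eq_zero (Finset.mem_univ k) (by rw [bump_eq_zero hk.le]; simp)]
        simp
      · rw [hr _ h]; simp
  · rw [not_and_or] at hx
    push Not at hx
    have hz₁ : χ₁ 0 = 0 := image_eq_zero_of_notMem_tsupport h₁.zero_notMem
    have hz₂ : χ₂ 0 = 0 := image_eq_zero_of_notMem_tsupport h₂.zero_notMem
    rcases hx with ⟨i, hi⟩ | ⟨j, hj⟩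
    · rw [Finset.prod_eq_zero (Finset.mem_univ i) (by rw [hi, hz₁])]; simp
    · rw [Finset.prod_eq_zero (f := fun j => χ₂ (x.2 j)) (Finset.mem_univ j) (by rw [hj, hz₂])]; simp

lemma exists_weight_freq_le (γ₁ : ρ → a → ℝ) (γ₂ : ρ → b → ℝ) {p : ℝ} (hp : 0 ≤ p) :
    ∃ C, 0 ≤ C ∧ ∀ τ, weight p (freq 1 γ₁ τ) (freq 2 γ₂ τ) ≤
      C * ((∏ k, (1 + |τ.1 k|) ^ (p + ((Fintype.card a : ℝ) + 2 * Fintype.card b) / 2)) *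
        (1 + |τ.2|) ^ (p - ((Fintype.card a : ℝ) + 2 * Fintype.card b) / 2)) := by
  set G : ℝ := ∑ k, ∑ i, |γ₁ k i| + ∑ k, ∑ j, |γ₂ k j|
  have hG0 : 0 ≤ G := by positivity
  set C : ℝ := 1 + 2 * Real.pi * (G + 2)
  have hpi := Real.pi_gt_three
  have hC : 1 ≤ C := le_add_of_nonneg_right (by positivity)
  have key : ∀ (d : ℝ) (γ : ρ → ℝ) (τ : (ρ → ℝ) × ℝ), 1 ≤ d → d ≤ 2 → (∀ k, |γ k| ≤ G) →
      1 + |2 * Real.pi * (∑ k, τ.1 k * γ k + τ.2 * d)| ≤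
        (C * ∏ k, (1 + |τ.1 k|)) * (1 + |τ.2|) ∧
      1 + |τ.2| ≤ (C * ∏ k, (1 + |τ.1 k|)) *
        (1 + |2 * Real.pi * (∑ k, τ.1 k * γ k + τ.2 * d)|) := by
    intro d γ τ hd1 hd2 hγ
    have hS0 : 0 ≤ ∑ k, |τ.1 k| := by positivity
    have hP := one_add_sum_le_prod τ.1
    have hs : |∑ k, τ.1 k * γ k| ≤ G * ∑ k, |τ.1 k| := by
      refine (Finset.abs_sum_le_sum_abs _ _).trans ?_
      rw [Finset.mul_sum]
      refine Finset.sum_le_sum fun k _ => ?_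
      rw [abs_mul, mul_comm]
      exact mul_le_mul_of_nonneg_right (hγ k) (abs_nonneg _)
    set S := ∑ k, |τ.1 k|
    set P := ∏ k, (1 + |τ.1 k|)
    set Q := ∑ k, τ.1 k * γ k
    have ht : |τ.2 * d| = |τ.2| * d := by rw [abs_mul, abs_of_nonneg (by linarith : 0 ≤ d)]
    have ht0 := abs_nonneg τ.2
    rw [abs_mul, abs_of_pos (by positivity : 0 < 2 * Real.pi)]
    constructor
    · have h1 : |Q + τ.2 * d| ≤ G * S + 2 * |τ.2| := by
        refine (abs_add_le _ _).trans (add_le_add hs ?_)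
        rw [ht]; nlinarith
      calc 1 + 2 * Real.pi * |Q + τ.2 * d| ≤ 1 + 2 * Real.pi * (G * S + 2 * |τ.2|) := by gcongr
        _ ≤ 1 + 2 * Real.pi * ((G + 2) * ((1 + S) * (1 + |τ.2|))) := by
            have : 0 ≤ S * |τ.2| := by positivity
            gcongr
            nlinarith [mul_nonneg hG0 ht0, mul_nonneg hG0 this]
        _ ≤ (1 + S) * (1 + |τ.2|) + 2 * Real.pi * ((G + 2) * ((1 + S) * (1 + |τ.2|))) := by
            have : 0 ≤ S * |τ.2| := by positivity
            nlinarith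
        _ = C * (1 + S) * (1 + |τ.2|) := by simp only [C]; ring
        _ ≤ _ := by gcongr
    · set Z := |Q + τ.2 * d|
      have h1 : |τ.2| ≤ Z + G * S := by
        have : |τ.2 * d| ≤ Z + |Q| := by
          have := abs_sub (Q + τ.2 * d) Q
          rwa [add_sub_cancel_left] at this
        rw [ht] at this
        nlinarith
      have hZ : 0 ≤ Z := abs_nonneg _
      calc 1 + |τ.2| ≤ 1 + (Z + G * S) := by gcongr
        _ ≤ C * (1 + S) * (1 + 2 * Real.pi * Z) := by
          have e1 : 1 + G ≤ C := by simp only [C]; nlinarith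
          have e2 : 1 + G * S ≤ C * (1 + S) := by nlinarith
          have e3 : 1 ≤ C * (1 + S) := by nlinarith
          have e4 : Z ≤ 2 * Real.pi * Z := by nlinarith
          nlinarith [mul_le_mul e3 e4 hZ (by positivity)]
        _ ≤ _ := by gcongr
  set e1 := p + ((Fintype.card a : ℝ) + 2 * Fintype.card b) / 2
  refine ⟨(Fintype.card a + Fintype.card b) * C ^ e1, by positivity, fun τ => ?_⟩
  have k1 : ∀ i, _ := fun i => key 1 (fun k => γ₁ k i) τ le_rfl (by norm_num) fun k => by
    refine le_add_of_le_of_nonneg ?_ (by positivity)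
    exact (Finset.single_le_sum (f := fun i => |γ₁ k i|) (fun _ _ => abs_nonneg _)
      (Finset.mem_univ i)).trans (Finset.single_le_sum (f := fun k => ∑ i, |γ₁ k i|)
        (fun _ _ => by positivity) (Finset.mem_univ k))
  have k2 : ∀ i, _ := fun i => key 2 (fun k => γ₂ k i) τ (by norm_num) le_rfl fun k => by
    refine le_add_of_nonneg_of_le (by positivity) ?_
    exact (Finset.single_le_sum (f := fun i => |γ₂ k i|) (fun _ _ => abs_nonneg _)
      (Finset.mem_univ i)).trans (Finset.single_le_sum (f := fun k => ∑ i, |γ₂ k i|)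
        (fun _ _ => by positivity) (Finset.mem_univ k))
  refine (weight_le hp (X := C * ∏ k, (1 + |τ.1 k|)) (Y := 1 + |τ.2|) (by positivity)
    (le_add_of_nonneg_right (abs_nonneg _)) (fun i => (k1 i).1) (fun i => (k2 i).1)
    (fun i => (k1 i).2) fun i => (k2 i).2).trans_eq ?_
  rw [Real.mul_rpow (by positivity) (by positivity),
    ← Real.finsetProd_rpow _ _ fun k _ => by positivity]
  ring

/-- The weighted `L¹` norm of the Fourier transform. -/
noncomputable def fourierNorm (e : ℝ) (g : ℝ → ℂ) : ℝ := ∫ t, ‖𝓕 g t‖ * (1 + |t|) ^ e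

/-- Continuous functions supported in `[-r, r]` with finite weighted Fourier norm. -/
structure IsWeight (e r : ℝ) (g : ℝ → ℂ) : Prop where
  continuous : Continuous g
  eq_zero : ∀ u, r < |u| → g u = 0
  integrable_fourier : Integrable fun t => ‖𝓕 g t‖ * (1 + |t|) ^ e

lemma IsWeight.hasCompactSupport {e r : ℝ} {g : ℝ → ℂ} (hg : IsWeight e r g) :
    HasCompactSupport g :=
  HasCompactSupport.intro (isCompact_closedBall (0 : ℝ) r) fun z hz => hg.eq_zero z (by
    rwa [mem_closedBall_zero_iff, not_le] at hz)

lemma IsWeight.integrable {e r : ℝ} {g : ℝ → ℂ} (hg : IsWeight e r g) : Integrable g :=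
  hg.continuous.integrable_of_hasCompactSupport hg.hasCompactSupport

lemma IsWeight.integrable_fourier' {e r : ℝ} (he : 0 ≤ e) {g : ℝ → ℂ} (hg : IsWeight e r g) :
    Integrable (𝓕 g) := by
  refine hg.integrable_fourier.mono' ?_ (Eventually.of_forall fun t => ?_)
  · exact (VectorFourier.fourierIntegral_continuous Real.continuous_fourierChar
      (by exact continuous_inner) hg.integrable).aestronglyMeasurable
  · exact le_mul_of_one_le_right (norm_nonneg _)
      (Real.one_le_rpow (le_add_of_nonneg_right (abs_nonneg _)) he)

lemma exists_norm_tsum_mainFun_sub_le {γ₁ : ρ → a → ℝ} {γ₂ : ρ → b → ℝ}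
    (H : ∀ B : ℝ, ∃ B' : ℝ, ∀ x : (a → ℝ) × (b → ℂ), (∀ i, x.1 i ≠ 0) → (∀ j, x.2 j ≠ 0) →
      (∀ k, |logForm (γ₁ k) (γ₂ k) x| ≤ B) → |logForm 1 2 x| ≤ B →
      (∀ i, |Real.log ‖x.1 i‖| ≤ B') ∧ ∀ j, |Real.log ‖x.2 j‖| ≤ B')
    (hn : Fintype.card ι = Fintype.card a + 2 * Fintype.card b)
    (L : (ι → ℝ) ≃ₗ[ℝ] (a → ℝ) × (b → ℂ)) (r : ℝ) {p : ℝ} (hp : (Fintype.card ι : ℝ) < p) :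
    ∃ C, 0 ≤ C ∧ ∀ g : ℝ → ℂ, IsWeight (p - (Fintype.card ι : ℝ) / 2) r g → ∀ R : ℝ, 1 ≤ R →
      ‖∑' m : ι → ℤ, mainFun γ₁ γ₂ g (R⁻¹ • L fun i => (m i : ℝ)) -
        (R : ℂ) ^ Fintype.card ι * ∫ c, mainFun γ₁ γ₂ g (L c)‖ ≤
      C * fourierNorm (p - (Fintype.card ι : ℝ) / 2) g := by
  have hn' : (Fintype.card ι : ℝ) = (Fintype.card a : ℝ) + 2 * Fintype.card b := by
    exact_mod_cast hn
  have hp0 : 0 ≤ p := (Nat.cast_nonneg _).trans hp.le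
  have he : 0 ≤ p - (Fintype.card ι : ℝ) / 2 := by
    have : (0 : ℝ) ≤ Fintype.card ι := Nat.cast_nonneg _
    linarith
  obtain ⟨χ₁, χ₂, h₁, h₂, hχ⟩ := superpose_ampl_eq H r
  have hm₁ : Measurable (freq 1 γ₁) := by unfold freq; fun_prop
  have hm₂ : Measurable (freq 2 γ₂) := by unfold freq; fun_prop
  obtain ⟨C1, hC1, hB⟩ := norm_tsum_lattice_sub_le (μ := volume) h₁ h₂ hm₁ hm₂ L hp
  obtain ⟨C2, hC2, hw⟩ := exists_weight_freq_le γ₁ γ₂ hp0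
  rw [← hn'] at hw
  set q := p + (Fintype.card ι : ℝ) / 2
  set e := p - (Fintype.card ι : ℝ) / 2
  set I := ∫ τ, ‖bumpHat τ‖ * (1 + |τ|) ^ q
  have hI : 0 ≤ I := integral_nonneg fun τ => by positivity
  refine ⟨C1 * (C2 * I ^ Fintype.card ρ), by positivity, fun g hg R hR => ?_⟩
  have hgf := hg.integrable_fourier' he
  have hmaj : Integrable fun τ : (ρ → ℝ) × ℝ =>
      (∏ k, ‖bumpHat (τ.1 k)‖ * (1 + |τ.1 k|) ^ q) * (‖𝓕 g τ.2‖ * (1 + |τ.2|) ^ e) :=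
    Integrable.mul_prod (f := fun x : ρ → ℝ => ∏ k, ‖bumpHat (x k)‖ * (1 + |x k|) ^ q)
      (Integrable.fintype_prod fun _ => integrable_bumpHat_mul q) hg.integrable_fourier
  have hA : Integrable (ampl (ρ := ρ) g) :=
    Integrable.mul_prod (f := fun x : ρ → ℝ => ∏ k, bumpHat (x k))
      (Integrable.fintype_prod fun _ => integrable_bumpHat) hgf
  have hle : ∀ τ, ‖ampl g τ‖ * weight p (freq 1 γ₁ τ) (freq 2 γ₂ τ) ≤
      C2 * ((∏ k, ‖bumpHat (τ.1 k)‖ * (1 + |τ.1 k|) ^ q) * (‖𝓕 g τ.2‖ * (1 + |τ.2|) ^ e)) := by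
    intro τ
    refine (mul_le_mul_of_nonneg_left (hw τ) (norm_nonneg _)).trans_eq ?_
    rw [ampl, norm_mul, norm_prod, Finset.prod_mul_distrib]
    ring
  have hAW : Integrable fun τ => ‖ampl g τ‖ * weight p (freq 1 γ₁ τ) (freq 2 γ₂ τ) := by
    refine (hmaj.const_mul C2).mono' ?_ (Eventually.of_forall fun τ => ?_)
    · refine hA.aestronglyMeasurable.norm.mul (Measurable.aestronglyMeasurable ?_)
      unfold weight
      fun_prop
    · rw [Real.norm_of_nonneg (mul_nonneg (norm_nonneg _) (weight_nonneg _ _ _))]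
      exact hle τ
  have h := hB _ hA hAW R hR
  simp only [hχ g hg.continuous hg.integrable hgf hg.eq_zero] at h
  refine h.trans ?_
  rw [mul_assoc, mul_assoc]
  refine mul_le_mul_of_nonneg_left ?_ hC1
  refine (integral_mono hAW (hmaj.const_mul C2) hle).trans_eq ?_
  rw [integral_const_mul]
  congr 1
  have := integral_prod_mul (μ := (volume : Measure (ρ → ℝ))) (ν := (volume : Measure ℝ)) 
    (fun x : ρ → ℝ => ∏ k, ‖bumpHat (x k)‖ * (1 + |x k|) ^ q)
    (fun t => ‖𝓕 g t‖ * (1 + |t|) ^ e)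
  rw [integral_fintype_prod_volume_eq_pow (fun x : ℝ => ‖bumpHat x‖ * (1 + |x|) ^ q)] at this
  exact this

end Unfold

section Coord

open scoped Classical
open Module NumberField.InfinitePlace NumberField.mixedEmbedding NumberField.Units
open NumberField.Units.dirichletUnitTheorem NumberField.mixedEmbedding.fundamentalCone

variable (K : Type*) [Field K] [NumberField K]

/-- The weighted sum of the coordinates. -/
noncomputable def sumForm : (InfinitePlace K → ℝ) →ₗ[ℝ] ℝ :=
  ∑ w, (mult w : ℝ) • LinearMap.proj w

variable {K} in
lemma sumForm_apply (y : InfinitePlace K → ℝ) : sumForm K y = ∑ w, (mult w : ℝ) * y w := by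
  simp [sumForm]

/-- The linear map underlying `logMap`. -/
noncomputable def logLin : (InfinitePlace K → ℝ) →ₗ[ℝ] logSpace K :=
  LinearMap.pi fun w => (mult w.1 : ℝ) • (LinearMap.proj w.1 - (finrank ℚ K : ℝ)⁻¹ • sumForm K)

/-- The coordinates of `logLin` in the basis of the unit lattice. -/
noncomputable def coordLin : (InfinitePlace K → ℝ) →ₗ[ℝ] (Fin (rank K) → ℝ) :=
  ((basisUnitLattice K).ofZLatticeBasis ℝ _).equivFun.toLinearMap ∘ₗ logLin K

variable {K}

/-- The vector of logarithms of the absolute values. -/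
noncomputable def logVec (x : mixedSpace K) : InfinitePlace K → ℝ :=
  fun w => Real.log (normAtPlace w x)

lemma sumForm_logVec {x : mixedSpace K} (hx : mixedEmbedding.norm x ≠ 0) :
    sumForm K (logVec x) = Real.log (mixedEmbedding.norm x) := by
  rw [sumForm_apply, mixedEmbedding.norm_apply, Real.log_prod]
  · simp [logVec]
  · intro w _
    exact pow_ne_zero _ (mixedEmbedding.norm_ne_zero_iff.1 hx w)

lemma logLin_logVec {x : mixedSpace K} (hx : mixedEmbedding.norm x ≠ 0) :
    logLin K (logVec x) = logMap x := by
  ext w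
  rw [logMap_apply]
  simp only [logLin, LinearMap.pi_apply, LinearMap.smul_apply, LinearMap.sub_apply,
    LinearMap.proj_apply, sumForm_logVec hx, smul_eq_mul]
  simp only [logVec]
  ring

lemma coordLin_logVec {x : mixedSpace K} (hx : mixedEmbedding.norm x ≠ 0) :
    coordLin K (logVec x) = ((basisUnitLattice K).ofZLatticeBasis ℝ _).equivFun (logMap x) := by
  simp [coordLin, logLin_logVec hx]

lemma norm_ne_zero_iff' {x : mixedSpace K} :
    mixedEmbedding.norm x ≠ 0 ↔ (∀ i, x.1 i ≠ 0) ∧ ∀ j, x.2 j ≠ 0 := by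
  rw [mixedEmbedding.norm_ne_zero_iff]
  constructor
  · intro h
    refine ⟨fun i => ?_, fun j => ?_⟩
    · have := h i.1
      rwa [normAtPlace_apply_of_isReal i.2, norm_ne_zero_iff] at this
    · have := h j.1
      rwa [normAtPlace_apply_of_isComplex j.2, norm_ne_zero_iff] at this
  · intro h w
    rcases isReal_or_isComplex w with hw | hw
    · rw [normAtPlace_apply_of_isReal hw, norm_ne_zero_iff]; exact h.1 _
    · rw [normAtPlace_apply_of_isComplex hw, norm_ne_zero_iff]; exact h.2 _

lemma linear_logVec (φ : (InfinitePlace K → ℝ) →ₗ[ℝ] ℝ) (x : mixedSpace K) :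
    φ (logVec x) = logForm (fun i : {w : InfinitePlace K // IsReal w} => φ (Pi.single i.1 1))
      (fun j : {w : InfinitePlace K // IsComplex w} => φ (Pi.single j.1 1)) x := by
  have h1 : φ (logVec x) = ∑ w, φ (Pi.single w 1) * logVec x w := by
    conv_lhs => rw [pi_eq_sum_univ' (logVec x)]
    rw [map_sum]
    refine Finset.sum_congr rfl fun w _ => ?_
    rw [map_smul, smul_eq_mul, mul_comm]
  have h2 : ∀ f : InfinitePlace K → ℝ, ∑ w, f w = (∑ w : {w : InfinitePlace K // IsReal w}, f w.1) +
      ∑ w : {w : InfinitePlace K // IsComplex w}, f w.1 := by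
    intro f
    rw [← Equiv.sum_comp (Equiv.subtypeEquivRight
      (fun w : InfinitePlace K => (not_isReal_iff_isComplex (w := w)))) (fun w => f w.1)]
    exact (Fintype.sum_subtype_add_sum_subtype _ _).symm
  rw [h1, h2, logForm]
  congr 1
  · refine Finset.sum_congr rfl fun i _ => ?_
    rw [logVec, normAtPlace_apply_of_isReal i.2]
  · refine Finset.sum_congr rfl fun i _ => ?_
    rw [logVec, normAtPlace_apply_of_isComplex i.2]

variable (K) in
/-- Coefficients of the coordinate forms at the real places. -/
noncomputable def realCoeff (k : Fin (rank K)) (i : {w : InfinitePlace K // IsReal w}) : ℝ :=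
  coordLin K (Pi.single i.1 1) k

variable (K) in
/-- Coefficients of the coordinate forms at the complex places. -/
noncomputable def complexCoeff (k : Fin (rank K)) (i : {w : InfinitePlace K // IsComplex w}) : ℝ :=
  coordLin K (Pi.single i.1 1) k

lemma logForm_coeff (k : Fin (rank K)) (x : mixedSpace K) :
    logForm (realCoeff K k) (complexCoeff K k) x = coordLin K (logVec x) k :=
  (linear_logVec (LinearMap.proj k ∘ₗ coordLin K) x).symm

lemma logForm_one_two (x : mixedSpace K) :
    logForm (1 : {w : InfinitePlace K // IsReal w} → ℝ)
      (2 : {w : InfinitePlace K // IsComplex w} → ℝ) x = sumForm K (logVec x) := by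
  rw [linear_logVec (sumForm K) x]
  congr 1
  · ext i
    simp [sumForm_apply, Pi.single_apply, mult_isReal]
  · ext i
    simp [sumForm_apply, Pi.single_apply, mult_isComplex]

lemma injective_coordLin_sumForm :
    Function.Injective ((coordLin K).prod (sumForm K)) := by
  rw [injective_iff_map_eq_zero]
  intro y hy
  obtain ⟨h1, h2⟩ := Prod.ext_iff.1 hy
  have h3 : logLin K y = 0 := by
    have : ((basisUnitLattice K).ofZLatticeBasis ℝ _).equivFun (logLin K y) = 0 := h1
    simpa using this
  have h2' : sumForm K y = 0 := h2
  have h4 : ∀ w, w ≠ w₀ → y w = 0 := by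
    intro w hw
    have := congrFun h3 ⟨w, hw⟩
    simp only [logLin, LinearMap.pi_apply, LinearMap.smul_apply, LinearMap.sub_apply,
      LinearMap.proj_apply, h2', smul_eq_mul, Pi.zero_apply, mul_zero, sub_zero] at this
    exact (mul_eq_zero.1 this).resolve_left (by exact_mod_cast mult_ne_zero)
  ext w
  by_cases hw : w = w₀
  · rw [sumForm_apply, Finset.sum_eq_single w₀ (fun v _ hv => by simp [h4 v hv]) (by simp)] at h2'
    rw [hw]
    exact (mul_eq_zero.1 h2').resolve_left (by exact_mod_cast mult_ne_zero)
  · exact h4 w hw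

lemma exists_log_bound (B : ℝ) : ∃ B' : ℝ, ∀ x : mixedSpace K,
    (∀ i, x.1 i ≠ 0) → (∀ j, x.2 j ≠ 0) →
    (∀ k, |logForm (realCoeff K k) (complexCoeff K k) x| ≤ B) → |logForm 1 2 x| ≤ B →
      (∀ i, |Real.log ‖x.1 i‖| ≤ B') ∧ ∀ j, |Real.log ‖x.2 j‖| ≤ B' := by
  obtain ⟨C, -, hC⟩ := ((coordLin K).prod (sumForm K)).injective_iff_antilipschitz.1
    injective_coordLin_sumForm
  refine ⟨C * B, fun x _ _ h1 h2 => ?_⟩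
  have h3 : ‖logVec x‖ ≤ C * B := by
    have := hC.le_mul_dist (logVec x) 0
    rw [map_zero, dist_zero_right, dist_zero_right] at this
    refine this.trans ?_
    gcongr
    have hB : 0 ≤ B := (abs_nonneg _).trans h2
    change max ‖coordLin K (logVec x)‖ ‖sumForm K (logVec x)‖ ≤ B
    refine max_le ((pi_norm_le_iff_of_nonneg hB).2 fun k => ?_) ?_
    · rw [← logForm_coeff]; exact h1 k
    · rw [← logForm_one_two]; exact h2
  refine ⟨fun i => ?_, fun j => ?_⟩
  · rw [← normAtPlace_apply_of_isReal i.2 x]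
    exact (norm_le_pi_norm (logVec x) i.1).trans h3
  · rw [← normAtPlace_apply_of_isComplex j.2 x]
    exact (norm_le_pi_norm (logVec x) j.1).trans h3

lemma hasSum_prod_bump {ρ : Type*} [Fintype ρ] (c : ρ → ℝ) :
    HasSum (fun k : ρ → ℤ => ∏ i, (bump (c i + k i) : ℂ)) 1 := by
  obtain ⟨N, hN⟩ : ∃ N : ℕ, ∀ i, |c i| + 1 ≤ N := by
    obtain ⟨N, hN⟩ := exists_nat_ge (‖c‖ + 1)
    exact ⟨N, fun i => (add_le_add_left (norm_le_pi_norm c i) 1).trans hN⟩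
  set T : Finset ℤ := (Finset.range (2 * N)).image fun j : ℕ => (j : ℤ) - N with hT
  have h1 : ∀ i, ∑ k ∈ T, (bump (c i + k) : ℂ) = 1 := by
    intro i
    have hi := abs_le.1 (show |c i| ≤ N - 1 by linarith [hN i])
    rw [hT, Finset.sum_image (fun x _ y _ h => by simpa using h)]
    have : ∀ j : ℕ, bump (c i + ((j : ℤ) - N : ℤ)) =
        Real.smoothTransition (c i - N + (j + 1 : ℕ)) - Real.smoothTransition (c i - N + (j : ℕ)) := by
      intro j
      simp only [bump]
      push_cast
      congr 2 <;> ring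
    simp_rw [this]
    rw [← Complex.ofReal_sum, Finset.sum_range_sub
      (fun j : ℕ => Real.smoothTransition (c i - N + (j : ℕ))),
      Real.smoothTransition.one_of_one_le (by push_cast; linarith),
      Real.smoothTransition.zero_of_nonpos (by push_cast; linarith)]
    simp
  have h2 : ∑ k ∈ Fintype.piFinset fun _ : ρ => T, ∏ i, (bump (c i + k i) : ℂ) = 1 := by
    rw [← Finset.prod_univ_sum (fun _ => T) fun i k => (bump (c i + (k : ℤ)) : ℂ)]
    exact Finset.prod_eq_one fun i _ => h1 i
  rw [← h2]
  refine hasSum_sum_of_ne_finset_zero fun k hk => ?_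
  rw [Fintype.mem_piFinset] at hk
  push Not at hk
  obtain ⟨i, hi⟩ := hk
  refine Finset.prod_eq_zero (Finset.mem_univ i) ?_
  rw [bump_eq_zero, Complex.ofReal_zero]
  by_contra hlt
  push Not at hlt
  refine hi ?_
  have h3 := abs_lt.1 hlt
  have h4 := abs_le.1 (show |c i| ≤ N - 1 by linarith [hN i])
  have h5 : -(N : ℤ) < k i := by
    have : (-(N : ℝ)) < k i := by linarith [h3.1, h4.2]
    exact_mod_cast this
  have h6 : k i < N := by
    have : (k i : ℝ) < N := by linarith [h3.2, h4.1]
    exact_mod_cast this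
  rw [hT, Finset.mem_image]
  exact ⟨(k i + N).toNat, by rw [Finset.mem_range]; omega, by omega⟩

end Coord

section IdealSum

open scoped Classical FourierTransform nonZeroDivisors
open Module NumberField.InfinitePlace NumberField.mixedEmbedding NumberField.Units
open NumberField.Units.dirichletUnitTheorem NumberField.mixedEmbedding.fundamentalCone

variable (K : Type*) [Field K] [NumberField K]

/-- The test function on the mixed space of `K` attached to a weight `g`. -/
noncomputable def mainFunK (g : ℝ → ℂ) : mixedSpace K → ℂ :=
  mainFun (realCoeff K) (complexCoeff K) g

variable {K}

lemma mainFunK_of_norm_eq_zero (g : ℝ → ℂ) {x : mixedSpace K} (hx : mixedEmbedding.norm x = 0) :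
    mainFunK K g x = 0 := by
  rw [mainFunK, mainFun, if_neg]
  exact fun h => norm_ne_zero_iff'.2 h hx

lemma mainFunK_of_norm_ne_zero (g : ℝ → ℂ) {x : mixedSpace K} (hx : mixedEmbedding.norm x ≠ 0) :
    mainFunK K g x = (∏ k, (bump (((basisUnitLattice K).ofZLatticeBasis ℝ _).equivFun (logMap x) k)
      : ℂ)) * g (Real.log (mixedEmbedding.norm x)) := by
  rw [mainFunK, mainFun, if_pos (norm_ne_zero_iff'.1 hx)]
  simp_rw [logForm_coeff, coordLin_logVec hx, logForm_one_two, sumForm_logVec hx]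

/-- The unit attached to a torsion unit and a family of exponents. -/
noncomputable def unitOf (p : torsion K × (Fin (rank K) → ℤ)) : (𝓞 K)ˣ :=
  p.1 * ∏ i, fundSystem K i ^ p.2 i

lemma unitOf_bijective : Function.Bijective (unitOf (K := K)) :=
  Function.bijective_iff_existsUnique _ |>.2 fun x => by
    simpa only [unitOf, eq_comm] using exist_unique_eq_mul_prod K x

lemma logEmbedding_unitOf (p : torsion K × (Fin (rank K) → ℤ)) (k : Fin (rank K)) :
    ((basisUnitLattice K).ofZLatticeBasis ℝ _).equivFun
      (logEmbedding K (Additive.ofMul (unitOf p))) k = p.2 k := by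
  have h : logEmbedding K (Additive.ofMul (unitOf p)) =
      ∑ i, (p.2 i : ℝ) • ((basisUnitLattice K).ofZLatticeBasis ℝ _ i) := by
    rw [unitOf, ofMul_mul, map_add, logEmbedding_eq_zero_iff.2 p.1.2, zero_add, ofMul_prod, map_sum]
    refine Finset.sum_congr rfl fun i _ => ?_
    rw [ofMul_zpow, map_zsmul, logEmbedding_fundSystem, Basis.ofZLatticeBasis_apply,
      Int.cast_smul_eq_zsmul]
  rw [h, ← Basis.equivFun_symm_apply, LinearEquiv.apply_symm_apply]

lemma mainFunK_unit (g : ℝ → ℂ) {α : 𝓞 K} (hα : α ≠ 0) {R : ℝ} (hR : 0 < R)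
    (p : torsion K × (Fin (rank K) → ℤ)) :
    mainFunK K g (R⁻¹ • mixedEmbedding K ((unitOf p : 𝓞 K) * α : 𝓞 K)) =
      (∏ k, (bump (((basisUnitLattice K).ofZLatticeBasis ℝ _).equivFun
        (logMap (mixedEmbedding K (α : K))) k + p.2 k) : ℂ)) *
      g (Real.log (Ideal.absNorm (Ideal.span {α})) - finrank ℚ K * Real.log R) := by
  have hn : mixedEmbedding.norm (mixedEmbedding K (α : K)) = Ideal.absNorm (Ideal.span {α}) := by
    rw [norm_eq_norm, Ideal.absNorm_span_singleton, ← Algebra.coe_norm_int, Nat.cast_natAbs]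
    push_cast
    rfl
  have hN0 : Ideal.absNorm (Ideal.span {α}) ≠ 0 := by
    rw [Ne, Ideal.absNorm_eq_zero_iff, Ideal.span_singleton_eq_bot]; exact hα
  have hn0 : mixedEmbedding.norm (mixedEmbedding K (α : K)) ≠ 0 := by
    rw [hn]; exact_mod_cast hN0
  have hu : mixedEmbedding K ((unitOf p : 𝓞 K) * α : 𝓞 K) = unitOf p • mixedEmbedding K (α : K) := by
    rw [unitSMul_smul, ← map_mul]
    simp
  have hn1 : mixedEmbedding.norm (unitOf p • mixedEmbedding K (α : K)) ≠ 0 := by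
    rwa [norm_unit_smul]
  have hx : mixedEmbedding.norm (R⁻¹ • unitOf p • mixedEmbedding K (α : K)) ≠ 0 := by
    rw [mixedEmbedding.norm_smul]
    exact mul_ne_zero (pow_ne_zero _ (abs_ne_zero.2 (inv_ne_zero hR.ne'))) hn1
  rw [hu, mainFunK_of_norm_ne_zero g hx, logMap_real_smul hn1 (inv_ne_zero hR.ne'),
    logMap_unit_smul _ hn0, map_add]
  congr 1
  · refine Finset.prod_congr rfl fun k _ => ?_
    rw [Pi.add_apply, logEmbedding_unitOf, add_comm]
  · rw [mixedEmbedding.norm_smul, norm_unit_smul, hn, abs_of_pos (inv_pos.2 hR),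
      Real.log_mul (by positivity) (by exact_mod_cast hN0), Real.log_pow, Real.log_inv]
    congr 1
    ring

variable (K) in
lemma isWeight_comp_log_finite {e r : ℝ} {g : ℝ → ℂ} (hg : IsWeight e r g) (u : ℝ) :
    (Function.support fun I : (Ideal (𝓞 K))⁰ =>
      g (Real.log (Ideal.absNorm (I : Ideal (𝓞 K))) - u)).Finite := by
  refine (Ideal.finite_setOfPred_absNorm_le₀ (S := 𝓞 K) ⌈Real.exp (r + u)⌉₊).subset fun I hI => ?_
  have h1 : |Real.log (Ideal.absNorm (I : Ideal (𝓞 K))) - u| ≤ r := by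
    by_contra h
    exact hI (hg.eq_zero _ (not_le.1 h))
  have h2 : (Ideal.absNorm (I : Ideal (𝓞 K)) : ℝ) ≤ Real.exp (r + u) := by
    have h0 : (0 : ℝ) < Ideal.absNorm (I : Ideal (𝓞 K)) := by
      exact_mod_cast Ideal.absNorm_pos_of_nonZeroDivisors I
    rw [← Real.log_le_iff_le_exp h0]
    linarith [(abs_le.1 h1).2]
  have h3 : (Ideal.absNorm (I : Ideal (𝓞 K)) : ℝ) ≤ ⌈Real.exp (r + u)⌉₊ :=
    h2.trans (Nat.le_ceil _)
  exact_mod_cast h3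

/-- The parametrisation of `J` by its basis. -/
noncomputable def latticeEquiv (J : (Ideal (𝓞 K))⁰) :
    (Free.ChooseBasisIndex ℤ (FractionalIdeal.mk0 K J : FractionalIdeal (𝓞 K)⁰ K) → ℝ) ≃ₗ[ℝ]
      mixedSpace K :=
  (fractionalIdealLatticeBasis K (FractionalIdeal.mk0 K J)).equivFun.symm

lemma range_latticeEquiv (J : (Ideal (𝓞 K))⁰) :
    Set.range (fun m : Free.ChooseBasisIndex ℤ (FractionalIdeal.mk0 K J :
      FractionalIdeal (𝓞 K)⁰ K) → ℤ => latticeEquiv J fun i => (m i : ℝ)) =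
      (fun α : 𝓞 K => mixedEmbedding K (α : K)) '' (J : Ideal (𝓞 K)) := by
  ext x
  have h := mem_span_fractionalIdealLatticeBasis K (FractionalIdeal.mk0 K J) (x := x)
  have h1 : x ∈ (fun α : 𝓞 K => mixedEmbedding K (α : K)) '' (J : Ideal (𝓞 K)) ↔
      x ∈ mixedEmbedding K '' (FractionalIdeal.mk0 K J : FractionalIdeal (𝓞 K)⁰ K) := by
    simp only [Set.mem_image, SetLike.mem_coe, FractionalIdeal.coe_mk0,
      FractionalIdeal.mem_coeIdeal]
    constructor
    · rintro ⟨α, hα, rfl⟩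
      exact ⟨α, ⟨α, hα, rfl⟩, rfl⟩
    · rintro ⟨_, ⟨α, hα, rfl⟩, rfl⟩
      exact ⟨α, hα, rfl⟩
  rw [h1, ← h, Submodule.mem_span_range_iff_exists_fun]
  simp only [Set.mem_range, latticeEquiv, Basis.equivFun_symm_apply, Int.cast_smul_eq_zsmul]

lemma latticeEquiv_injective (J : (Ideal (𝓞 K))⁰) :
    Function.Injective (fun m : Free.ChooseBasisIndex ℤ (FractionalIdeal.mk0 K J :
      FractionalIdeal (𝓞 K)⁰ K) → ℤ => latticeEquiv J fun i => (m i : ℝ)) := by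
  intro m m' h
  have := (latticeEquiv J).injective h
  ext i
  exact_mod_cast congrFun this i

lemma card_chooseBasisIndex (J : (Ideal (𝓞 K))⁰) :
    Fintype.card (Free.ChooseBasisIndex ℤ (FractionalIdeal.mk0 K J :
      FractionalIdeal (𝓞 K)⁰ K)) = finrank ℚ K := by
  rw [← finrank_eq_card_basis (fractionalIdealLatticeBasis K (FractionalIdeal.mk0 K J)),
    mixedEmbedding.finrank]

/-- The ideals whose class is the inverse of the class of `J`. -/
abbrev InvClass (J : (Ideal (𝓞 K))⁰) : Type _ :=
  {I : (Ideal (𝓞 K))⁰ // ClassGroup.mk0 I = (ClassGroup.mk0 J)⁻¹}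

lemma exists_generators (J : (Ideal (𝓞 K))⁰) : ∃ A : InvClass J → 𝓞 K, (∀ I, A I ≠ 0) ∧
    (∀ I, A I ∈ (J : Ideal (𝓞 K))) ∧ (∀ I, Ideal.span {A I} = (I.1 : Ideal (𝓞 K)) * J) ∧
    Function.Injective (fun q : InvClass J × (𝓞 K)ˣ => (q.2 : 𝓞 K) * A q.1) ∧
    ∀ α ∈ (J : Ideal (𝓞 K)), α ≠ 0 → ∃ q : InvClass J × (𝓞 K)ˣ, (q.2 : 𝓞 K) * A q.1 = α := by
  have hgen : ∀ I : InvClass J, ∃ α : 𝓞 K, Ideal.span {α} = (I.1 : Ideal (𝓞 K)) * J := by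
    intro I
    have h1 : ClassGroup.mk0 (I.1 * J) = 1 := by rw [map_mul, I.2, inv_mul_cancel]
    have h2 := (ClassGroup.mk0_eq_one_iff (I.1 * J).2).1 h1
    exact ⟨_, @Ideal.span_singleton_generator _ _ _ h2⟩
  choose A hA using hgen
  have hA0 : ∀ I, A I ≠ 0 := by
    intro I h0
    have := hA I
    rw [h0, Ideal.span_singleton_eq_bot.2 rfl] at this
    exact nonZeroDivisors.coe_ne_zero (I.1 * J) this.symm
  have hspan : ∀ (u : (𝓞 K)ˣ) (α : 𝓞 K), Ideal.span {(u : 𝓞 K) * α} = Ideal.span {α} := by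
    intro u α
    rw [Ideal.span_singleton_eq_span_singleton]
    exact associated_unit_mul_left α u u.isUnit
  refine ⟨A, hA0, fun I => ?_, hA, ?_, ?_⟩
  · have : A I ∈ (I.1 : Ideal (𝓞 K)) * J := by
      rw [← hA]; exact Ideal.mem_span_singleton_self _
    exact (Ideal.mul_le_right : (I.1 : Ideal (𝓞 K)) * (J : Ideal (𝓞 K)) ≤ J) this
  · rintro ⟨I, p⟩ ⟨I', p'⟩ h
    have h1 : (p : 𝓞 K) * A I = p' * A I' := h
    have h2 : (I.1 : Ideal (𝓞 K)) * J = I'.1 * J := by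
      rw [← hA, ← hA, ← hspan p, h1, hspan]
    have hJ0 : (J : Ideal (𝓞 K)) ≠ 0 := nonZeroDivisors.coe_ne_zero J
    have h3 : (I.1 : Ideal (𝓞 K)) = I'.1 := (mul_left_inj' hJ0).1 h2
    have h3 : I = I' := Subtype.ext (Subtype.ext h3)
    subst h3
    have h4 := mul_right_cancel₀ (hA0 I) h1
    rw [Units.ext h4]
  · intro α hα hα0
    obtain ⟨I, hI⟩ : (J : Ideal (𝓞 K)) ∣ Ideal.span {α} :=
      Ideal.dvd_span_singleton.2 hα
    have hI0 : I ≠ 0 := by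
      rintro rfl
      rw [mul_zero, Ideal.zero_eq_bot, Ideal.span_singleton_eq_bot] at hI
      exact hα0 hI
    let I₀ : (Ideal (𝓞 K))⁰ := ⟨I, mem_nonZeroDivisors_of_ne_zero hI0⟩
    have hcl : ClassGroup.mk0 I₀ = (ClassGroup.mk0 J)⁻¹ := by
      rw [eq_inv_iff_mul_eq_one, ← map_mul]
      refine (ClassGroup.mk0_eq_one_iff (I₀ * J).2).2 ⟨α, ?_⟩
      rw [Submonoid.coe_mul, mul_comm, ← hI]
    let I₁ : InvClass J := ⟨I₀, hcl⟩
    have h5 : Associated (A I₁) α := by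
      rw [← Ideal.span_singleton_eq_span_singleton, hA, hI, mul_comm]
    obtain ⟨u, hu⟩ := h5
    exact ⟨(I₁, u), by rw [mul_comm]; exact hu⟩

/-- The index type of the coordinates on `J`. -/
abbrev IdealIndex (J : (Ideal (𝓞 K))⁰) : Type _ :=
  Free.ChooseBasisIndex ℤ (FractionalIdeal.mk0 K J : FractionalIdeal (𝓞 K)⁰ K)

lemma hasCompactSupport_mainFunK {e r : ℝ} (he : 0 ≤ e) {g : ℝ → ℂ} (hg : IsWeight e r g) :
    HasCompactSupport (mainFunK K g) := by
  obtain ⟨χ₁, χ₂, h₁, h₂, hs⟩ := superpose_ampl_eq (exists_log_bound (K := K)) r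
  have := hasCompactSupport_superpose (μ := volume) (s₁ := freq 1 (realCoeff K))
    (s₂ := freq 2 (complexCoeff K)) (A := ampl g) h₁ h₂
  rwa [funext (hs g hg.continuous hg.integrable (hg.integrable_fourier' he) hg.eq_zero)] at this

lemma summable_lattice {e r : ℝ} (he : 0 ≤ e) {g : ℝ → ℂ} (hg : IsWeight e r g)
    (J : (Ideal (𝓞 K))⁰) {R : ℝ} (hR : 0 < R) :
    Summable fun m : IdealIndex J → ℤ => mainFunK K g (R⁻¹ • latticeEquiv J fun i => (m i : ℝ)) := by
  let ee : (IdealIndex J → ℝ) ≃ₜ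
      mixedSpace K := (latticeEquiv J).toContinuousLinearEquiv.toHomeomorph.trans
        (Homeomorph.smulOfNeZero R⁻¹ (by positivity))
  obtain ⟨T, hT⟩ := exists_finset_support
    ((hasCompactSupport_mainFunK he hg).comp_homeomorph ee) 0
  refine summable_of_ne_finset_zero (s := T) fun m hm => ?_
  have := hT 0 (by simp) m hm
  rwa [zero_add] at this

/-- Unfolding of the lattice sum over `J` as a sum over the ideals in the class of `J⁻¹`. -/
lemma tsum_lattice_eq {e r : ℝ} (he : 0 ≤ e) {g : ℝ → ℂ} (hg : IsWeight e r g)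
    (J : (Ideal (𝓞 K))⁰) {R : ℝ} (hR : 0 < R) :
    ∑' m : IdealIndex J → ℤ, mainFunK K g (R⁻¹ • latticeEquiv J fun i => (m i : ℝ)) =
    torsionOrder K * ∑' I : InvClass J,
      g (Real.log (Ideal.absNorm (I.1 : Ideal (𝓞 K))) +
        Real.log (Ideal.absNorm (J : Ideal (𝓞 K))) - finrank ℚ K * Real.log R) := by
  obtain ⟨A, hA0, hAJ, hA, hAinj, hAsurj⟩ := exists_generators J
  let Φ : InvClass J × (torsion K × (Fin (rank K) → ℤ)) → mixedSpace K :=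
    fun q => mixedEmbedding K ((unitOf q.2 : 𝓞 K) * A q.1 : 𝓞 K)
  have hinj : Function.Injective (fun α : 𝓞 K => mixedEmbedding K (α : K)) :=
    (mixedEmbedding_injective K).comp RingOfIntegers.coe_injective
  have hΦ : Function.Injective Φ := by
    rintro ⟨I, p⟩ ⟨I', p'⟩ h
    have h1 := Prod.ext_iff.1 (@hAinj (I, unitOf p) (I', unitOf p') (hinj h))
    exact Prod.ext h1.1 (unitOf_bijective.1 h1.2)
  have hrange : ∀ x, x ∈ (fun α : 𝓞 K => mixedEmbedding K (α : K)) '' (J : Ideal (𝓞 K)) →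
      x ≠ 0 → x ∈ Set.range Φ := by
    rintro _ ⟨α, hα, rfl⟩ h0
    have hα0 : α ≠ 0 := by rintro rfl; simp at h0
    obtain ⟨⟨I, u⟩, hu⟩ := hAsurj α hα hα0
    obtain ⟨p, rfl⟩ := unitOf_bijective.2 u
    exact ⟨(I, p), congrArg (fun α : 𝓞 K => mixedEmbedding K (α : K)) hu⟩
  have hmem : ∀ q, Φ q ∈ (fun α : 𝓞 K => mixedEmbedding K (α : K)) '' (J : Ideal (𝓞 K)) :=
    fun q => ⟨(unitOf q.2 : 𝓞 K) * A q.1, Ideal.mul_mem_left _ _ (hAJ _), rfl⟩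
  let f : mixedSpace K → ℂ := Set.indicator
    ((fun α : 𝓞 K => mixedEmbedding K (α : K)) '' (J : Ideal (𝓞 K)))
    (fun x => mainFunK K g (R⁻¹ • x))
  have hf1 : ∀ m : IdealIndex J → ℤ, mainFunK K g (R⁻¹ • latticeEquiv J fun i => (m i : ℝ)) =
        f (latticeEquiv J fun i => (m i : ℝ)) := by
    intro m
    have : latticeEquiv J (fun i => (m i : ℝ)) ∈
        (fun α : 𝓞 K => mixedEmbedding K (α : K)) '' (J : Ideal (𝓞 K)) := by
      rw [← range_latticeEquiv]; exact ⟨m, rfl⟩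
    simp only [f, Set.indicator_of_mem this]
  have hsupp1 : Function.support f ⊆ Set.range
      (fun m : IdealIndex J → ℤ => latticeEquiv J fun i => (m i : ℝ)) := by
    rw [range_latticeEquiv]
    exact Set.support_indicator_subset
  have hsupp2 : Function.support f ⊆ Set.range Φ := by
    intro x hx
    refine hrange x (Set.support_indicator_subset hx) ?_
    rintro rfl
    refine hx ?_
    simp only [f, Set.indicator_apply, smul_zero]
    rw [mainFunK_of_norm_eq_zero _ (map_zero _), ite_self]
  have hsum : Summable fun m : IdealIndex J → ℤ => mainFunK K g (R⁻¹ • latticeEquiv J fun i => (m i : ℝ)) :=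
    summable_lattice he hg J hR
  have hsumf : Summable f := by
    rw [← (latticeEquiv_injective J).summable_iff fun x hx => by
      by_contra h; exact hx (hsupp1 h)]
    exact hsum.congr fun m => hf1 m
  have hsumΦ : Summable (f ∘ Φ) := by
    rw [hΦ.summable_iff fun x hx => by by_contra h; exact hx (hsupp2 h)]
    exact hsumf
  simp_rw [hf1]
  rw [(latticeEquiv_injective J).tsum_eq hsupp1, ← hΦ.tsum_eq hsupp2]
  refine (Summable.tsum_prod hsumΦ).trans ?_
  rw [← tsum_mul_left]
  refine tsum_congr fun I => ?_
  have hfib : ∀ p, f (Φ (I, p)) = (∏ k, (bump (((basisUnitLattice K).ofZLatticeBasis ℝ _).equivFun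
        (logMap (mixedEmbedding K (A I : K))) k + p.2 k) : ℂ)) *
      g (Real.log (Ideal.absNorm (I.1 : Ideal (𝓞 K))) +
        Real.log (Ideal.absNorm (J : Ideal (𝓞 K))) - finrank ℚ K * Real.log R) := by
    intro p
    simp only [f, Set.indicator_of_mem (hmem (I, p))]
    simp only [Φ]
    rw [mainFunK_unit g (hA0 I) hR, hA, map_mul, Nat.cast_mul, Real.log_mul]
    · exact_mod_cast (Ideal.absNorm_pos_of_nonZeroDivisors I.1).ne'
    · exact_mod_cast (Ideal.absNorm_pos_of_nonZeroDivisors J).ne'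
  have hfs := hsumΦ.comp_injective (Prod.mk_right_injective I)
  have hfs' : Summable fun p => f (Φ (I, p)) := hfs
  refine (Summable.tsum_prod hfs').trans ?_
  have : Fintype (torsion K) := Fintype.ofFinite _
  rw [tsum_fintype]
  simp_rw [hfib, tsum_mul_right, (hasSum_prod_bump _).tsum_eq, one_mul]
  rw [Finset.sum_const, nsmul_eq_mul, Finset.card_univ, torsionOrder, Nat.card_eq_fintype_card]

end IdealSum

section IdealSumBound

open scoped Classical FourierTransform nonZeroDivisors
open Module NumberField.InfinitePlace NumberField.mixedEmbedding NumberField.Units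
open NumberField.Units.dirichletUnitTheorem NumberField.mixedEmbedding.fundamentalCone

variable {K : Type*} [Field K] [NumberField K]

lemma exists_norm_tsum_invClass_sub_le (J : (Ideal (𝓞 K))⁰) {e : ℝ}
    (he : (finrank ℚ K : ℝ) / 2 < e) (r : ℝ) :
    ∃ C, 0 ≤ C ∧ ∀ g : ℝ → ℂ, IsWeight e r g → ∃ c : ℂ, ∀ u : ℝ, 0 ≤ u →
      ‖∑' I : InvClass J, g (Real.log (Ideal.absNorm (I.1 : Ideal (𝓞 K))) - u) -
        c * (Real.exp u : ℂ)‖ ≤ C * fourierNorm e g := by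
  have hcard := card_chooseBasisIndex J
  have hn0 : (0 : ℝ) < finrank ℚ K := by exact_mod_cast finrank_pos
  obtain ⟨C, hC0, hC⟩ := exists_norm_tsum_mainFun_sub_le (exists_log_bound (K := K))
    (ι := IdealIndex J)
    (by rw [hcard, ← card_add_two_mul_card_eq_rank K]) (latticeEquiv J) r
    (p := e + (finrank ℚ K : ℝ) / 2) (by rw [hcard]; linarith)
  rw [hcard, add_sub_cancel_right] at hC
  set w : ℝ := ((torsionOrder K : ℕ) : ℝ) with hw
  have hw0 : 0 < w := by rw [hw]; exact_mod_cast torsionOrder_pos K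
  set N : ℝ := ((Ideal.absNorm (J : Ideal (𝓞 K)) : ℕ) : ℝ) with hN
  have hN1 : 1 ≤ N := by
    rw [hN]; exact_mod_cast Ideal.absNorm_pos_of_nonZeroDivisors J
  refine ⟨w⁻¹ * C, by positivity, fun g hg =>
    ⟨(w : ℂ)⁻¹ * (N * ∫ c, mainFunK K g (latticeEquiv J c)), fun u hu => ?_⟩⟩
  have hlN := Real.log_nonneg hN1
  have h := hC g hg (Real.exp ((u + Real.log N) / finrank ℚ K))
    (Real.one_le_exp (by positivity))
  have h1 := tsum_lattice_eq (by linarith) hg J (Real.exp_pos ((u + Real.log N) / finrank ℚ K))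
  rw [mainFunK, ← hN] at h1
  rw [h1, Real.log_exp] at h
  have h2 : ∀ I : InvClass J, Real.log (Ideal.absNorm (I.1 : Ideal (𝓞 K))) + Real.log N -
      finrank ℚ K * ((u + Real.log N) / finrank ℚ K) =
      Real.log (Ideal.absNorm (I.1 : Ideal (𝓞 K))) - u := by
    intro I
    rw [mul_div_cancel₀ _ hn0.ne']
    ring
  have h3 : ((Real.exp ((u + Real.log N) / finrank ℚ K) : ℝ) : ℂ) ^ finrank ℚ K =
      (Real.exp u : ℂ) * N := by
    rw [← Complex.ofReal_pow, ← Real.exp_nat_mul, mul_div_cancel₀ _ hn0.ne', Real.exp_add,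
      Real.exp_log (by linarith), Complex.ofReal_mul]
  simp_rw [h2] at h
  rw [h3] at h
  have hwC : (w : ℂ) ≠ 0 := by exact_mod_cast hw0.ne'
  have h4 : ∑' I : InvClass J, g (Real.log (Ideal.absNorm (I.1 : Ideal (𝓞 K))) - u) -
        (w : ℂ)⁻¹ * (N * ∫ c, mainFunK K g (latticeEquiv J c)) * (Real.exp u : ℂ) =
      (w : ℂ)⁻¹ * (torsionOrder K * ∑' I : InvClass J,
        g (Real.log (Ideal.absNorm (I.1 : Ideal (𝓞 K))) - u) - (Real.exp u : ℂ) * N *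
        ∫ c, mainFun (realCoeff K) (complexCoeff K) g (latticeEquiv J c)) := by
    have : (torsionOrder K : ℂ) = (w : ℂ) := by simp [hw]
    rw [this, mul_sub, inv_mul_cancel_left₀ hwC, mainFunK]
    ring
  rw [h4, norm_mul, norm_inv, Complex.norm_real, Real.norm_of_nonneg hw0.le, mul_assoc w⁻¹ C]
  exact mul_le_mul_of_nonneg_left h (inv_nonneg.2 hw0.le)

/-- The sum of a weight over the ideals of `K`. -/
theorem exists_norm_tsum_ideal_sub_le {e : ℝ} (he : (finrank ℚ K : ℝ) / 2 < e) (r : ℝ) :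
    ∃ C, 0 ≤ C ∧ ∀ g : ℝ → ℂ, IsWeight e r g → ∃ c : ℂ, ∀ u : ℝ, 0 ≤ u →
      ‖∑' I : (Ideal (𝓞 K))⁰, g (Real.log (Ideal.absNorm (I : Ideal (𝓞 K))) - u) -
        c * (Real.exp u : ℂ)‖ ≤ C * fourierNorm e g := by
  have hJ : ∀ c : ClassGroup (𝓞 K), ∃ J : (Ideal (𝓞 K))⁰, (ClassGroup.mk0 J)⁻¹ = c := fun c => by
    obtain ⟨J, hJ⟩ := ClassGroup.mk0_surjective c⁻¹
    exact ⟨J, by rw [hJ, inv_inv]⟩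
  choose J hJ using hJ
  choose C hC0 hC using fun c => exists_norm_tsum_invClass_sub_le (J c) he r
  refine ⟨∑ c, C c, Finset.sum_nonneg fun c _ => hC0 c, fun g hg => ?_⟩
  choose a ha using fun c => hC c g hg
  refine ⟨∑ c, a c, fun u hu => ?_⟩
  have hs : Summable fun I : (Ideal (𝓞 K))⁰ =>
      g (Real.log (Ideal.absNorm (I : Ideal (𝓞 K))) - u) :=
    summable_of_hasFiniteSupport (isWeight_comp_log_finite K hg u)
  have h1 : ∑' I : (Ideal (𝓞 K))⁰, g (Real.log (Ideal.absNorm (I : Ideal (𝓞 K))) - u) =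
      ∑ c, ∑' I : InvClass (J c), g (Real.log (Ideal.absNorm (I.1 : Ideal (𝓞 K))) - u) := by
    let E : (Σ c : ClassGroup (𝓞 K), InvClass (J c)) ≃ (Ideal (𝓞 K))⁰ :=
      (Equiv.sigmaCongrRight fun c => Equiv.subtypeEquivRight fun I => by rw [hJ]).trans
        (Equiv.sigmaFiberEquiv fun I : (Ideal (𝓞 K))⁰ => ClassGroup.mk0 I)
    have hs' := (Equiv.summable_iff E).2 hs
    rw [← Equiv.tsum_eq E]
    refine (Summable.tsum_sigma hs').trans ?_
    rw [tsum_fintype]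
    rfl
  rw [h1, Finset.sum_mul, ← Finset.sum_sub_distrib, Finset.sum_mul]
  exact (norm_sum_le _ _).trans (Finset.sum_le_sum fun c _ => ha c u hu)

end IdealSumBound

section Mollifier

open scoped FourierTransform ContDiff

lemma exists_laplace_bound (j : ℕ) : ∀ f : ℝ → ℂ, ContDiff ℝ ∞ f → HasCompactSupport f →
    ∃ C, 0 ≤ C ∧ ∀ a : ℂ, |a.re| ≤ 1 → ‖∫ z : ℝ, f z * Complex.exp (a * z)‖ * ‖a‖ ^ j ≤ C := by
  induction j with
  | zero =>
    intro f hf hs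
    refine ⟨∫ z : ℝ, ‖f z‖ * Real.exp |z|, integral_nonneg fun z => by positivity, fun a ha => ?_⟩
    rw [pow_zero, mul_one]
    refine (norm_integral_le_integral_norm _).trans (integral_mono ?_ ?_ fun z => ?_)
    · refine Continuous.integrable_of_hasCompactSupport ?_ ?_
      · have := hf.continuous
        fun_prop
      · exact HasCompactSupport.norm (HasCompactSupport.mul_right hs)
    · refine Continuous.integrable_of_hasCompactSupport ?_ ?_
      · have := hf.continuous
        fun_prop
      · exact HasCompactSupport.mul_right hs.norm
    · simp only [norm_mul, Complex.norm_exp, Complex.mul_re, Complex.ofReal_re, Complex.ofReal_im,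
        mul_zero, sub_zero]
      gcongr
      calc a.re * z ≤ |a.re * z| := le_abs_self _
        _ = |a.re| * |z| := abs_mul _ _
        _ ≤ 1 * |z| := by gcongr
        _ = |z| := one_mul _
  | succ j ih =>
    intro f hf hs
    have hf' : ContDiff ℝ ∞ (deriv f) := (contDiff_infty_iff_deriv.1 hf).2
    obtain ⟨C, hC0, hC⟩ := ih (deriv f) hf' hs.deriv
    refine ⟨C, hC0, fun a ha => ?_⟩
    have hexp : ∀ x : ℝ, HasDerivAt (fun z : ℝ => Complex.exp (a * z))
        (Complex.exp (a * x) * a) x := fun x => by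
      have h := (Complex.ofRealCLM.hasDerivAt (x := x)).const_mul a
      simpa using h.cexp
    have hce : Continuous fun z : ℝ => Complex.exp (a * z) := by fun_prop
    have hIBP := integral_mul_deriv_eq_deriv_mul_of_integrable (u := f) (u' := deriv f)
      (v := fun z : ℝ => Complex.exp (a * z)) (v' := fun z => Complex.exp (a * z) * a)
      (fun x _ => ((hf.differentiable (by simp)) x).hasDerivAt) (fun x _ => hexp x)
      ((hf.continuous.mul (hce.mul continuous_const)).integrable_of_hasCompactSupport
        hs.mul_right)
      ((hf'.continuous.mul hce).integrable_of_hasCompactSupport hs.deriv.mul_right)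
      ((hf.continuous.mul hce).integrable_of_hasCompactSupport hs.mul_right)
    have h1 : (∫ z : ℝ, f z * Complex.exp (a * z)) * a =
        -∫ z : ℝ, deriv f z * Complex.exp (a * z) := by
      rw [← hIBP, ← integral_mul_const]
      simp_rw [mul_assoc]
    calc ‖∫ z : ℝ, f z * Complex.exp (a * z)‖ * ‖a‖ ^ (j + 1)
        = ‖(∫ z : ℝ, f z * Complex.exp (a * z)) * a‖ * ‖a‖ ^ j := by
          rw [norm_mul, pow_succ]; ring
      _ ≤ C := by rw [h1, norm_neg]; exact hC a ha

/-- A smooth even probability density supported in `[-1, 1]`. -/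
noncomputable def mol : ℝ → ℝ :=
  ContDiffBump.normed (⟨1 / 2, 1, by norm_num, by norm_num⟩ : ContDiffBump (0 : ℝ)) volume

lemma mol_nonneg (z : ℝ) : 0 ≤ mol z := ContDiffBump.nonneg_normed _ _

lemma mol_neg (z : ℝ) : mol (-z) = mol z := ContDiffBump.normed_neg _ _

lemma integral_mol : ∫ z, mol z = 1 := ContDiffBump.integral_normed _

lemma contDiff_mol : ContDiff ℝ ∞ mol := ContDiffBump.contDiff_normed (n := ⊤) _

lemma mol_eq_zero {z : ℝ} (hz : 1 ≤ |z|) : mol z = 0 := by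
  by_contra h
  have : z ∈ Function.support mol := h
  rw [mol, ContDiffBump.support_normed_eq] at this
  simp at this
  linarith

lemma hasCompactSupport_mol : HasCompactSupport mol := ContDiffBump.hasCompactSupport_normed _

/-- The density `mol` at scale `δ`. -/
noncomputable def molS (δ y : ℝ) : ℝ := δ⁻¹ * mol (y / δ)

lemma molS_nonneg {δ : ℝ} (hδ : 0 < δ) (y : ℝ) : 0 ≤ molS δ y :=
  mul_nonneg (inv_nonneg.2 hδ.le) (mol_nonneg _)

lemma molS_neg (δ y : ℝ) : molS δ (-y) = molS δ y := by
  rw [molS, neg_div, mol_neg, molS]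

lemma contDiff_molS (δ : ℝ) : ContDiff ℝ ∞ (molS δ) :=
  contDiff_const.mul (contDiff_mol.comp (contDiff_id.div_const δ))

lemma molS_eq_zero {δ y : ℝ} (hδ : 0 < δ) (hy : δ ≤ |y|) : molS δ y = 0 := by
  rw [molS, mol_eq_zero, mul_zero]
  rwa [abs_div, abs_of_pos hδ, one_le_div hδ]

lemma integral_molS_mul {δ : ℝ} (hδ : 0 < δ) (F : ℝ → ℂ) :
    ∫ y, (molS δ y : ℂ) * F y = ∫ z, (mol z : ℂ) * F (δ * z) := by
  have h := Measure.integral_comp_mul_left (fun y => (molS δ y : ℂ) * F y) δ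
  rw [abs_of_pos (inv_pos.2 hδ)] at h
  have h2 : (∫ y, (molS δ y : ℂ) * F y) =
      δ • ∫ z, (molS δ (δ * z) : ℂ) * F (δ * z) := by
    rw [h, smul_smul, mul_inv_cancel₀ hδ.ne', one_smul]
  rw [h2, ← integral_smul]
  refine integral_congr_ae (Eventually.of_forall fun z => ?_)
  have hδ' : (δ : ℂ) ≠ 0 := by exact_mod_cast hδ.ne'
  simp only [molS, mul_div_cancel_left₀ _ hδ.ne', Complex.real_smul, Complex.ofReal_mul,
    Complex.ofReal_inv, mul_assoc, mul_inv_cancel_left₀ hδ']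

lemma integral_molS {δ : ℝ} (hδ : 0 < δ) : ∫ y, molS δ y = 1 := by
  have h := integral_molS_mul hδ (fun _ => 1)
  simp only [mul_one] at h
  rw [integral_complex_ofReal, integral_complex_ofReal, integral_mol] at h
  exact_mod_cast h

/-- Decay of the Fourier transform of `molS δ y * exp y`, uniformly in `δ`. -/
lemma exists_fourier_molS_exp_bound (j : ℕ) : ∃ C, 0 ≤ C ∧ ∀ δ : ℝ, 0 < δ → δ ≤ 1 → ∀ t : ℝ,
    ‖𝓕 (fun y : ℝ => ((molS δ y * Real.exp y : ℝ) : ℂ)) t‖ * (1 + δ * |t|) ^ j ≤ C := by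
  have hm : ContDiff ℝ ∞ fun z => (mol z : ℂ) := Complex.ofRealCLM.contDiff.comp contDiff_mol
  have hs : HasCompactSupport fun z => (mol z : ℂ) :=
    hasCompactSupport_mol.comp_left Complex.ofReal_zero
  obtain ⟨C₀, hC₀, h0⟩ := exists_laplace_bound 0 _ hm hs
  obtain ⟨C₁, hC₁, h1⟩ := exists_laplace_bound j _ hm hs
  refine ⟨2 ^ j * (C₀ + C₁), by positivity, fun δ hδ hδ1 t => ?_⟩
  set a : ℂ := δ * (1 - 2 * Real.pi * Complex.I * t) with ha
  have hre : a.re = δ := by simp [ha]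
  have hre1 : |a.re| ≤ 1 := by rw [hre, abs_of_pos hδ]; exact hδ1
  have him : a.im = -(δ * (2 * Real.pi * t)) := by simp [ha]
  have hna : δ * |t| ≤ ‖a‖ := by
    refine le_trans ?_ (Complex.abs_im_le_norm a)
    rw [him, abs_neg, abs_mul, abs_mul, abs_of_pos hδ, abs_of_pos Real.two_pi_pos]
    have : 1 ≤ 2 * Real.pi := by linarith [Real.pi_gt_three]
    gcongr
    exact le_mul_of_one_le_left (abs_nonneg t) this
  have hF : 𝓕 (fun y : ℝ => ((molS δ y * Real.exp y : ℝ) : ℂ)) t =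
      ∫ z : ℝ, (mol z : ℂ) * Complex.exp (a * z) := by
    rw [Real.fourier_real_eq_integral_exp_smul]
    refine (integral_congr_ae (Eventually.of_forall fun y => ?_)).trans
      ((integral_molS_mul hδ fun y => Complex.exp ((1 - 2 * Real.pi * Complex.I * t) * y)).trans
        (integral_congr_ae (Eventually.of_forall fun z : ℝ => ?_)))
    · simp only [smul_eq_mul, Complex.ofReal_mul, Complex.ofReal_exp]
      rw [mul_left_comm, ← Complex.exp_add]
      congr 2
      push_cast
      ring
    · simp only [ha]
      congr 2
      push_cast
      ring
  rw [hF]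
  have h0' := h0 a hre1
  have h1' := h1 a hre1
  rw [pow_zero, mul_one] at h0'
  set X := ‖∫ z : ℝ, (mol z : ℂ) * Complex.exp (a * z)‖ with hX
  have hX0 : 0 ≤ X := norm_nonneg _
  have hy : 0 ≤ δ * |t| := by positivity
  have h2 : (1 + δ * |t|) ^ j ≤ 2 ^ j * (1 + ‖a‖ ^ j) := by
    have : 1 + δ * |t| ≤ 2 * max 1 ‖a‖ := by
      linarith [le_max_left 1 ‖a‖, le_max_right 1 ‖a‖]
    calc (1 + δ * |t|) ^ j ≤ (2 * max 1 ‖a‖) ^ j := by gcongr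
      _ = 2 ^ j * (max 1 ‖a‖) ^ j := mul_pow _ _ _
      _ ≤ _ := by
        gcongr
        rcases max_choice 1 ‖a‖ with h | h <;> rw [h]
        · rw [one_pow]; linarith [pow_nonneg (norm_nonneg a) j]
        · linarith
  calc X * (1 + δ * |t|) ^ j ≤ X * (2 ^ j * (1 + ‖a‖ ^ j)) := by gcongr
    _ = 2 ^ j * (X + X * ‖a‖ ^ j) := by ring
    _ ≤ _ := by gcongr

end Mollifier

section Kernel

open scoped FourierTransform ContDiff

/-- The mollification of `v ↦ max (1 - exp v) 0` at scale `δ`. -/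
noncomputable def ker (δ v : ℝ) : ℝ := ∫ y, molS δ y * max (Real.exp y - Real.exp v) 0

lemma continuous_molS (δ : ℝ) : Continuous (molS δ) := (contDiff_molS δ).continuous

lemma hasCompactSupport_molS {δ : ℝ} (hδ : 0 < δ) : HasCompactSupport (molS δ) :=
  HasCompactSupport.of_support_subset_isCompact (isCompact_Icc (a := -δ) (b := δ)) fun y hy => by
    by_contra h
    refine hy (molS_eq_zero hδ ?_)
    by_contra! h'
    exact h ⟨(abs_lt.1 h').1.le, (abs_lt.1 h').2.le⟩

lemma integrable_molS_mul {δ : ℝ} (hδ : 0 < δ) {F : ℝ → ℝ} (hF : Continuous F) :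
    Integrable fun y => molS δ y * F y :=
  ((continuous_molS δ).mul hF).integrable_of_hasCompactSupport
    (hasCompactSupport_molS hδ).mul_right

lemma ker_nonneg {δ : ℝ} (hδ : 0 < δ) (v : ℝ) : 0 ≤ ker δ v :=
  integral_nonneg fun y => mul_nonneg (molS_nonneg hδ y) (le_max_right _ _)

lemma ker_le {δ : ℝ} (hδ : 0 < δ) (hδ1 : δ ≤ 1) (v : ℝ) : ker δ v ≤ 3 := by
  have h : ker δ v ≤ ∫ y, molS δ y * 3 := by
    refine integral_mono (integrable_molS_mul hδ (by fun_prop)) (integrable_molS_mul hδ (by fun_prop))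
      fun y => ?_
    by_cases hy : δ ≤ |y|
    · simp [molS_eq_zero hδ hy]
    · refine mul_le_mul_of_nonneg_left (max_le ?_ (by norm_num)) (molS_nonneg hδ y)
      have h1 : y ≤ 1 := by linarith [le_abs_self y]
      have h2 := Real.exp_le_exp.2 h1
      linarith [Real.exp_pos v, Real.exp_one_lt_d9]
  rwa [integral_mul_const, integral_molS hδ, one_mul] at h

lemma ker_eq_zero {δ v : ℝ} (hδ : 0 < δ) (hδ1 : δ ≤ 1) (hv : 1 ≤ v) : ker δ v = 0 := by
  refine integral_eq_zero_of_ae (Eventually.of_forall fun y => ?_)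
  by_cases hy : δ ≤ |y|
  · simp [molS_eq_zero hδ hy]
  · have := Real.exp_le_exp.2 (show y ≤ v by linarith [le_abs_self y])
    simp only [Pi.zero_apply]
    rw [max_eq_right (by linarith), mul_zero]

lemma ker_eq_interval {δ : ℝ} (hδ : 0 < δ) (hδ1 : δ ≤ 1) (v : ℝ) :
    ker δ v = (∫ y in v..1, molS δ y * Real.exp y) - Real.exp v * ∫ y in v..1, molS δ y := by
  have hc := continuous_molS δ
  have h1 : (∫ y in v..1, molS δ y * Real.exp y) - Real.exp v * ∫ y in v..1, molS δ y =
      ∫ y in v..1, molS δ y * (Real.exp y - Real.exp v) := by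
    rw [← intervalIntegral.integral_const_mul, ← intervalIntegral.integral_sub
      (Continuous.intervalIntegrable (by fun_prop) _ _)
      (Continuous.intervalIntegrable (by fun_prop) _ _)]
    congr 1 with y
    ring
  rw [h1]
  rcases le_total v 1 with hv | hv
  · rw [ker, ← intervalIntegral.integral_eq_integral_of_support_subset (a := v) (b := 1)]
    · refine intervalIntegral.integral_congr fun y hy => ?_
      rw [uIcc_of_le hv] at hy
      have := Real.exp_le_exp.2 hy.1
      rw [max_eq_left (by linarith)]
    · intro y hy
      rw [Function.mem_support] at hy
      constructor
      · by_contra! h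
        have := Real.exp_le_exp.2 h
        exact hy (by rw [max_eq_right (by linarith), mul_zero])
      · by_contra! h
        exact hy (by rw [molS_eq_zero hδ (by linarith [le_abs_self y]), zero_mul])
  · rw [ker_eq_zero hδ hδ1 hv, intervalIntegral.integral_congr (g := fun _ => (0 : ℝ)),
      intervalIntegral.integral_zero]
    intro y hy
    rw [uIcc_of_ge hv] at hy
    simp only
    rw [molS_eq_zero hδ (by linarith [le_abs_self y, hy.1]), zero_mul]

lemma ker_of_le {δ v : ℝ} (hδ : 0 < δ) (hδ1 : δ ≤ 1) (hv : v ≤ -1) :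
    ker δ v = (∫ y, molS δ y * Real.exp y) - Real.exp v := by
  have h : ker δ v = ∫ y, (molS δ y * Real.exp y - molS δ y * Real.exp v) := by
    refine integral_congr_ae (Eventually.of_forall fun y => ?_)
    by_cases hy : δ ≤ |y|
    · simp [molS_eq_zero hδ hy]
    · have := Real.exp_le_exp.2 (show v ≤ y by linarith [neg_abs_le y])
      simp only
      rw [max_eq_left (by linarith)]
      ring
  rw [h, integral_sub (integrable_molS_mul hδ Real.continuous_exp)
    (integrable_molS_mul hδ continuous_const), integral_mul_const, integral_molS hδ, one_mul]

lemma hasDerivAt_ker {δ : ℝ} (hδ : 0 < δ) (hδ1 : δ ≤ 1) (v : ℝ) :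
    HasDerivAt (ker δ) (-(Real.exp v * ∫ y in v..1, molS δ y)) v := by
  have hc := continuous_molS δ
  have h1 : HasDerivAt (fun v => ∫ y in v..1, molS δ y * Real.exp y)
      (-(molS δ v * Real.exp v)) v :=
    intervalIntegral.integral_hasDerivAt_left (Continuous.intervalIntegrable (by fun_prop) _ _)
      (Continuous.stronglyMeasurableAtFilter (by fun_prop) _ _)
      (Continuous.continuousAt (by fun_prop))
  have h2 : HasDerivAt (fun v => ∫ y in v..1, molS δ y) (-(molS δ v)) v :=
    intervalIntegral.integral_hasDerivAt_left (Continuous.intervalIntegrable (by fun_prop) _ _)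
      (Continuous.stronglyMeasurableAtFilter (by fun_prop) _ _)
      (Continuous.continuousAt (by fun_prop))
  rw [funext (ker_eq_interval hδ hδ1)]
  refine (h1.sub ((Real.hasDerivAt_exp v).mul h2)).congr_deriv ?_
  ring

lemma hasDerivAt_ker' {δ : ℝ} (v : ℝ) :
    HasDerivAt (fun v => -(Real.exp v * ∫ y in v..1, molS δ y))
      (-(Real.exp v * ∫ y in v..1, molS δ y) + molS δ v * Real.exp v) v := by
  have hc := continuous_molS δ
  have h2 : HasDerivAt (fun v => ∫ y in v..1, molS δ y) (-(molS δ v)) v :=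
    intervalIntegral.integral_hasDerivAt_left (Continuous.intervalIntegrable (by fun_prop) _ _)
      (Continuous.stronglyMeasurableAtFilter (by fun_prop) _ _)
      (Continuous.continuousAt (by fun_prop))
  refine ((Real.hasDerivAt_exp v).mul h2).neg.congr_deriv ?_
  ring

/-- The operator `(1 - S)(1 - S / 2)` with `S` the shift by `log 2`. -/
noncomputable def shiftDiff (f : ℝ → ℝ) (v : ℝ) : ℝ :=
  f v - 3 / 2 * f (v + Real.log 2) + 1 / 2 * f (v + 2 * Real.log 2)

lemma HasDerivAt.shiftDiff {f f' : ℝ → ℝ} (h : ∀ v, HasDerivAt f (f' v) v) (v : ℝ) :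
    HasDerivAt (shiftDiff f) (shiftDiff f' v) v :=
  ((h v).sub ((h _).comp_add_const v (Real.log 2) |>.const_mul (3 / 2))).add
    ((h _).comp_add_const v (2 * Real.log 2) |>.const_mul (1 / 2))

lemma norm_fourier_shiftDiff_le {f : ℝ → ℝ} (hf : Integrable f) (t : ℝ) :
    ‖𝓕 (fun v => (shiftDiff f v : ℂ)) t‖ ≤ 3 * ‖𝓕 (fun v => (f v : ℂ)) t‖ := by
  have hF : Integrable fun v => (f v : ℂ) := hf.ofReal
  have hsh : ∀ c : ℝ, ‖∫ v, Complex.exp (↑(-2 * Real.pi * v * t) * Complex.I) * (f (v + c) : ℂ)‖ =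
      ‖𝓕 (fun v => (f v : ℂ)) t‖ := fun c => by
    have := congrFun (VectorFourier.fourierIntegral_comp_add_right Real.fourierChar volume
      (innerₗ ℝ) (fun v => (f v : ℂ)) c) t
    have h2 := congrArg norm this
    rw [Circle.norm_smul] at h2
    have h3 := Real.fourier_real_eq_integral_exp_smul (fun v => (f (v + c) : ℂ)) t
    simp only [smul_eq_mul] at h3
    rw [← h3]
    exact h2
  have hInt : ∀ c : ℝ, Integrable fun v =>
      Complex.exp (↑(-2 * Real.pi * v * t) * Complex.I) * (f (v + c) : ℂ) := fun c => by
    refine (hF.comp_add_right c).bdd_mul (c := 1) (by fun_prop) (Eventually.of_forall fun v => ?_)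
    rw [Complex.norm_exp_ofReal_mul_I]
  rw [Real.fourier_real_eq_integral_exp_smul]
  have : (fun v : ℝ => Complex.exp (↑(-2 * Real.pi * v * t) * Complex.I) • (shiftDiff f v : ℂ)) =
      fun v => Complex.exp (↑(-2 * Real.pi * v * t) * Complex.I) * (f (v + 0) : ℂ) -
        (3 / 2 : ℂ) * (Complex.exp (↑(-2 * Real.pi * v * t) * Complex.I) *
          (f (v + Real.log 2) : ℂ)) +
        (1 / 2 : ℂ) * (Complex.exp (↑(-2 * Real.pi * v * t) * Complex.I) *
          (f (v + 2 * Real.log 2) : ℂ)) := by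
    ext v
    simp only [shiftDiff, smul_eq_mul, add_zero]
    push_cast
    ring
  have h4 := integral_add ((hInt 0).sub ((hInt (Real.log 2)).const_mul (3 / 2)))
    ((hInt (2 * Real.log 2)).const_mul (1 / 2))
  have h5 := integral_sub (hInt 0) ((hInt (Real.log 2)).const_mul (3 / 2))
  simp only [Pi.sub_apply] at h4
  rw [this, h4, h5, integral_const_mul, integral_const_mul]
  refine (norm_add_le _ _).trans ((add_le_add_left (norm_sub_le _ _) _).trans ?_)
  rw [norm_mul, norm_mul, hsh, hsh, hsh]
  norm_num
  linarith [norm_nonneg (𝓕 (fun v => (f v : ℂ)) t)]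

lemma shiftDiff_ker_eq_zero {δ v : ℝ} (hδ : 0 < δ) (hδ1 : δ ≤ 1) (hv : 3 ≤ |v|) :
    shiftDiff (ker δ) v = 0 := by
  have h2 : 0 < Real.log 2 := Real.log_pos (by norm_num)
  have h2' := Real.log_two_lt_d9
  rcases le_abs'.1 hv with h | h
  · rw [shiftDiff, ker_of_le hδ hδ1 (by linarith), ker_of_le hδ hδ1 (by linarith),
      ker_of_le hδ hδ1 (by linarith), two_mul, Real.exp_add, Real.exp_add v,
      Real.exp_add (Real.log 2), Real.exp_log (by norm_num)]
    ring
  · rw [shiftDiff, ker_eq_zero hδ hδ1 (by linarith), ker_eq_zero hδ hδ1 (by linarith),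
      ker_eq_zero hδ hδ1 (by linarith)]
    ring

end Kernel

section KernelNorm

open scoped FourierTransform ContDiff

lemma integrable_abs_rpow_mul {q : ℝ} (hq : -1 < q) {j : ℕ} (hj : q + 1 < j) :
    Integrable fun s : ℝ => |s| ^ q * ((1 + |s|) ^ j)⁻¹ := by
  have h := (integrable_fun_norm_addHaar (volume : Measure ℝ)
    (f := fun y : ℝ => y ^ q * ((1 + y) ^ j)⁻¹)).2
  simp only [Module.finrank_self, Nat.sub_self, pow_zero, one_smul, Real.norm_eq_abs] at h
  refine h ?_
  have hmeas : Measurable fun y : ℝ => y ^ q * ((1 + y) ^ j)⁻¹ := by fun_prop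
  rw [← Ioc_union_Ioi_eq_Ioi zero_le_one]
  refine IntegrableOn.union ?_ ?_
  · have h1 : IntegrableOn (fun y : ℝ => y ^ q) (Ioc 0 1) :=
      (intervalIntegrable_iff_integrableOn_Ioc_of_le zero_le_one).1
        (intervalIntegral.intervalIntegrable_rpow' hq)
    refine Integrable.mono' h1 hmeas.aestronglyMeasurable ?_
    refine (ae_restrict_iff' measurableSet_Ioc).2 (Eventually.of_forall fun y hy => ?_)
    have hy0 := hy.1.le
    rw [Real.norm_of_nonneg (by positivity)]
    refine mul_le_of_le_one_right (by positivity) (inv_le_one_of_one_le₀ (one_le_pow₀ ?_))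
    linarith
  · have h1 := integrableOn_Ioi_rpow_of_lt (a := q - j) (by linarith) (zero_lt_one (α := ℝ))
    refine Integrable.mono' h1 hmeas.aestronglyMeasurable ?_
    refine (ae_restrict_iff' measurableSet_Ioi).2 (Eventually.of_forall fun y hy => ?_)
    have hy0 : 0 < y := zero_lt_one.trans hy
    rw [Real.norm_of_nonneg (by positivity), Real.rpow_sub hy0, div_eq_mul_inv, Real.rpow_natCast]
    gcongr
    linarith

lemma scaled_integral {q : ℝ} (j : ℕ) {δ : ℝ} (hδ : 0 < δ) :
    (∫ t : ℝ, |t| ^ q * ((1 + δ * |t|) ^ j)⁻¹) =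
      δ ^ (-(q + 1)) * ∫ s : ℝ, |s| ^ q * ((1 + |s|) ^ j)⁻¹ := by
  have h := Measure.integral_comp_mul_left (fun s : ℝ => |s| ^ q * ((1 + |s|) ^ j)⁻¹) δ
  rw [abs_of_pos (inv_pos.2 hδ), smul_eq_mul] at h
  have h2 : ∀ t : ℝ, |t| ^ q * ((1 + δ * |t|) ^ j)⁻¹ =
      δ ^ (-q) * (|δ * t| ^ q * ((1 + |δ * t|) ^ j)⁻¹) := fun t => by
    rw [abs_mul, abs_of_pos hδ, Real.mul_rpow hδ.le (abs_nonneg t), Real.rpow_neg hδ.le]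
    have := Real.rpow_pos_of_pos hδ q
    field_simp
  simp_rw [h2]
  rw [integral_const_mul, h, ← mul_assoc, neg_add, Real.rpow_add hδ, Real.rpow_neg_one]

lemma integrable_scaled {q : ℝ} (hq : -1 < q) {j : ℕ} (hj : q + 1 < j) {δ : ℝ} (hδ : 0 < δ) :
    Integrable fun t : ℝ => |t| ^ q * ((1 + δ * |t|) ^ j)⁻¹ := by
  have h := ((integrable_abs_rpow_mul hq hj).comp_mul_left' hδ.ne').const_mul (δ ^ (-q))
  refine h.congr (Eventually.of_forall fun t => ?_)
  simp only
  rw [abs_mul, abs_of_pos hδ, Real.mul_rpow hδ.le (abs_nonneg t), Real.rpow_neg hδ.le]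
  have := Real.rpow_pos_of_pos hδ q
  field_simp

/-- The weight attached to the kernel `ker δ`. -/
noncomputable def kerWeight (δ v : ℝ) : ℂ := (shiftDiff (ker δ) v : ℂ)

lemma abs_shiftDiff_ker_le {δ : ℝ} (hδ : 0 < δ) (hδ1 : δ ≤ 1) (v : ℝ) :
    |shiftDiff (ker δ) v| ≤ 9 := by
  have h := fun w => ker_nonneg hδ w
  have h' := fun w => ker_le hδ hδ1 w
  rw [shiftDiff, abs_le]
  constructor <;>
    linarith [h v, h (v + Real.log 2), h (v + 2 * Real.log 2), h' v, h' (v + Real.log 2),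
      h' (v + 2 * Real.log 2)]

lemma norm_fourier_kerWeight_le {δ : ℝ} (hδ : 0 < δ) (hδ1 : δ ≤ 1) (t : ℝ) :
    ‖𝓕 (kerWeight δ) t‖ ≤ 54 := by
  refine (VectorFourier.norm_fourierIntegral_le_integral_norm _ _ _ _ _).trans ?_
  have h : ∀ v, ‖kerWeight δ v‖ ≤ (Icc (-3 : ℝ) 3).indicator (fun _ => (9 : ℝ)) v := fun v => by
    rw [kerWeight, Complex.norm_real, Real.norm_eq_abs]
    by_cases hv : v ∈ Icc (-3 : ℝ) 3
    · rw [indicator_of_mem hv]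
      exact abs_shiftDiff_ker_le hδ hδ1 v
    · rw [indicator_of_notMem hv, shiftDiff_ker_eq_zero hδ hδ1, abs_zero]
      by_contra! h
      exact hv ⟨(abs_lt.1 h).1.le, (abs_lt.1 h).2.le⟩
  refine (integral_mono_of_nonneg (Eventually.of_forall fun v => norm_nonneg _) ?_
    (Eventually.of_forall h)).trans ?_
  · exact (integrable_indicator_iff measurableSet_Icc).2 (integrableOn_const (by simp))
  · rw [integral_indicator measurableSet_Icc]
    simp
    norm_num

lemma hasCompactSupport_kerWeight {δ : ℝ} (hδ : 0 < δ) (hδ1 : δ ≤ 1) :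
    HasCompactSupport (kerWeight δ) :=
  HasCompactSupport.intro (isCompact_closedBall (0 : ℝ) 3) fun z hz => by
    rw [mem_closedBall_zero_iff, not_le] at hz
    rw [kerWeight, shiftDiff_ker_eq_zero hδ hδ1 hz.le, Complex.ofReal_zero]

lemma differentiable_kerWeight {δ : ℝ} (hδ : 0 < δ) (hδ1 : δ ≤ 1) :
    Differentiable ℝ (kerWeight δ) := fun v =>
  (HasDerivAt.shiftDiff (hasDerivAt_ker hδ hδ1) v).ofReal_comp.differentiableAt

lemma sq_mul_norm_fourier_kerWeight_le {δ : ℝ} (hδ : 0 < δ) (hδ1 : δ ≤ 1) (t : ℝ) :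
    t ^ 2 * ‖𝓕 (kerWeight δ) t‖ ≤
      3 * ‖𝓕 (fun y : ℝ => ((molS δ y * Real.exp y : ℝ) : ℂ)) t‖ := by
  set σ : ℝ → ℝ := fun y => molS δ y * Real.exp y with hσ
  set k' : ℝ → ℝ := shiftDiff fun v => -(Real.exp v * ∫ y in v..1, molS δ y) with hk'
  have hcσ : Continuous σ := (continuous_molS δ).mul Real.continuous_exp
  have hiσ : Integrable σ := integrable_molS_mul hδ Real.continuous_exp
  have hcs := hasCompactSupport_kerWeight hδ hδ1
  have hd1 : deriv (kerWeight δ) = fun v => (k' v : ℂ) := funext fun v =>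
    (HasDerivAt.shiftDiff (hasDerivAt_ker hδ hδ1) v).ofReal_comp.deriv
  have hk2 : ∀ v, HasDerivAt k' (k' v + shiftDiff σ v) v := fun v => by
    refine (HasDerivAt.shiftDiff (f' := fun v => -(Real.exp v * ∫ y in v..1, molS δ y) + σ v)
      (fun v => hasDerivAt_ker' (δ := δ) v) v).congr_deriv ?_
    simp only [hk', shiftDiff]
    ring
  have hck' : Continuous k' :=
    continuous_iff_continuousAt.2 fun v => (hk2 v).continuousAt
  have hcσ' : Continuous (shiftDiff σ) := by unfold shiftDiff; fun_prop
  have hd2 : deriv (deriv (kerWeight δ)) = fun v => ((k' v + shiftDiff σ v : ℝ) : ℂ) := by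
    rw [hd1]
    exact funext fun v => (hk2 v).ofReal_comp.deriv
  have hdiff1 : Differentiable ℝ (deriv (kerWeight δ)) := by
    rw [hd1]
    exact fun v => (hk2 v).ofReal_comp.differentiableAt
  have hi0 : Integrable (kerWeight δ) :=
    (differentiable_kerWeight hδ hδ1).continuous.integrable_of_hasCompactSupport hcs
  have hi1 : Integrable (deriv (kerWeight δ)) :=
    hdiff1.continuous.integrable_of_hasCompactSupport hcs.deriv
  have hi2 : Integrable (deriv (deriv (kerWeight δ))) := by
    refine Continuous.integrable_of_hasCompactSupport ?_ hcs.deriv.deriv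
    rw [hd2]
    fun_prop
  have h1 := congrFun (Real.fourier_deriv hi0 (differentiable_kerWeight hδ hδ1) hi1) t
  have h2 := congrFun (Real.fourier_deriv hi1 hdiff1 hi2) t
  simp only [smul_eq_mul] at h1 h2
  have h3 : 𝓕 (fun v => (shiftDiff σ v : ℂ)) t =
      𝓕 (deriv (deriv (kerWeight δ))) t - 𝓕 (deriv (kerWeight δ)) t := by
    have hsub : (fun v => (shiftDiff σ v : ℂ)) =
        fun v => deriv (deriv (kerWeight δ)) v - deriv (kerWeight δ) v := by
      rw [hd2, hd1]
      ext v
      push_cast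
      ring
    rw [hsub, Real.fourier_eq, Real.fourier_eq, Real.fourier_eq]
    simp_rw [smul_sub]
    have e1 := (Real.fourierIntegral_convergent_iff t).2 hi1
    have e2 := (Real.fourierIntegral_convergent_iff t).2 hi2
    exact integral_sub e2 e1
  rw [h2, h1] at h3
  have h4 := norm_fourier_shiftDiff_le hiσ t
  rw [h3] at h4
  refine le_trans ?_ h4
  have h5 : 2 * Real.pi * Complex.I * t * (2 * Real.pi * Complex.I * t * 𝓕 (kerWeight δ) t) -
      2 * Real.pi * Complex.I * t * 𝓕 (kerWeight δ) t =
      (2 * Real.pi * Complex.I * t) * (2 * Real.pi * Complex.I * t - 1) * 𝓕 (kerWeight δ) t := by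
    ring
  rw [h5, norm_mul, norm_mul]
  have hpi : 1 ≤ 2 * Real.pi := by linarith [Real.pi_gt_three]
  have h6 : |t| ≤ 2 * Real.pi * |t| := le_mul_of_one_le_left (abs_nonneg t) hpi
  have h7 : |t| ≤ ‖2 * Real.pi * Complex.I * (t : ℂ)‖ := by
    simpa [abs_of_pos Real.pi_pos] using h6
  have h8 : |t| ≤ ‖2 * Real.pi * Complex.I * (t : ℂ) - 1‖ := by
    refine le_trans ?_ (Complex.abs_im_le_norm _)
    simpa [abs_mul, abs_of_pos Real.pi_pos] using h6
  rw [← sq_abs, sq]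
  gcongr

/-- The kernel weights have Fourier norm `O(δ ^ (1 - e))`. -/
theorem exists_fourierNorm_kerWeight_le {e : ℝ} (he : 1 < e) : ∃ C, 0 ≤ C ∧ ∀ δ : ℝ, 0 < δ →
    δ ≤ 1 → IsWeight e 3 (kerWeight δ) ∧ fourierNorm e (kerWeight δ) ≤ C * δ ^ (-(e - 1)) := by
  obtain ⟨j, hj⟩ := exists_nat_gt e
  obtain ⟨C, hC0, hC⟩ := exists_fourier_molS_exp_bound j
  have hq : -1 < e - 2 := by linarith
  have hj' : e - 2 + 1 < j := by linarith
  set A := ∫ s : ℝ, |s| ^ (e - 2) * ((1 + |s|) ^ j)⁻¹ with hA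
  have hA0 : 0 ≤ A := integral_nonneg fun s => by positivity
  refine ⟨54 * 2 ^ e * 2 + 2 ^ e * (3 * C) * A, by positivity, fun δ hδ hδ1 => ?_⟩
  set D : ℝ → ℝ := fun t => (Icc (-1 : ℝ) 1).indicator (fun _ => 54 * 2 ^ e) t +
    2 ^ e * (3 * C) * (|t| ^ (e - 2) * ((1 + δ * |t|) ^ j)⁻¹) with hD
  have hi1 : Integrable ((Icc (-1 : ℝ) 1).indicator fun _ => (54 * 2 ^ e : ℝ)) :=
    (integrable_indicator_iff measurableSet_Icc).2 (integrableOn_const (by simp))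
  have hi2 := (integrable_scaled hq hj' hδ).const_mul (2 ^ e * (3 * C))
  have hDi : Integrable D := hi1.add hi2
  have hcont := (differentiable_kerWeight hδ hδ1).continuous
  have hcs := hasCompactSupport_kerWeight hδ hδ1
  have hbd : ∀ t, ‖𝓕 (kerWeight δ) t‖ * (1 + |t|) ^ e ≤ D t := fun t => by
    have hP : 0 < 1 + δ * |t| := by positivity
    by_cases ht : t ∈ Icc (-1 : ℝ) 1
    · simp only [hD]
      rw [indicator_of_mem ht]
      have h1 : |t| ≤ 1 := abs_le.2 ht
      have h2 : (1 + |t|) ^ e ≤ 2 ^ e := by gcongr; linarith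
      have h3 := norm_fourier_kerWeight_le hδ hδ1 t
      have h4 : ‖𝓕 (kerWeight δ) t‖ * (1 + |t|) ^ e ≤ 54 * 2 ^ e := by gcongr
      have : 0 ≤ 2 ^ e * (3 * C) * (|t| ^ (e - 2) * ((1 + δ * |t|) ^ j)⁻¹) := by positivity
      linarith
    · simp only [hD]
      rw [indicator_of_notMem ht, zero_add]
      have h1 : 1 < |t| := by
        by_contra! h
        exact ht (abs_le.1 h)
      have ht0 : 0 < |t| := by linarith
      have h2 : (1 + |t|) ^ e ≤ 2 ^ e * |t| ^ e := by
        rw [← Real.mul_rpow (by norm_num) ht0.le]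
        gcongr
        linarith
      have h3 := sq_mul_norm_fourier_kerWeight_le hδ hδ1 t
      have h4 := hC δ hδ hδ1 t
      rw [← le_div_iff₀ (by positivity)] at h4
      have h5 : ‖𝓕 (kerWeight δ) t‖ ≤ 3 * (C / (1 + δ * |t|) ^ j) / |t| ^ 2 := by
        rw [le_div_iff₀ (by positivity), sq_abs]
        linarith
      calc ‖𝓕 (kerWeight δ) t‖ * (1 + |t|) ^ e
          ≤ (3 * (C / (1 + δ * |t|) ^ j) / |t| ^ 2) * (2 ^ e * |t| ^ e) := by gcongr
        _ = _ := by
          rw [Real.rpow_sub ht0, Real.rpow_two]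
          field_simp
  have hmeas : AEStronglyMeasurable (fun t => ‖𝓕 (kerWeight δ) t‖ * (1 + |t|) ^ e) volume := by
    refine AEStronglyMeasurable.mul ?_ (Measurable.aestronglyMeasurable (by fun_prop))
    exact (VectorFourier.fourierIntegral_continuous Real.continuous_fourierChar
      (by exact continuous_inner)
      (hcont.integrable_of_hasCompactSupport hcs)).norm.aestronglyMeasurable
  have hInt : Integrable fun t => ‖𝓕 (kerWeight δ) t‖ * (1 + |t|) ^ e :=
    hDi.mono' hmeas (Eventually.of_forall fun t => by
      rw [Real.norm_of_nonneg (by positivity)]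
      exact hbd t)
  refine ⟨⟨hcont, fun u hu => by
    rw [kerWeight, shiftDiff_ker_eq_zero hδ hδ1 hu.le, Complex.ofReal_zero], hInt⟩, ?_⟩
  have h1 : fourierNorm e (kerWeight δ) ≤ ∫ t, D t := integral_mono hInt hDi hbd
  have h2 : ∫ t, D t = 54 * 2 ^ e * 2 + 2 ^ e * (3 * C) * (δ ^ (-(e - 1)) * A) := by
    simp only [hD]
    rw [integral_add hi1 hi2, integral_const_mul, scaled_integral j hδ,
      integral_indicator measurableSet_Icc, hA]
    congr 1
    · simp
      norm_num
      ring
    · congr 4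
      ring
  have h3 : 1 ≤ δ ^ (-(e - 1)) := Real.one_le_rpow_of_pos_of_le_one_of_nonpos hδ hδ1 (by linarith)
  rw [h2] at h1
  refine h1.trans ?_
  rw [add_mul]
  refine add_le_add (le_mul_of_one_le_right (by positivity) h3) (le_of_eq ?_)
  ring

end KernelNorm

section SmoothSum

lemma two_mul_integral_molS {δ : ℝ} (hδ : 0 < δ) {β : ℝ → ℝ} (hβ : Continuous β) (u : ℝ) :
    2 * ∫ y, molS δ y * β (u + y) = ∫ y, molS δ y * (β (u + y) + β (u - y)) := by
  have h1 : ∫ y, molS δ y * β (u + y) = ∫ y, molS δ y * β (u - y) := by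
    rw [← integral_neg_eq_self]
    simp_rw [molS_neg, sub_eq_add_neg]
  simp_rw [mul_add]
  rw [integral_add (integrable_molS_mul hδ (by fun_prop)) (integrable_molS_mul hδ (by fun_prop)),
    ← h1, two_mul]

lemma le_integral_molS {δ : ℝ} (hδ : 0 < δ) {β : ℝ → ℝ} (hβ : Continuous β)
    (hc : ConvexOn ℝ univ β) (u : ℝ) : β u ≤ ∫ y, molS δ y * β (u + y) := by
  have h1 := two_mul_integral_molS hδ hβ u
  have h2 : ∫ y, molS δ y * (2 * β u) ≤ ∫ y, molS δ y * (β (u + y) + β (u - y)) := by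
    refine integral_mono (integrable_molS_mul hδ (by fun_prop))
      (integrable_molS_mul hδ (by fun_prop)) fun y => ?_
    refine mul_le_mul_of_nonneg_left ?_ (molS_nonneg hδ y)
    have h := hc.2 (mem_univ (u + y)) (mem_univ (u - y)) (show (0 : ℝ) ≤ 1 / 2 by norm_num)
      (show (0 : ℝ) ≤ 1 / 2 by norm_num) (by norm_num)
    simp only [smul_eq_mul] at h
    rw [show 1 / 2 * (u + y) + 1 / 2 * (u - y) = u by ring] at h
    linarith
  rw [integral_mul_const, integral_molS hδ] at h2
  linarith

lemma integral_molS_le {δ : ℝ} (hδ : 0 < δ) {β : ℝ → ℝ} (hβ : Continuous β)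
    (hc : ConvexOn ℝ univ β) (u : ℝ) :
    2 * ∫ y, molS δ y * β (u + y) ≤ β (u + δ) + β (u - δ) := by
  have h2 : ∫ y, molS δ y * (β (u + y) + β (u - y)) ≤
      ∫ y, molS δ y * (β (u + δ) + β (u - δ)) := by
    refine integral_mono (integrable_molS_mul hδ (by fun_prop))
      (integrable_molS_mul hδ (by fun_prop)) fun y => ?_
    by_cases hy : δ ≤ |y|
    · simp [molS_eq_zero hδ hy]
    · refine mul_le_mul_of_nonneg_left ?_ (molS_nonneg hδ y)
      push Not at hy
      obtain ⟨h3, h4⟩ := abs_lt.1 hy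
      have ha : 0 ≤ (δ + y) / (2 * δ) := div_nonneg (by linarith) (by linarith)
      have hb : 0 ≤ (δ - y) / (2 * δ) := div_nonneg (by linarith) (by linarith)
      have hab : (δ + y) / (2 * δ) + (δ - y) / (2 * δ) = 1 := by
        field_simp
        ring
      have e1 := hc.2 (mem_univ (u + δ)) (mem_univ (u - δ)) ha hb hab
      have e2 := hc.2 (mem_univ (u + δ)) (mem_univ (u - δ)) hb ha (by rw [add_comm]; exact hab)
      simp only [smul_eq_mul] at e1 e2
      rw [show (δ + y) / (2 * δ) * (u + δ) + (δ - y) / (2 * δ) * (u - δ) = u + y by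
        field_simp; ring] at e1
      rw [show (δ - y) / (2 * δ) * (u + δ) + (δ + y) / (2 * δ) * (u - δ) = u - y by
        field_simp; ring] at e2
      have e3 : (δ - y) / (2 * δ) = 1 - (δ + y) / (2 * δ) := by linarith
      rw [e3] at e1 e2
      linarith
  rw [integral_mul_const, integral_molS hδ, one_mul] at h2
  rwa [two_mul_integral_molS hδ hβ u]

variable {ι : Type*} (l : ι → ℝ)

/-- The sum of `max (exp u - exp (l i)) 0` over the index set. -/
noncomputable def rieszSum (u : ℝ) : ℝ := ∑' i, max (Real.exp u - Real.exp (l i)) 0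

/-- The smoothed and normalised version of `rieszSum`. -/
noncomputable def smoothSum (δ u : ℝ) : ℝ := ∑' i, ker δ (l i - u)

variable {l}

lemma rieszSum_eq_sum {T u : ℝ} (s : Finset ι) (hs : ∀ i, l i ≤ T → i ∈ s) (hu : u ≤ T) :
    rieszSum l u = ∑ i ∈ s, max (Real.exp u - Real.exp (l i)) 0 :=
  tsum_eq_sum fun i hi => by
    have h : ¬ l i ≤ T := fun h => hi (hs i h)
    have := Real.exp_le_exp.2 (show u ≤ l i by linarith)
    exact max_eq_right (by linarith)

lemma smoothSum_eq_sum {δ T u : ℝ} (hδ : 0 < δ) (hδ1 : δ ≤ 1) (s : Finset ι)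
    (hs : ∀ i, l i ≤ T → i ∈ s) (hu : u + 1 ≤ T) :
    smoothSum l δ u = ∑ i ∈ s, ker δ (l i - u) :=
  tsum_eq_sum fun i hi => by
    have h : ¬ l i ≤ T := fun h => hi (hs i h)
    exact ker_eq_zero hδ hδ1 (by linarith)

lemma exp_mul_smoothSum {δ T u : ℝ} (hδ : 0 < δ) (hδ1 : δ ≤ 1) (s : Finset ι)
    (hs : ∀ i, l i ≤ T → i ∈ s) (hu : u + 1 ≤ T) :
    Real.exp u * smoothSum l δ u =
      ∫ y, molS δ y * ∑ i ∈ s, max (Real.exp (u + y) - Real.exp (l i)) 0 := by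
  rw [smoothSum_eq_sum hδ hδ1 s hs hu, Finset.mul_sum]
  simp_rw [Finset.mul_sum]
  rw [integral_finsetSum _ fun i _ => integrable_molS_mul hδ (by fun_prop)]
  refine Finset.sum_congr rfl fun i _ => ?_
  rw [ker, ← integral_const_mul]
  refine integral_congr_ae (Eventually.of_forall fun y => ?_)
  simp only
  rw [mul_left_comm, mul_max_of_nonneg _ _ (Real.exp_pos u).le, mul_zero, mul_sub, ← Real.exp_add,
    ← Real.exp_add, add_sub_cancel]

lemma convexOn_finset_sum_max_exp (s : Finset ι) :
    ConvexOn ℝ univ fun u => ∑ i ∈ s, max (Real.exp u - Real.exp (l i)) 0 := by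
  classical
  induction s using Finset.induction_on with
  | empty => simpa using convexOn_const 0 convex_univ
  | insert i s hi ih =>
    simp_rw [Finset.sum_insert hi]
    refine ConvexOn.add ?_ ih
    exact (convexOn_exp.sub (concaveOn_const _ convex_univ)).sup (convexOn_const 0 convex_univ)

variable (hfin : ∀ T, {i | l i ≤ T}.Finite)
include hfin

lemma rieszSum_le {δ : ℝ} (hδ : 0 < δ) (hδ1 : δ ≤ 1) (u : ℝ) :
    rieszSum l u ≤ Real.exp u * smoothSum l δ u := by
  have hs : ∀ i, l i ≤ u + 1 → i ∈ (hfin (u + 1)).toFinset := fun i hi => by simpa using hi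
  rw [rieszSum_eq_sum _ hs (by linarith), exp_mul_smoothSum hδ hδ1 _ hs le_rfl]
  exact le_integral_molS hδ (β := fun w => ∑ i ∈ (hfin (u + 1)).toFinset,
    max (Real.exp w - Real.exp (l i)) 0) (by fun_prop) (convexOn_finset_sum_max_exp _) u

lemma le_rieszSum {δ : ℝ} (hδ : 0 < δ) (hδ1 : δ ≤ 1) (u : ℝ) :
    2 * (Real.exp (u - δ) * smoothSum l δ (u - δ)) -
      Real.exp (u - 2 * δ) * smoothSum l δ (u - 2 * δ) ≤ rieszSum l u := by
  have hs : ∀ i, l i ≤ u + 1 → i ∈ (hfin (u + 1)).toFinset := fun i hi => by simpa using hi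
  have h1 := rieszSum_le hfin hδ hδ1 (u - 2 * δ)
  have h2 := integral_molS_le hδ (β := fun w => ∑ i ∈ (hfin (u + 1)).toFinset,
    max (Real.exp w - Real.exp (l i)) 0) (by fun_prop) (convexOn_finset_sum_max_exp _) (u - δ)
  rw [← exp_mul_smoothSum hδ hδ1 _ hs (by linarith), ← rieszSum_eq_sum _ hs (by linarith),
    ← rieszSum_eq_sum _ hs (by linarith), sub_add_cancel,
    show u - δ - δ = u - 2 * δ by ring] at h2
  linarith

lemma tsum_kerWeight {δ : ℝ} (hδ : 0 < δ) (hδ1 : δ ≤ 1) (u : ℝ) :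
    ∑' i, kerWeight δ (l i - u) = ((smoothSum l δ u - 3 / 2 * smoothSum l δ (u - Real.log 2) +
      1 / 2 * smoothSum l δ (u - 2 * Real.log 2) : ℝ) : ℂ) := by
  have h2 : 0 < Real.log 2 := Real.log_pos (by norm_num)
  have hs : ∀ i, l i ≤ u + 3 → i ∈ (hfin (u + 3)).toFinset := fun i hi => by simpa using hi
  have hz : ∀ i ∉ (hfin (u + 3)).toFinset, kerWeight δ (l i - u) = 0 := fun i hi => by
    have h : ¬ l i ≤ u + 3 := fun h => hi (hs i h)
    rw [kerWeight, shiftDiff_ker_eq_zero hδ hδ1, Complex.ofReal_zero]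
    rw [abs_of_pos (by linarith)]
    linarith
  rw [tsum_eq_sum hz, smoothSum_eq_sum hδ hδ1 _ hs (by linarith),
    smoothSum_eq_sum hδ hδ1 _ hs (by linarith), smoothSum_eq_sum hδ hδ1 _ hs (by linarith),
    Finset.mul_sum, Finset.mul_sum, ← Finset.sum_sub_distrib, ← Finset.sum_add_distrib,
    Complex.ofReal_sum]
  refine Finset.sum_congr rfl fun i _ => ?_
  rw [kerWeight, shiftDiff, sub_add, sub_add, sub_sub_eq_add_sub, sub_sub_eq_add_sub]
  norm_num [sub_add_eq_add_sub, sub_sub_eq_add_sub]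

lemma abs_smoothSum_le {δ u : ℝ} (hδ : 0 < δ) (hδ1 : δ ≤ 1) (hu : u ≤ 0) :
    |smoothSum l δ u| ≤ 3 * (hfin 1).toFinset.card := by
  have hs : ∀ i, l i ≤ 1 → i ∈ (hfin 1).toFinset := fun i hi => by simpa using hi
  rw [smoothSum_eq_sum hδ hδ1 _ hs (by linarith),
    abs_of_nonneg (Finset.sum_nonneg fun i _ => ker_nonneg hδ _)]
  refine (Finset.sum_le_card_nsmul _ _ 3 fun i _ => ker_le hδ hδ1 _).trans (le_of_eq ?_)
  rw [nsmul_eq_mul, mul_comm]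

end SmoothSum

section Tauberian

lemma le_of_le_shift_add {φ : ℝ → ℝ} {L M E U : ℝ} (hE : 0 ≤ E) (hL : 1 / 2 ≤ L)
    (hM : ∀ u, -L ≤ u → u ≤ 0 → φ u ≤ M)
    (hφ : ∀ u, 0 ≤ u → u ≤ U → φ u ≤ φ (u - L) + E) {u : ℝ} (hu : 0 ≤ u) (huU : u ≤ U) :
    φ u ≤ M + (1 + 2 * u) * E := by
  have key : ∀ n : ℕ, ∀ v, -L ≤ v → v < n * L → v ≤ U → φ v ≤ M + n * E := by
    intro n
    induction n with
    | zero =>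
      intro v h1 h2 _
      simp only [Nat.cast_zero, zero_mul] at h2 ⊢
      linarith [hM v h1 h2.le]
    | succ n ih =>
      intro v h1 h2 h3
      push_cast at h2 ⊢
      rcases le_total v 0 with h0 | h0
      · have : 0 ≤ ((n : ℝ) + 1) * E := by positivity
        linarith [hM v h1 h0]
      · have h4 := ih (v - L) (by linarith) (by linarith) (by linarith)
        linarith [hφ v h0 h3]
  have h1 : (⌊2 * u⌋₊ : ℝ) ≤ 2 * u := Nat.floor_le (by linarith)
  have h2 : 2 * u < ⌊2 * u⌋₊ + 1 := Nat.lt_floor_add_one _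
  have h3 := key (⌊2 * u⌋₊ + 1) u (by linarith) (by push_cast; nlinarith) huU
  push_cast at h3
  nlinarith

lemma half_le_log_two : 1 / 2 ≤ Real.log 2 := by
  have := Real.log_two_gt_d9
  linarith

lemma abs_le_of_abs_shift_le {f : ℝ → ℝ} {M E : ℝ}
    (hM : ∀ u, -(2 * Real.log 2) ≤ u → u ≤ 0 → |f u| ≤ M)
    (hE : ∀ u, 0 ≤ u → |f u - 3 / 2 * f (u - Real.log 2) + 1 / 2 * f (u - 2 * Real.log 2)| ≤ E)
    {u : ℝ} (hu : 0 ≤ u) : |f u| ≤ (1 + 2 * u) ^ 2 * (3 * M + E) := by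
  have hL := half_le_log_two
  have hE0 : 0 ≤ E := (abs_nonneg _).trans (hE 0 le_rfl)
  have hM0 : 0 ≤ M := (abs_nonneg _).trans (hM 0 (by linarith) le_rfl)
  have h1 : ∀ v, 0 ≤ v → |f v - 1 / 2 * f (v - Real.log 2)| ≤ 3 / 2 * M + (1 + 2 * v) * E := by
    intro v hv
    refine le_of_le_shift_add (φ := fun v => |f v - 1 / 2 * f (v - Real.log 2)|) hE0 hL
      (fun w hw hw0 => ?_) (fun w hw _ => ?_) hv le_rfl
    · have a1 := abs_le.1 (hM w (by linarith) hw0)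
      have a2 := abs_le.1 (hM (w - Real.log 2) (by linarith) (by linarith))
      exact abs_le.2 ⟨by linarith [a1.1, a2.2], by linarith [a1.2, a2.1]⟩
    · have a := hE w hw
      rw [show w - Real.log 2 - Real.log 2 = w - 2 * Real.log 2 by ring]
      have b := abs_add_le (f (w - Real.log 2) - 1 / 2 * f (w - 2 * Real.log 2))
        (f w - 3 / 2 * f (w - Real.log 2) + 1 / 2 * f (w - 2 * Real.log 2))
      rw [show f (w - Real.log 2) - 1 / 2 * f (w - 2 * Real.log 2) +
        (f w - 3 / 2 * f (w - Real.log 2) + 1 / 2 * f (w - 2 * Real.log 2)) =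
        f w - 1 / 2 * f (w - Real.log 2) by ring] at b
      linarith
  have h2 : |f u| ≤ M + (1 + 2 * u) * (3 / 2 * M + (1 + 2 * u) * E) := by
    refine le_of_le_shift_add (φ := fun v => |f v|) (by positivity) hL
      (fun w hw hw0 => hM w (by linarith) hw0) (fun w hw hwu => ?_) hu le_rfl
    have a := h1 w hw
    have b := abs_add_le (1 / 2 * f (w - Real.log 2)) (f w - 1 / 2 * f (w - Real.log 2))
    rw [add_sub_cancel, abs_mul, abs_of_pos (show (0 : ℝ) < 1 / 2 by norm_num)] at b
    have c : (1 + 2 * w) * E ≤ (1 + 2 * u) * E := by gcongr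
    linarith [abs_nonneg (f (w - Real.log 2))]
  have h3 : 0 ≤ u * M := by positivity
  have h4 : 0 ≤ u ^ 2 * M := by positivity
  nlinarith

lemma tendsto_exp_mul_sq_div_exp (B : ℝ) :
    Tendsto (fun u : ℝ => Real.exp u * ((1 + 2 * u) ^ 2 * B) / Real.exp (2 * u)) atTop (nhds 0) := by
  have h0 := Real.tendsto_pow_mul_exp_neg_atTop_nhds_zero 0
  have h1 := Real.tendsto_pow_mul_exp_neg_atTop_nhds_zero 1
  have h2 := Real.tendsto_pow_mul_exp_neg_atTop_nhds_zero 2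
  have h := ((h0.add (h1.const_mul 4)).add (h2.const_mul 4)).mul_const B
  simp only [mul_zero, add_zero, zero_mul] at h
  refine h.congr fun u => ?_
  rw [mul_div_right_comm, ← Real.exp_sub, show u - 2 * u = -u by ring]
  ring

lemma rieszSum_nonneg {ι : Type*} {l : ι → ℝ} (u : ℝ) : 0 ≤ rieszSum l u := tsum_nonneg fun _ => le_max_right _ _

variable {ι : Type*} {l : ι → ℝ} (hfin : ∀ T, {i | l i ≤ T}.Finite)
include hfin

lemma exists_abs_smoothSum_sub_le {e : ℝ} (he : 1 < e)
    (H : ∃ C, 0 ≤ C ∧ ∀ g, IsWeight e 3 g → ∃ c : ℂ, ∀ u, 0 ≤ u →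
      ‖∑' i, g (l i - u) - c * (Real.exp u : ℂ)‖ ≤ C * fourierNorm e g) :
    ∃ C N, 0 ≤ C ∧ 0 ≤ N ∧ ∀ δ, 0 < δ → δ ≤ 1 → ∃ c : ℝ, ∀ u, 0 ≤ u →
      |smoothSum l δ u - c * Real.exp u| ≤
        (1 + 2 * u) ^ 2 * (3 * (N + |c|) + C * δ ^ (-(e - 1))) := by
  obtain ⟨C, hC, H⟩ := H
  obtain ⟨C', hC', hK⟩ := exists_fourierNorm_kerWeight_le he
  refine ⟨C * C', 3 * (hfin 1).toFinset.card, by positivity, by positivity,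
    fun δ hδ hδ1 => ?_⟩
  obtain ⟨hw, hn⟩ := hK δ hδ hδ1
  obtain ⟨c, hc⟩ := H _ hw
  refine ⟨8 / 3 * c.re, fun u hu => ?_⟩
  refine abs_le_of_abs_shift_le (f := fun u => smoothSum l δ u - 8 / 3 * c.re * Real.exp u)
    (fun v hv hv0 => ?_) (fun v hv => ?_) hu
  · refine (abs_sub _ _).trans (add_le_add (abs_smoothSum_le hfin hδ hδ1 hv0) ?_)
    rw [abs_mul, Real.abs_exp]
    exact mul_le_of_le_one_right (abs_nonneg _) (Real.exp_le_one_iff.2 hv0)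
  · have h1 := hc v hv
    rw [tsum_kerWeight hfin hδ hδ1] at h1
    have h2 := (Complex.abs_re_le_norm _).trans h1
    rw [Complex.sub_re, Complex.ofReal_re, Complex.re_mul_ofReal] at h2
    have e1 : Real.exp (v - Real.log 2) = Real.exp v / 2 := by
      rw [Real.exp_sub, Real.exp_log two_pos]
    have e2 : Real.exp (v - 2 * Real.log 2) = Real.exp v / 4 := by
      rw [two_mul, ← sub_sub, Real.exp_sub, Real.exp_log two_pos, e1]
      ring
    rw [e1, e2]
    refine le_trans (le_of_eq ?_) (h2.trans ?_)
    · congr 1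
      ring
    · rw [mul_assoc]
      gcongr

lemma rieszSum_bounds {δ c B : ℝ} (hδ : 0 < δ) (hδ1 : δ ≤ 1 / 4)
    (hG : ∀ u, 0 ≤ u → |smoothSum l δ u - c * Real.exp u| ≤ (1 + 2 * u) ^ 2 * B) {u : ℝ}
    (hu : 2 * δ ≤ u) :
    rieszSum l u ≤ c * Real.exp (2 * u) + Real.exp u * ((1 + 2 * u) ^ 2 * B) ∧
    c * (2 * Real.exp (-(2 * δ)) - Real.exp (-(4 * δ))) * Real.exp (2 * u) -
      3 * (Real.exp u * ((1 + 2 * u) ^ 2 * B)) ≤ rieszSum l u := by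
  have hB : 0 ≤ B := by simpa using (abs_nonneg _).trans (hG 0 le_rfl)
  have key : ∀ v, 0 ≤ v → v ≤ u → |Real.exp v * smoothSum l δ v - c * Real.exp (2 * v)| ≤
      Real.exp u * ((1 + 2 * u) ^ 2 * B) := by
    intro v hv hvu
    rw [two_mul, Real.exp_add, mul_left_comm, ← mul_sub, abs_mul, Real.abs_exp]
    refine mul_le_mul (Real.exp_le_exp.2 hvu) ((hG v hv).trans ?_) (abs_nonneg _)
      (Real.exp_pos _).le
    gcongr
  have k0 := abs_le.1 (key u (by linarith) le_rfl)
  have k1 := abs_le.1 (key (u - δ) (by linarith) (by linarith))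
  have k2 := abs_le.1 (key (u - 2 * δ) (by linarith) (by linarith))
  have r1 := rieszSum_le hfin hδ (by linarith) u
  have r2 := le_rieszSum hfin hδ (by linarith) u
  refine ⟨by linarith [k0.2], ?_⟩
  have e1 : Real.exp (2 * (u - δ)) = Real.exp (-(2 * δ)) * Real.exp (2 * u) := by
    rw [← Real.exp_add]; ring_nf
  have e2 : Real.exp (2 * (u - 2 * δ)) = Real.exp (-(4 * δ)) * Real.exp (2 * u) := by
    rw [← Real.exp_add]; ring_nf
  rw [e1] at k1
  rw [e2] at k2
  have : c * (2 * Real.exp (-(2 * δ)) - Real.exp (-(4 * δ))) * Real.exp (2 * u) =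
    2 * (c * (Real.exp (-(2 * δ)) * Real.exp (2 * u))) -
      c * (Real.exp (-(4 * δ)) * Real.exp (2 * u)) := by ring
  rw [this]
  linarith [k1.1, k2.2]

lemma abs_rieszSum_sub_le {κ : ℝ}
    (hF : Tendsto (fun u => rieszSum l u / Real.exp (2 * u)) atTop (nhds (κ / 2)))
    {δ c N E : ℝ} (hδ : 0 < δ) (hδ1 : δ ≤ 1 / 4)
    (hG : ∀ u, 0 ≤ u →
      |smoothSum l δ u - c * Real.exp u| ≤ (1 + 2 * u) ^ 2 * (3 * (N + |c|) + E)) {u : ℝ}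
    (hu : 2 * δ ≤ u) :
    |rieszSum l u - κ / 2 * Real.exp (2 * u)| ≤ 4 * κ * δ ^ 2 * Real.exp (2 * u) +
      3 * (Real.exp u * ((1 + 2 * u) ^ 2 * (3 * (N + κ) + E))) := by
  have hκ : 0 ≤ κ := by
    have : 0 ≤ κ / 2 := ge_of_tendsto' hF fun u => by
      have := rieszSum_nonneg (l := l) u
      positivity
    linarith
  have hz := tendsto_exp_mul_sq_div_exp (3 * (N + |c|) + E)
  have hb : ∀ v, 2 * δ ≤ v → _ := fun v hv => rieszSum_bounds hfin hδ hδ1 hG hv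
  have hc1 : κ / 2 ≤ c := by
    have h := tendsto_const_nhds (x := c) |>.add hz
    rw [add_zero] at h
    refine le_of_tendsto_of_tendsto hF h ?_
    filter_upwards [eventually_ge_atTop (2 * δ)] with v hv
    rw [div_le_iff₀ (Real.exp_pos _), add_mul, div_mul_cancel₀ _ (Real.exp_ne_zero _)]
    exact (hb v hv).1
  have hc2 : c * (2 * Real.exp (-(2 * δ)) - Real.exp (-(4 * δ))) ≤ κ / 2 := by
    have h := tendsto_const_nhds (x := c * (2 * Real.exp (-(2 * δ)) - Real.exp (-(4 * δ))))
      |>.sub (hz.const_mul 3)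
    rw [mul_zero, sub_zero] at h
    refine le_of_tendsto_of_tendsto h hF ?_
    filter_upwards [eventually_ge_atTop (2 * δ)] with v hv
    rw [le_div_iff₀ (Real.exp_pos _), sub_mul, mul_assoc 3, div_mul_cancel₀ _ (Real.exp_ne_zero _)]
    exact (hb v hv).2
  have hq : 1 - 4 * δ ^ 2 ≤ 2 * Real.exp (-(2 * δ)) - Real.exp (-(4 * δ)) := by
    have e1 : Real.exp (-(4 * δ)) = Real.exp (-(2 * δ)) ^ 2 := by
      rw [← Real.exp_nat_mul]; push_cast; ring_nf
    have e2 := Real.add_one_le_exp (-(2 * δ))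
    have e3 : Real.exp (-(2 * δ)) ≤ 1 := Real.exp_le_one_iff.2 (by linarith)
    rw [e1]
    nlinarith
  have hc0 : 0 ≤ c := by linarith
  have hδ2 : δ ^ 2 ≤ 1 / 16 := by nlinarith
  have hc3 : c * (1 - 4 * δ ^ 2) ≤ κ / 2 := (mul_le_mul_of_nonneg_left hq hc0).trans hc2
  have hcκ : c ≤ κ := by nlinarith
  have hc4 : c ≤ κ / 2 + 4 * κ * δ ^ 2 := by nlinarith [sq_nonneg δ]
  have hc5 : κ / 2 - 4 * κ * δ ^ 2 ≤ c * (2 * Real.exp (-(2 * δ)) - Real.exp (-(4 * δ))) := by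
    refine le_trans ?_ (mul_le_mul_of_nonneg_left hq hc0)
    nlinarith [sq_nonneg δ]
  have hB : Real.exp u * ((1 + 2 * u) ^ 2 * (3 * (N + |c|) + E)) ≤
      Real.exp u * ((1 + 2 * u) ^ 2 * (3 * (N + κ) + E)) := by
    rw [abs_of_nonneg hc0]
    gcongr
  have hB0 : 0 ≤ Real.exp u * ((1 + 2 * u) ^ 2 * (3 * (N + |c|) + E)) :=
    mul_nonneg (Real.exp_pos _).le ((abs_nonneg _).trans (hG u (by linarith)))
  have he := (Real.exp_pos (2 * u)).le
  obtain ⟨b1, b2⟩ := hb u hu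
  have c4 := mul_le_mul_of_nonneg_right hc4 he
  have c5 := mul_le_mul_of_nonneg_right hc5 he
  rw [abs_le]
  constructor <;> nlinarith

/-- A Tauberian estimate with power saving for `rieszSum`. -/
theorem exists_abs_rieszSum_sub_le {κ e : ℝ} (he : 1 < e)
    (hF : Tendsto (fun u => rieszSum l u / Real.exp (2 * u)) atTop (nhds (κ / 2)))
    (H : ∃ C, 0 ≤ C ∧ ∀ g, IsWeight e 3 g → ∃ c : ℂ, ∀ u, 0 ≤ u →
      ‖∑' i, g (l i - u) - c * (Real.exp u : ℂ)‖ ≤ C * fourierNorm e g) :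
    ∃ C, 0 ≤ C ∧ ∀ u, 1 ≤ u → |rieszSum l u - κ / 2 * Real.exp (2 * u)| ≤
      C * (1 + 2 * u) ^ 2 * Real.exp (u * (1 + (e - 1) / (e + 1))) := by
  obtain ⟨C, N, hC, hN, hG⟩ := exists_abs_smoothSum_sub_le hfin he H
  have hκ : 0 ≤ κ := by
    have : 0 ≤ κ / 2 := ge_of_tendsto' hF fun u => by
      have := rieszSum_nonneg (l := l) u
      positivity
    linarith
  refine ⟨4 * κ + 3 * (3 * (N + κ) + C * (1 / 4) ^ (-(e - 1))), by positivity, fun u hu => ?_⟩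
  set δ : ℝ := 1 / 4 * Real.exp (-(u / (e + 1))) with hδ
  have h1 : Real.exp (-(u / (e + 1))) ≤ 1 :=
    Real.exp_le_one_iff.2 (neg_nonpos.2 (div_nonneg (by linarith) (by linarith)))
  have hδ0 : 0 < δ := by positivity
  have hδ1 : δ ≤ 1 / 4 := by linarith
  obtain ⟨c, hc⟩ := hG δ hδ0 (by linarith)
  refine (abs_rieszSum_sub_le hfin hF hδ0 hδ1 hc (by linarith)).trans ?_
  set X := Real.exp (u * (1 + (e - 1) / (e + 1))) with hX
  have hX0 : 0 < X := Real.exp_pos _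
  have k1 : δ ^ 2 * Real.exp (2 * u) ≤ X := by
    rw [hδ, mul_pow, ← Real.exp_nat_mul, mul_assoc, ← Real.exp_add, hX]
    have : ((2 : ℕ) : ℝ) * -(u / (e + 1)) + 2 * u = u * (1 + (e - 1) / (e + 1)) := by
      push_cast
      field_simp
      ring
    rw [this]
    nlinarith
  have k2 : Real.exp u * δ ^ (-(e - 1)) = (1 / 4) ^ (-(e - 1)) * X := by
    rw [hδ, Real.mul_rpow (by norm_num) (Real.exp_pos _).le, ← Real.exp_mul, mul_left_comm,
      ← Real.exp_add, hX]
    congr 2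
    field_simp
  have k3 : Real.exp u ≤ X := by
    rw [hX, Real.exp_le_exp]
    have : 0 ≤ u * ((e - 1) / (e + 1)) :=
      mul_nonneg (by linarith) (div_nonneg (by linarith) (by linarith))
    linarith
  have hP : 1 ≤ (1 + 2 * u) ^ 2 := by nlinarith
  have l1 : 4 * κ * δ ^ 2 * Real.exp (2 * u) ≤ 4 * κ * (1 + 2 * u) ^ 2 * X := by
    rw [mul_assoc (4 * κ), mul_assoc (4 * κ)]
    refine mul_le_mul_of_nonneg_left (k1.trans ?_) (by positivity)
    exact le_mul_of_one_le_left hX0.le hP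
  have l2 : Real.exp u * ((1 + 2 * u) ^ 2 * (3 * (N + κ) + C * δ ^ (-(e - 1)))) ≤
      (3 * (N + κ) + C * (1 / 4) ^ (-(e - 1))) * (1 + 2 * u) ^ 2 * X := by
    have : Real.exp u * ((1 + 2 * u) ^ 2 * (3 * (N + κ) + C * δ ^ (-(e - 1)))) =
      (1 + 2 * u) ^ 2 * (3 * (N + κ) * Real.exp u + C * (Real.exp u * δ ^ (-(e - 1)))) := by ring
    have h3 : 3 * (N + κ) * Real.exp u ≤ 3 * (N + κ) * X := by gcongr
    have h4 := mul_le_mul_of_nonneg_left h3 (zero_le_one.trans hP)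
    rw [this, k2]
    linarith
  linarith

end Tauberian

section Counting

open scoped nonZeroDivisors

variable (K : Type*) [Field K] [NumberField K]

lemma sum_rK_eq_card (n : ℕ) : ∑ m ∈ Finset.Icc 1 n, rK K m =
    Nat.card {I : (Ideal (𝓞 K))⁰ // Ideal.absNorm (I : Ideal (𝓞 K)) ≤ n} := by
  unfold rK
  symm
  rw [← add_left_inj 1, ← Ideal.card_norm_le_eq_card_norm_le_add_one,
    show Finset.Icc 1 n = Finset.Ioc 0 n from Finset.Icc_succ_left_eq_Ioc _ _,
    show 1 = Nat.card {I : Ideal (𝓞 K) // Ideal.absNorm I = 0} by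
      simp [Ideal.absNorm_eq_zero_iff],
    Finset.sum_Ioc_add_eq_sum_Icc (n.zero_le),
    ← Finset.card_preimage_eq_sum_card_image_eq
      (fun k _ ↦ Ideal.finite_setOfPred_absNorm_eq k)]
  simp [Set.coe_eq_subtype]

lemma tendsto_sum_rK_div :
    Tendsto (fun t : ℝ => (∑ m ∈ Finset.Icc 1 ⌊t⌋₊, (rK K m : ℝ)) / t) atTop
      (nhds (dedekindZeta_residue K)) := by
  refine (NumberField.Ideal.tendsto_norm_le_div_atTop₀ K).congr' ?_
  filter_upwards [eventually_ge_atTop 0] with t ht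
  rw [← Nat.cast_sum, sum_rK_eq_card]
  simp_rw [Nat.le_floor_iff ht]

lemma eq_dedekindZeta_residue {κ : ℝ}
    (hκ : Tendsto (fun s : ℝ => (s - 1) * ∑' m : ℕ, (rK K m : ℝ) / (m : ℝ) ^ s)
      (nhdsWithin 1 (Ioi 1)) (nhds κ)) : κ = dedekindZeta_residue K := by
  have h1 := tendsto_sub_one_mul_dedekindZeta_nhdsGT K
  have h2 := (Complex.continuous_ofReal.tendsto κ).comp hκ
  refine Complex.ofReal_injective (tendsto_nhds_unique h2 (h1.congr' ?_))
  filter_upwards [self_mem_nhdsWithin] with s hs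
  have hs0 : s ≠ 0 := by
    have : (1 : ℝ) < s := hs
    linarith
  simp only [Function.comp_apply, Complex.ofReal_mul, Complex.ofReal_sub, Complex.ofReal_one,
    Complex.ofReal_tsum]
  congr 1
  refine tsum_congr fun m => ?_
  rcases eq_or_ne m 0 with rfl | hm
  · simp [LSeries.term_zero, Real.zero_rpow hs0]
  · rw [LSeries.term_of_ne_zero hm, Complex.ofReal_div, Complex.ofReal_cpow (Nat.cast_nonneg m)]
    rfl

/-- The logarithms of the norms of the nonzero ideals. -/
noncomputable def logNorm (I : (Ideal (𝓞 K))⁰) : ℝ :=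
  Real.log (Ideal.absNorm (I : Ideal (𝓞 K)))

variable {K} in
lemma exp_logNorm (I : (Ideal (𝓞 K))⁰) :
    Real.exp (logNorm K I) = Ideal.absNorm (I : Ideal (𝓞 K)) :=
  Real.exp_log (by exact_mod_cast Ideal.absNorm_pos_of_nonZeroDivisors I)

lemma finite_logNorm_le (T : ℝ) : {I | logNorm K I ≤ T}.Finite := by
  refine (Ideal.finite_setOfPred_absNorm_le₀ (S := 𝓞 K) ⌊Real.exp T⌋₊).subset fun I hI => ?_
  refine Nat.le_floor ?_
  rw [← exp_logNorm]
  exact Real.exp_le_exp.2 hI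

lemma sum_rK_eq_sum_indicator {t x : ℝ} (ht : 0 ≤ t) (hx : 0 < x) (htx : t ≤ x) :
    (∑ m ∈ Finset.Icc 1 ⌊t⌋₊, (rK K m : ℝ)) =
      ∑ I ∈ (finite_logNorm_le K (Real.log x)).toFinset,
        if (Ideal.absNorm (I : Ideal (𝓞 K)) : ℝ) ≤ t then (1 : ℝ) else 0 := by
  classical
  rw [← Nat.cast_sum, sum_rK_eq_card, Finset.sum_ite, Finset.sum_const_zero, add_zero,
    Finset.sum_const, nsmul_one]
  congr 1
  refine Nat.subtype_card _ fun I => ?_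
  rw [Finset.mem_filter, Set.Finite.mem_toFinset, mem_ofPred_eq, Nat.le_floor_iff ht]
  refine ⟨fun h => h.2, fun h => ⟨?_, h⟩⟩
  rw [← Real.exp_le_exp, exp_logNorm, Real.exp_log hx]
  exact h.trans htx

lemma integral_ite_le {a x : ℝ} (ha : 1 ≤ a) (hx : 1 ≤ x) :
    IntervalIntegrable (fun t => if a ≤ t then (1 : ℝ) else 0) volume 1 x ∧
    ∫ t in (1 : ℝ)..x, (if a ≤ t then (1 : ℝ) else 0) = max (x - a) 0 := by
  have h : (fun t : ℝ => if a ≤ t then (1 : ℝ) else 0) = (Ici a).indicator fun _ => 1 := by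
    ext t
    simp [indicator_apply]
  constructor
  · rw [h, intervalIntegrable_iff]
    exact (integrable_indicator_iff measurableSet_Ici).2
      (integrableOn_const (by
        rw [Measure.restrict_apply measurableSet_Ici]
        exact ((measure_mono inter_subset_right).trans_lt (by simp [uIoc])).ne))
  · rw [h, intervalIntegral.integral_of_le hx, integral_indicator measurableSet_Ici,
      Measure.restrict_restrict measurableSet_Ici]
    simp only [integral_const, smul_eq_mul, mul_one, measureReal_restrict_apply_univ]
    rw [measureReal_congr (t := Ioc a x)]
    · rw [Real.volume_real_Ioc]
    · refine (ae_eq_set_inter Ioi_ae_eq_Ici.symm (ae_eq_refl _)).trans ?_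
      rw [← Ioi_inter_Iic, ← inter_assoc, Ioi_inter_Ioi, sup_eq_left.2 ha, Ioi_inter_Iic]
      rfl

lemma intervalIntegral_sum_rK {x : ℝ} (hx : 1 ≤ x) :
    IntervalIntegrable (fun t => ∑ m ∈ Finset.Icc 1 ⌊t⌋₊, (rK K m : ℝ)) volume 1 x ∧
    ∫ t in (1 : ℝ)..x, ∑ m ∈ Finset.Icc 1 ⌊t⌋₊, (rK K m : ℝ) =
      rieszSum (logNorm K) (Real.log x) := by
  have hx0 : 0 < x := by linarith
  have h1 : ∀ I : (Ideal (𝓞 K))⁰, (1 : ℝ) ≤ Ideal.absNorm (I : Ideal (𝓞 K)) := fun I => by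
    exact_mod_cast Ideal.absNorm_pos_of_nonZeroDivisors I
  have heq : EqOn (fun t => ∑ I ∈ (finite_logNorm_le K (Real.log x)).toFinset,
      if (Ideal.absNorm (I : Ideal (𝓞 K)) : ℝ) ≤ t then (1 : ℝ) else 0)
      (fun t => ∑ m ∈ Finset.Icc 1 ⌊t⌋₊, (rK K m : ℝ)) (uIcc 1 x) := fun t ht => by
    rw [uIcc_of_le hx] at ht
    exact (sum_rK_eq_sum_indicator K (by linarith [ht.1]) hx0 ht.2).symm
  constructor
  · refine IntervalIntegrable.congr (heq.mono uIoc_subset_uIcc) ?_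
    have h := IntervalIntegrable.sum (finite_logNorm_le K (Real.log x)).toFinset
      fun I _ => (integral_ite_le (h1 I) hx).1
    rwa [Finset.sum_fn] at h
  · rw [← intervalIntegral.integral_congr heq, intervalIntegral.integral_finsetSum
      fun I _ => (integral_ite_le (h1 I) hx).1, rieszSum_eq_sum
      (finite_logNorm_le K (Real.log x)).toFinset (fun I hI => by simpa using hI) le_rfl]
    refine Finset.sum_congr rfl fun I _ => ?_
    rw [(integral_ite_le (h1 I) hx).2, Real.exp_log hx0, exp_logNorm]

lemma tendsto_integral_div_sq {A : ℝ → ℝ} {κ : ℝ}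
    (hA : ∀ x, 1 ≤ x → IntervalIntegrable A volume 1 x)
    (h : Tendsto (fun t => A t / t) atTop (nhds κ)) :
    Tendsto (fun x : ℝ => (∫ t in (1 : ℝ)..x, A t) / x ^ 2) atTop (nhds (κ / 2)) := by
  have hR : ∀ x, 1 ≤ x → IntervalIntegrable (fun t => A t - κ * t) volume 1 x := fun x hx =>
    (hA x hx).sub (Continuous.intervalIntegrable (by fun_prop) _ _)
  have hinv : Tendsto (fun x : ℝ => (x ^ 2)⁻¹) atTop (nhds 0) :=
    (tendsto_pow_atTop two_ne_zero).inv_tendsto_atTop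
  have key : Tendsto (fun x : ℝ => (∫ t in (1 : ℝ)..x, (A t - κ * t)) / x ^ 2) atTop (nhds 0) := by
    rw [Metric.tendsto_nhds]
    intro ε hε
    obtain ⟨T, hT⟩ := eventually_atTop.1 (Metric.tendsto_nhds.1 h ε hε)
    set S : ℝ := max T 1 with hS
    have h3 := hinv.const_mul |∫ t in (1 : ℝ)..S, (A t - κ * t)|
    rw [mul_zero] at h3
    filter_upwards [eventually_ge_atTop S, h3.eventually_lt_const (half_pos hε)] with x hx hx3
    have hS1 : 1 ≤ S := le_max_right _ _
    have hx0 : 0 < x ^ 2 := by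
      have : 0 < x := by linarith
      positivity
    have h4 : |∫ t in S..x, (A t - κ * t)| ≤ ∫ t in S..x, ε * t := by
      rw [← Real.norm_eq_abs]
      refine intervalIntegral.norm_integral_le_of_norm_le hx (ae_of_all _ fun t ht => ?_)
        (Continuous.intervalIntegrable (by fun_prop) _ _)
      have ht0 : 0 < t := by linarith [ht.1]
      have h5 := hT t ((le_max_left T 1).trans ht.1.le)
      rw [Real.dist_eq, div_sub' ht0.ne', abs_div, abs_of_pos ht0, div_lt_iff₀ ht0,
        mul_comm t] at h5
      exact h5.le
    rw [intervalIntegral.integral_const_mul, integral_id] at h4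
    rw [dist_zero_right, Real.norm_eq_abs, abs_div, abs_of_pos hx0, div_lt_iff₀ hx0,
      ← intervalIntegral.integral_add_adjacent_intervals (hR S hS1)
        ((hR S hS1).symm.trans (hR x (hS1.trans hx)))]
    refine (abs_add_le _ _).trans_lt ?_
    rw [← div_eq_mul_inv, div_lt_iff₀ hx0] at hx3
    nlinarith [sq_nonneg S]
  have h2 := (key.add_const (κ / 2)).sub (hinv.const_mul (κ / 2))
  rw [mul_zero, sub_zero, zero_add] at h2
  refine h2.congr' ?_
  filter_upwards [eventually_ge_atTop 1] with x hx
  have hx0 : x ≠ 0 := by linarith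
  rw [intervalIntegral.integral_sub (hA x hx) (Continuous.intervalIntegrable (by fun_prop) _ _),
    intervalIntegral.integral_const_mul, integral_id]
  field_simp
  ring

lemma tendsto_rieszSum_logNorm : Tendsto
    (fun u => rieszSum (logNorm K) u / Real.exp (2 * u)) atTop
    (nhds (dedekindZeta_residue K / 2)) := by
  have h := (tendsto_integral_div_sq (fun x hx => (intervalIntegral_sum_rK K hx).1)
    (tendsto_sum_rK_div K)).comp Real.tendsto_exp_atTop
  refine h.congr' ?_
  filter_upwards [eventually_ge_atTop 0] with u hu
  rw [Function.comp_apply, (intervalIntegral_sum_rK K (Real.one_le_exp hu)).2, Real.log_exp,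
    ← Real.exp_nat_mul, Nat.cast_two]

lemma one_add_two_mul_log_sq_le {ε x : ℝ} (hε : 0 < ε) (hx : Real.exp 1 ≤ x) :
    (1 + 2 * Real.log x) ^ 2 ≤ (12 / ε) ^ 2 * x ^ (ε / 2) := by
  have hx0 : 0 < x := (Real.exp_pos 1).trans_le hx
  have h1 : 1 ≤ Real.log x := (Real.le_log_iff_exp_le hx0).2 hx
  have h2 := Real.log_le_rpow_div hx0.le (show 0 < ε / 4 by positivity)
  have h3 : 1 + 2 * Real.log x ≤ 12 / ε * x ^ (ε / 4) := by
    have : 3 * (x ^ (ε / 4) / (ε / 4)) = 12 / ε * x ^ (ε / 4) := by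
      field_simp
      ring
    linarith
  have h4 : x ^ (ε / 2) = (x ^ (ε / 4)) ^ 2 := by
    rw [← Real.rpow_natCast, ← Real.rpow_mul hx0.le]
    congr 1
    push_cast
    ring
  rw [h4, ← mul_pow]
  exact pow_le_pow_left₀ (by linarith) h3 2

lemma exponent_le {n ε : ℝ} (hn2 : 2 ≤ n) (hn6 : n ≤ 6) (hε : 0 < ε) :
    (n / 2 + ε - 1) / (n / 2 + ε + 1) + ε / 2 ≤ 3 / 4 - 3 / (2 * n) + ε := by
  have h1 : (n / 2 + ε - 1) / (n / 2 + ε + 1) ≤ (n - 2) / (n + 2) + ε / 2 := by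
    rw [div_add_div _ _ (by linarith) two_ne_zero, div_le_div_iff₀ (by linarith) (by linarith)]
    nlinarith [mul_nonneg hε.le hε.le, mul_nonneg hε.le (sub_nonneg.2 hn2),
      mul_nonneg (mul_nonneg hε.le hε.le) (sub_nonneg.2 hn2),
      mul_nonneg (mul_nonneg hε.le (sub_nonneg.2 hn2)) (sub_nonneg.2 hn2)]
  have h2 : (n - 2) / (n + 2) ≤ 3 / 4 - 3 / (2 * n) := by
    rw [div_sub_div _ _ (by norm_num) (by linarith), div_le_div_iff₀ (by linarith) (by linarith)]
    nlinarith [mul_nonneg (sub_nonneg.2 hn2) (sub_nonneg.2 hn6)]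
  linarith

/-- The mean of the remainder in the ideal theorem is `O(x ^ (3/4 - 3/(2n) + ε))`. -/
theorem exists_abs_mean_le (hn2 : 2 ≤ Module.finrank ℚ K) (hn6 : Module.finrank ℚ K ≤ 6)
    {ε : ℝ} (hε : 0 < ε) :
    ∃ C > 0, ∀ x : ℝ, Real.exp 1 ≤ x →
      |(1 / x) * ∫ t in (1 : ℝ)..x,
          ((∑ m ∈ Finset.Icc 1 ⌊t⌋₊, (rK K m : ℝ)) - dedekindZeta_residue K * t)|
        ≤ C * x ^ ((3 : ℝ) / 4 - 3 / (2 * (Module.finrank ℚ K : ℝ)) + ε) := by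
  have hn2' : (2 : ℝ) ≤ Module.finrank ℚ K := by exact_mod_cast hn2
  have hn6' : (Module.finrank ℚ K : ℝ) ≤ 6 := by exact_mod_cast hn6
  have hκ := (dedekindZeta_residue_pos K).le
  set κ := dedekindZeta_residue K
  obtain ⟨C, hC, h⟩ := exists_abs_rieszSum_sub_le (finite_logNorm_le K)
    (e := (Module.finrank ℚ K : ℝ) / 2 + ε) (by linarith) (tendsto_rieszSum_logNorm K)
    (exists_norm_tsum_ideal_sub_le (K := K) (by linarith) 3)
  have hρ := exponent_le hn2' hn6' hε
  have hθ : 0 ≤ ((Module.finrank ℚ K : ℝ) / 2 + ε - 1) / ((Module.finrank ℚ K : ℝ) / 2 + ε + 1) :=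
    div_nonneg (by linarith) (by linarith)
  set θ := ((Module.finrank ℚ K : ℝ) / 2 + ε - 1) / ((Module.finrank ℚ K : ℝ) / 2 + ε + 1)
  set ρ := (3 : ℝ) / 4 - 3 / (2 * (Module.finrank ℚ K : ℝ)) + ε
  refine ⟨C * (12 / ε) ^ 2 + κ / 2 + 1, by positivity, fun x hx => ?_⟩
  have hx1 : 1 ≤ x := (Real.one_le_exp zero_le_one).trans hx
  have hx0 : 0 < x := by linarith
  obtain ⟨i1, i2⟩ := intervalIntegral_sum_rK K hx1
  have hb := h (Real.log x) ((Real.le_log_iff_exp_le hx0).2 hx)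
  have e1 : Real.exp (2 * Real.log x) = x ^ 2 := by
    rw [two_mul, Real.exp_add, Real.exp_log hx0, sq]
  have e2 : Real.exp (Real.log x * (1 + θ)) = x * x ^ θ := by
    rw [← Real.rpow_def_of_pos hx0, Real.rpow_add hx0, Real.rpow_one]
  rw [e1, e2] at hb
  have hxρ : 1 ≤ x ^ ρ := Real.one_le_rpow hx1 (by linarith)
  have h2 : (1 + 2 * Real.log x) ^ 2 * x ^ θ ≤ (12 / ε) ^ 2 * x ^ ρ := by
    refine (mul_le_mul_of_nonneg_right (one_add_two_mul_log_sq_le hε hx) (by positivity)).trans ?_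
    rw [mul_assoc, ← Real.rpow_add hx0]
    exact mul_le_mul_of_nonneg_left (Real.rpow_le_rpow_of_exponent_le hx1 (by linarith))
      (by positivity)
  rw [intervalIntegral.integral_sub i1 (Continuous.intervalIntegrable (by fun_prop) _ _), i2,
    intervalIntegral.integral_const_mul, integral_id, abs_mul, abs_of_pos (one_div_pos.2 hx0),
    one_div_mul_eq_div, div_le_iff₀ hx0]
  have h3 : |rieszSum (logNorm K) (Real.log x) - κ * ((x ^ 2 - 1 ^ 2) / 2)| ≤
      C * (1 + 2 * Real.log x) ^ 2 * (x * x ^ θ) + κ / 2 := by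
    rw [show rieszSum (logNorm K) (Real.log x) - κ * ((x ^ 2 - 1 ^ 2) / 2) =
      rieszSum (logNorm K) (Real.log x) - κ / 2 * x ^ 2 + κ / 2 by ring]
    refine (abs_add_le _ _).trans (add_le_add hb (le_of_eq (abs_of_nonneg (by positivity))))
  refine h3.trans ?_
  have h4 : C * (1 + 2 * Real.log x) ^ 2 * (x * x ^ θ) ≤ C * ((12 / ε) ^ 2 * x ^ ρ) * x := by
    rw [show C * (1 + 2 * Real.log x) ^ 2 * (x * x ^ θ) =
      C * ((1 + 2 * Real.log x) ^ 2 * x ^ θ) * x by ring]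
    gcongr
  have h5 : κ / 2 * 1 ≤ κ / 2 * (x ^ ρ * x) := by
    gcongr
    exact one_le_mul_of_one_le_of_one_le hxρ hx1
  have h6 : 0 ≤ x ^ ρ * x := by positivity
  nlinarith

end Counting

end IdealMean

/-- Mean-value estimate for the remainder in the ideal theorem, degree `2 ≤ n ≤ 6`:
`(1/x) ∫₁ˣ (∑_{m ≤ t} r_K(m) - κ_K t) dt = O(x^{3/4-3/(2n)+ε})` for `x ≥ d_K^{1/2}` large. -/
theorem stmt2 (K : Type*) [Field K] [NumberField K]
    (hn2 : 2 ≤ Module.finrank ℚ K) (hn6 : Module.finrank ℚ K ≤ 6)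
    (κ : ℝ)
    (hκ : Filter.Tendsto
      (fun s : ℝ => (s - 1) * ∑' m : ℕ, (rK K m : ℝ) / (m : ℝ) ^ s)
      (nhdsWithin 1 (Set.Ioi 1)) (nhds κ))
    (ε : ℝ) (hε : ε ∈ Set.Ioo (0 : ℝ) (1/2)) :
    ∃ C > 0, ∀ᶠ x : ℝ in atTop,
      Real.sqrt |(NumberField.discr K : ℝ)| ≤ x →
      |(1 / x) * ∫ t in (1:ℝ)..x,
          ((∑ m ∈ Finset.Icc 1 ⌊t⌋₊, (rK K m : ℝ)) - κ * t)|
        ≤ C * x ^ ((3 : ℝ)/4 - 3 / (2 * (Module.finrank ℚ K : ℝ)) + ε) := by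
  obtain ⟨C, hC, h⟩ := IdealMean.exists_abs_mean_le K hn2 hn6 hε.1
  refine ⟨C, hC, ?_⟩
  filter_upwards [eventually_ge_atTop (Real.exp 1)] with x hx _
  rw [IdealMean.eq_dedekindZeta_residue K hκ]
  exact h x hx
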